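/- Fix an integer n ≥ 1. As T → ∞ through admissible values, (∑_{0<γ≤T} ζ^{(n)}(ρ)) / ((T/2π) log^{n+1}(T/2π)) tends to the real number (−1)^{n+1}/(n+1). In particular ζ^{(n)}(ρ) is real and positive in the mean when n is odd, and real and negative in the mean when n is even. -/

import Mathlib

open Complex Filter Finset

/-- The order of vanishing of the Riemann zeta function at a point `ρ`:
the least `k` such that the `k`-th derivative of `ζ` is nonzero at `ρ`. -/
noncomputable def zetaZeroOrder (ρ : ℂ) : ℕ :=
  sInf {k : ℕ | iteratedDeriv k riemannZeta ρ ≠ 0}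

/-- A non-trivial zero of the Riemann zeta function. -/
def IsNontrivialZero (ρ : ℂ) : Prop :=
  riemannZeta ρ = 0 ∧ 0 < ρ.re ∧ ρ.re < 1

/-- `∑_{0<γ≤T} ζ^{(n)}(ρ)`, the sum of the `n`-th derivative of `ζ` over the
non-trivial zeros `ρ = β + iγ` with `0 < γ ≤ T`, counted with multiplicity. -/
noncomputable def zetaZeroSum (n : ℕ) (T : ℝ) : ℂ :=
  ∑ᶠ ρ ∈ {ρ : ℂ | IsNontrivialZero ρ ∧ 0 < ρ.im ∧ ρ.im ≤ T},
    (zetaZeroOrder ρ : ℂ) * iteratedDeriv n riemannZeta ρ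

/-- `T` is admissible: `|T - γ| ≥ δ / log T` for every ordinate `γ` of a
non-trivial zero of `ζ`. -/
def AdmissibleHeight (δ T : ℝ) : Prop :=
  ∀ ρ : ℂ, IsNontrivialZero ρ → δ / Real.log T ≤ |T - ρ.im|

namespace Shanks

lemma norm_cpow_neg {x : ℝ} (hx : 0 < x) (s : ℂ) : ‖(x:ℂ) ^ (-s)‖ = x ^ (-s.re) := by
  rw [Complex.norm_cpow_eq_rpow_re_of_pos hx]; simp

lemma cpow_diff_bd {m x y : ℝ} (hm : 0 < m) (hx : m ≤ x) (hy : x ≤ y) (s : ℂ) (hs : 0 < s.re) :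
    ‖(y:ℂ) ^ (-s) - (x:ℂ) ^ (-s)‖ ≤ ‖s‖ * m ^ (-s.re - 1) * (y - x) := by
  have key : ∀ u ∈ Set.Icc x y, HasDerivWithinAt (fun u : ℝ => (u:ℂ) ^ (-s)) (-s * (u:ℂ) ^ (-s - 1)) (Set.Icc x y) u := by
    intro u hu
    have hu0 : 0 < u := by linarith [hu.1]
    have := (hasDerivAt_id (u:ℂ)).cpow_const (c := -s) (Or.inl (by simpa using hu0))
    simpa using (this.comp_ofReal).hasDerivWithinAt
  have := (convex_Icc x y).norm_image_sub_le_of_norm_hasDerivWithin_le (C := ‖s‖ * m ^ (-s.re - 1)) key ?_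
    (Set.left_mem_Icc.2 hy) (Set.right_mem_Icc.2 hy)
  · simpa [abs_of_nonneg (sub_nonneg.2 hy)] using this
  · intro u hu
    have hu0 : 0 < u := by linarith [hu.1]
    rw [norm_mul, norm_neg, Complex.norm_cpow_eq_rpow_re_of_pos hu0]
    gcongr
    simp only [sub_re, neg_re, one_re]
    exact Real.rpow_le_rpow_of_nonpos hm (by linarith [hu.1]) (by linarith)

/-- remainder term -/
noncomputable def Rm (m : ℝ) (s : ℂ) : ℂ :=
  (s - 1) * ((m + 1 : ℝ):ℂ) ^ (-s) + ((m + 1 : ℝ):ℂ) ^ (1 - s) - (m:ℂ) ^ (1 - s)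

lemma Rm_bd {m : ℝ} (hm : 0 < m) (s : ℂ) (hs : 0 < s.re) :
    ‖Rm m s‖ ≤ ‖s - 1‖ * ‖s‖ * m ^ (-s.re - 1) := by
  set c : ℂ := ((m + 1 : ℝ):ℂ) ^ (-s)
  have key : ∀ u ∈ Set.Icc m (m+1), HasDerivWithinAt (fun u : ℝ => (u:ℂ) ^ (1-s) + (s-1) * c * u)
      ((s - 1) * (c - (u:ℂ) ^ (-s))) (Set.Icc m (m+1)) u := by
    intro u hu
    have hu0 : 0 < u := by linarith [hu.1]
    have h1 := (hasDerivAt_id (u:ℂ)).cpow_const (c := 1-s) (Or.inl (by simpa using hu0))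
    have h2 := (hasDerivAt_id (u:ℂ)).const_mul ((s-1)*c)
    have := (h1.add h2).comp_ofReal.hasDerivWithinAt (s := Set.Icc m (m+1))
    have e : (1 - s - 1) = -s := by ring
    refine HasDerivWithinAt.congr_deriv this ?_
    rw [e]; simp only [id]; ring
  have := (convex_Icc m (m+1)).norm_image_sub_le_of_norm_hasDerivWithin_le (C := ‖s-1‖ * (‖s‖ * m ^ (-s.re - 1))) key ?_
    (Set.left_mem_Icc.2 (by linarith)) (Set.right_mem_Icc.2 (by linarith))
  · rw [mul_assoc]
    convert this using 1
    · congr 1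
      simp only [Rm, c]; push_cast; ring
    · simp
  · intro u hu
    rw [norm_mul]
    gcongr
    have h := cpow_diff_bd hm hu.1 hu.2 s hs
    refine h.trans ?_
    have : m + 1 - u ≤ 1 := by linarith [hu.1]
    have h0 : 0 ≤ ‖s‖ * m ^ (-s.re - 1) := by positivity
    nlinarith

lemma summable_shift {p : ℝ} (hp : p < -1) (N : ℕ) :
    Summable fun k : ℕ => ((N:ℝ) + k) ^ p := by
  have := (summable_nat_add_iff N).2 (Real.summable_nat_rpow.2 hp)
  refine this.congr fun k => ?_
  push_cast; rw [add_comm]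

lemma zeta_hasSum (s : ℂ) (hs : 1 < s.re) :
    HasSum (fun n : ℕ => ((n:ℂ) + 1) ^ (-s)) (riemannZeta s) := by
  have h := zeta_eq_tsum_one_div_nat_add_one_cpow hs
  have hsum : Summable (fun n : ℕ => 1 / ((n:ℂ) + 1) ^ s) := by
    have := (summable_nat_add_iff 1).2 (Complex.summable_one_div_nat_cpow.2 hs)
    simpa using this
  rw [h]
  have e : (fun n : ℕ => ((n:ℂ) + 1) ^ (-s)) = (fun n : ℕ => 1 / ((n:ℂ) + 1) ^ s) := by
    funext n; simp [Complex.cpow_neg]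
  rw [e]; exact hsum.hasSum

lemma Rm_tsum (N : ℕ) (hN : 1 ≤ N) (s : ℂ) (hs : 1 < s.re) :
    ∑' k : ℕ, Rm ((N:ℝ) + k) s = (s - 1) * (riemannZeta s - ∑ n ∈ range N, ((n:ℂ) + 1) ^ (-s))
      - (N:ℂ) ^ (1 - s) := by
  have hz := zeta_hasSum s hs
  have h1 : HasSum (fun k : ℕ => (((k + N : ℕ):ℂ) + 1) ^ (-s))
      (riemannZeta s - ∑ n ∈ range N, ((n:ℂ) + 1) ^ (-s)) := (hasSum_nat_add_iff' N).2 hz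
  have hR : Summable fun k : ℕ => Rm ((N:ℝ) + k) s := by
    refine Summable.of_norm_bounded (g := fun k : ℕ => ‖s - 1‖ * ‖s‖ * ((N:ℝ) + k) ^ (-s.re - 1)) ?_ ?_
    · exact (summable_shift (by linarith) N).mul_left _
    · intro k
      exact Rm_bd (by positivity) s (by linarith)
  refine HasSum.tsum_eq ?_
  rw [hR.hasSum_iff_tendsto_nat]
  have h2 := (h1.mul_left (s-1)).tendsto_sum_nat
  have h3 : Tendsto (fun n : ℕ => (((N + n : ℕ):ℝ):ℂ) ^ (1 - s)) atTop (nhds 0) := by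
    rw [tendsto_zero_iff_norm_tendsto_zero]
    have : Tendsto (fun n : ℕ => (((N + n : ℕ):ℝ)) ^ (-(s.re - 1))) atTop (nhds 0) := by
      refine (tendsto_rpow_neg_atTop (by linarith : 0 < s.re - 1)).comp ?_
      exact tendsto_natCast_atTop_atTop.comp (tendsto_atTop_mono (fun n => by simp) tendsto_id)
    refine this.congr fun n => ?_
    rw [Complex.norm_cpow_eq_rpow_re_of_pos (by positivity)]
    simp
  have h4 := (h2.add h3).sub_const ((N:ℂ) ^ (1 - s))
  rw [add_zero] at h4
  refine h4.congr fun n => ?_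
  induction n with
  | zero => simp
  | succ n ih =>
    rw [sum_range_succ, sum_range_succ, ← ih]
    simp only [Rm]
    push_cast
    rw [show (N:ℂ) + n + 1 = n + N + 1 by ring, show (N:ℂ) + (n + 1) = n + N + 1 by ring]
    ring

lemma zeta1_eq (N : ℕ) (hN : 1 ≤ N) (s : ℂ) (hs : 0 < s.re) :
    riemannZeta₁ s = (s - 1) * (∑ n ∈ range N, ((n:ℂ) + 1) ^ (-s)) + (N:ℂ) ^ (1 - s)
      + ∑' k : ℕ, Rm ((N:ℝ) + k) s := by
  set ε := s.re / 2 with hε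
  set R := ‖s‖ + 4 with hR
  set U : Set ℂ := {z | ε < z.re} ∩ Metric.ball 0 R with hU
  have hUo : IsOpen U := (isOpen_lt continuous_const continuous_re).inter Metric.isOpen_ball
  have hUc : Convex ℝ U := (convex_halfSpace_re_gt ε).inter (convex_ball 0 R)
  have hNC : (N:ℂ) ≠ 0 := by exact_mod_cast (by omega : N ≠ 0)
  have hd1 : DifferentiableOn ℂ (fun s => ∑' k : ℕ, Rm ((N:ℝ) + k) s) U := by
    refine differentiableOn_tsum_of_summable_norm (u := fun k : ℕ => (R + 1) * R * ((N:ℝ) + k) ^ (-ε - 1)) ?_ ?_ hUo ?_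
    · exact (summable_shift (by linarith) N).mul_left _
    · intro k
      have e1 : (((N:ℝ) + k + 1 : ℝ) : ℂ) ≠ 0 := by exact_mod_cast (by positivity : ((N:ℝ) + k + 1) ≠ 0)
      have e2 : (((N:ℝ) + k : ℝ) : ℂ) ≠ 0 := by exact_mod_cast (by positivity : ((N:ℝ) + k) ≠ 0)
      intro z _
      apply DifferentiableAt.differentiableWithinAt
      unfold Rm
      have := fun (c : ℂ) (hc : c ≠ 0) => (differentiableAt_id (𝕜 := ℂ) (x := z)).neg.const_cpow (c := c) (Or.inl hc)
      have h2 := fun (c : ℂ) (hc : c ≠ 0) => ((differentiableAt_id (𝕜 := ℂ) (x := z)).const_sub 1).const_cpow (c := c) (Or.inl hc)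
      exact (((differentiableAt_id.sub_const 1).mul (this _ e1)).add (h2 _ e1)).sub (h2 _ e2)
    · intro k z hz
      have hz1 : ε < z.re := hz.1
      have hz2 : ‖z‖ < R := by simpa using hz.2
      refine (Rm_bd (by positivity) z (by linarith)).trans ?_
      have h1 : ‖z - 1‖ ≤ R + 1 := by
        have := norm_sub_le z 1
        rw [norm_one] at this; linarith
      have h3 : ((N:ℝ) + k) ^ (-z.re - 1) ≤ ((N:ℝ) + k) ^ (-ε - 1) := by
        apply Real.rpow_le_rpow_of_exponent_le
        · have : (1:ℝ) ≤ N := by exact_mod_cast hN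
          have : (0:ℝ) ≤ k := by positivity
          linarith
        · linarith
      gcongr
  have hd2 : DifferentiableOn ℂ (fun s : ℂ => (s - 1) * (∑ n ∈ range N, ((n:ℂ) + 1) ^ (-s)) + (N:ℂ) ^ (1 - s)) U := by
    intro z _
    apply DifferentiableAt.differentiableWithinAt
    have h2 := ((differentiableAt_id (𝕜 := ℂ) (x := z)).const_sub 1).const_cpow (c := (N:ℂ)) (Or.inl hNC)
    refine ((differentiableAt_id.sub_const 1).mul ?_).add h2
    apply DifferentiableAt.fun_sum
    intro i _
    exact (differentiableAt_id (𝕜 := ℂ) (x := z)).neg.const_cpow (Or.inl (by exact_mod_cast (by omega : i + 1 ≠ 0)))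
  have hA := (differentiable_riemannZeta₁.differentiableOn (s := U)).analyticOnNhd hUo
  have hB := (hd2.add hd1).analyticOnNhd hUo
  have h3U : (s.re + 3/2 : ℝ) + (0:ℂ) ∈ U := by
    refine ⟨?_, ?_⟩
    · simp only [add_zero, Set.mem_ofPred_eq, ofReal_re]; linarith
    · simp only [add_zero, Metric.mem_ball, dist_zero_right, norm_real, Real.norm_eq_abs]
      rw [abs_of_pos (by linarith)]
      have := Complex.re_le_norm s
      linarith
  have heq := hA.eqOn_of_preconnected_of_eventuallyEq hB hUc.isPreconnected h3U ?_
  · have hsU : s ∈ U := by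
      refine ⟨?_, ?_⟩
      · simp only [Set.mem_ofPred_eq]; linarith
      · simp; linarith
    exact heq hsU
  · have hev : ∀ᶠ z : ℂ in nhds ((s.re + 3/2 : ℝ) + (0:ℂ)), 1 < z.re := by
      apply (isOpen_lt continuous_const continuous_re).mem_nhds
      simp only [add_zero, Set.mem_ofPred_eq, ofReal_re]; linarith
    filter_upwards [hev] with z hz
    have hz1 : z ≠ 1 := by rintro rfl; simp at hz
    have h5 := riemannZeta_eq_inv_sub_mul hz1
    have h6 : z - 1 ≠ 0 := sub_ne_zero.2 hz1
    simp only [Pi.add_apply]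
    rw [Rm_tsum N hN z hz, h5]
    field_simp
    ring

lemma rpow_step {x σ : ℝ} (hx : 0 < x) (hσ : 0 < σ) :
    σ * (x + 1) ^ (-σ - 1) ≤ x ^ (-σ) - (x + 1) ^ (-σ) := by
  have h1 : x ^ (-σ) = (x+1) ^ (-σ) * ((x+1)/x) ^ σ := by
    rw [Real.div_rpow (by positivity) hx.le, Real.rpow_neg hx.le, Real.rpow_neg (by positivity)]
    field_simp
  have h2 : 1 + σ / (x+1) ≤ ((x+1)/x) ^ σ := by
    rw [Real.rpow_def_of_pos (by positivity)]
    have h3 := Real.add_one_le_exp (Real.log ((x+1)/x) * σ)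
    have h4 := Real.one_sub_inv_le_log_of_pos (by positivity : 0 < (x+1)/x)
    have h5 : 1 - ((x+1)/x)⁻¹ = 1/(x+1) := by field_simp; ring
    rw [h5] at h4
    have : σ / (x+1) = 1/(x+1) * σ := by ring
    nlinarith
  have h6 : (x + 1) ^ (-σ - 1) = (x+1) ^ (-σ) / (x+1) := by
    rw [Real.rpow_sub_one (by positivity)]
  rw [h6, h1]
  have h7 : 0 < (x+1) ^ (-σ) := by positivity
  have : σ * ((x+1) ^ (-σ) / (x+1)) = (x+1) ^ (-σ) * (σ/(x+1)) := by ring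
  nlinarith

lemma tsum_shift_bd {σ : ℝ} (hσ : 0 < σ) (N : ℕ) (hN : 1 ≤ N) :
    ∑' k : ℕ, ((N:ℝ) + k) ^ (-σ - 1) ≤ (1 + 1/σ) * (N:ℝ) ^ (-σ) := by
  have hN' : (1:ℝ) ≤ N := by exact_mod_cast hN
  have hstep : ∀ n : ℕ, ∑ k ∈ range (n+1), ((N:ℝ) + k) ^ (-σ - 1) ≤
      (N:ℝ) ^ (-σ - 1) + 1/σ * ((N:ℝ) ^ (-σ) - ((N:ℝ) + n) ^ (-σ)) := by
    intro n
    induction n with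
    | zero => simp
    | succ n ih =>
      rw [sum_range_succ]
      have := rpow_step (x := (N:ℝ) + n) (by positivity) hσ
      have h2 : ((N:ℝ) + n + 1) ^ (-σ - 1) ≤ 1/σ * (((N:ℝ) + n) ^ (-σ) - ((N:ℝ) + n + 1) ^ (-σ)) := by
        rw [one_div, le_inv_mul_iff₀ hσ]; exact this
      push_cast
      rw [← add_assoc]
      linarith
  refine Real.tsum_le_of_sum_range_le (fun k => by positivity) ?_
  intro n
  have h1 : ∑ k ∈ range n, ((N:ℝ) + k) ^ (-σ - 1) ≤ ∑ k ∈ range (n+1), ((N:ℝ) + k) ^ (-σ - 1) := by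
    rw [sum_range_succ]
    have : 0 ≤ ((N:ℝ) + n) ^ (-σ - 1) := by positivity
    linarith
  have h2 : (N:ℝ) ^ (-σ - 1) ≤ (N:ℝ) ^ (-σ) := Real.rpow_le_rpow_of_exponent_le hN' (by linarith)
  have h3 : 0 ≤ 1/σ * ((N:ℝ) + n) ^ (-σ) := by positivity
  have := hstep n
  linarith

lemma sum_rpow_bd (N : ℕ) (hN : 1 ≤ N) (σ : ℝ) :
    ∑ n ∈ range N, ((n:ℝ) + 1) ^ (-σ) ≤ ((N:ℝ) ^ (1 - σ) + 1) * (1 + Real.log N) := by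
  have h := harmonic_le_one_add_log N
  have h2 : ((harmonic N : ℚ) : ℝ) = ∑ n ∈ range N, ((n:ℝ) + 1)⁻¹ := by
    simp [harmonic]
  rw [h2] at h
  have h0 : 0 ≤ (N:ℝ) ^ (1 - σ) + 1 := by positivity
  refine le_trans ?_ (mul_le_mul_of_nonneg_left h h0)
  rw [mul_sum]
  refine sum_le_sum fun n hn => ?_
  have hn' : ((n:ℝ) + 1) ≤ N := by exact_mod_cast (mem_range.1 hn)
  have e : ((n:ℝ)+1) ^ (-σ) = ((n:ℝ)+1) ^ (1-σ) * ((n:ℝ)+1)⁻¹ := by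
    rw [← Real.rpow_neg_one, ← Real.rpow_add (by positivity)]; congr 1; ring
  rw [e]
  gcongr
  rcases le_total σ 1 with h | h
  · have := Real.rpow_le_rpow (by positivity) hn' (by linarith : 0 ≤ 1 - σ)
    linarith
  · have := Real.rpow_le_one_of_one_le_of_nonpos (by linarith [(Nat.cast_nonneg n : (0:ℝ) ≤ n)] : 1 ≤ (n:ℝ)+1) (by linarith : 1 - σ ≤ 0)
    have : 0 ≤ (N:ℝ) ^ (1 - σ) := by positivity
    linarith

lemma zeta_bd_N (N : ℕ) (hN : 1 ≤ N) (s : ℂ) (hs : 0 < s.re) (h1 : s ≠ 1) :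
    ‖riemannZeta s‖ ≤ ((N:ℝ) ^ (1 - s.re) + 1) * (1 + Real.log N) + (N:ℝ) ^ (1 - s.re) / ‖s - 1‖
      + ‖s‖ * ((1 + 1/s.re) * (N:ℝ) ^ (-s.re)) := by
  have hs1 : s - 1 ≠ 0 := sub_ne_zero.2 h1
  have hn : 0 < ‖s - 1‖ := norm_pos_iff.2 hs1
  have e : riemannZeta s = (∑ n ∈ range N, ((n:ℂ) + 1) ^ (-s)) + (N:ℂ) ^ (1 - s) / (s - 1)
      + (∑' k : ℕ, Rm ((N:ℝ) + k) s) / (s - 1) := by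
    rw [riemannZeta_eq_inv_sub_mul h1, zeta1_eq N hN s hs]
    field_simp
  rw [e]
  refine (norm_add₃_le).trans ?_
  have hNpos : (0:ℝ) < N := by exact_mod_cast hN
  have b1 : ‖∑ n ∈ range N, ((n:ℂ) + 1) ^ (-s)‖ ≤ ((N:ℝ) ^ (1 - s.re) + 1) * (1 + Real.log N) := by
    refine (norm_sum_le _ _).trans ((le_of_eq ?_).trans (sum_rpow_bd N hN s.re))
    refine sum_congr rfl fun n _ => ?_
    have := norm_cpow_neg (x := (n:ℝ)+1) (by positivity) s
    push_cast at this
    exact this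
  have b2 : ‖(N:ℂ) ^ (1 - s) / (s - 1)‖ = (N:ℝ) ^ (1 - s.re) / ‖s - 1‖ := by
    rw [norm_div, Complex.norm_natCast_cpow_of_pos (by omega)]; simp
  have b3 : ‖(∑' k : ℕ, Rm ((N:ℝ) + k) s) / (s - 1)‖ ≤ ‖s‖ * ((1 + 1/s.re) * (N:ℝ) ^ (-s.re)) := by
    rw [norm_div, div_le_iff₀ hn]
    have hsum := (summable_shift (p := -s.re - 1) (by linarith) N).mul_left (‖s - 1‖ * ‖s‖)
    refine (tsum_of_norm_bounded hsum.hasSum (fun k => Rm_bd (by positivity) s hs)).trans ?_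
    rw [tsum_mul_left]
    have := tsum_shift_bd hs N hN
    have h0 : 0 ≤ ‖s - 1‖ * ‖s‖ := by positivity
    nlinarith [mul_le_mul_of_nonneg_left this h0]
  rw [b2]
  linarith

theorem zeta_bd1 : ∃ C : ℝ, 0 < C ∧ ∀ σ t : ℝ, 1/4 ≤ σ → σ ≤ 3 → 2 ≤ t →
    ‖riemannZeta (σ + t * I)‖ ≤ C * (t ^ (1 - σ) + 1) * Real.log t := by
  refine ⟨100, by norm_num, fun σ t h1 h2 ht => ?_⟩
  set N := ⌈t⌉₊ with hN
  have hNt : t ≤ N := Nat.le_ceil t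
  have hN2 : (N:ℝ) ≤ 2 * t := by linarith [Nat.ceil_lt_add_one (by linarith : 0 ≤ t)]
  have hN1 : 1 ≤ N := by
    have : (1:ℝ) ≤ N := by linarith
    exact_mod_cast this
  have hre : ((σ:ℂ) + t * I).re = σ := by simp
  have him : ((σ:ℂ) + t * I - 1).im = t := by simp
  have hne : ((σ:ℂ) + t * I) ≠ 1 := by
    intro h; have := congrArg Complex.im h; simp at this; linarith
  have := zeta_bd_N N hN1 (σ + t * I) (by rw [hre]; linarith) hne
  rw [hre] at this
  refine this.trans ?_
  have hn1 : t ≤ ‖(σ:ℂ) + t * I - 1‖ := by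
    have := Complex.abs_im_le_norm ((σ:ℂ) + t * I - 1)
    rw [him, abs_of_pos (by linarith)] at this; exact this
  have hn2 : ‖(σ:ℂ) + t * I‖ ≤ 3 * t := by
    have := Complex.norm_le_abs_re_add_abs_im ((σ:ℂ) + t * I)
    simp only [hre, add_im, ofReal_im, mul_im, ofReal_re, I_im, I_re] at this
    rw [abs_of_pos (by linarith : 0 < σ)] at this
    simp only [mul_one, mul_zero, add_zero, zero_add] at this
    rw [abs_of_pos (by linarith : 0 < t)] at this
    linarith
  have htp : 0 < t ^ (1 - σ) := by positivity
  have hNp : (N:ℝ) ^ (1 - σ) ≤ 2 * t ^ (1-σ) := by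
    rcases le_total σ 1 with h | h
    · calc (N:ℝ) ^ (1 - σ) ≤ (2 * t) ^ (1 - σ) := Real.rpow_le_rpow (by positivity) hN2 (by linarith)
        _ = 2 ^ (1 - σ) * t ^ (1 - σ) := Real.mul_rpow (by norm_num) (by linarith)
        _ ≤ 2 * t ^ (1-σ) := by
          gcongr
          calc (2:ℝ) ^ (1 - σ) ≤ 2 ^ (1:ℝ) := Real.rpow_le_rpow_of_exponent_le (by norm_num) (by linarith)
            _ = 2 := by norm_num
    · have := Real.rpow_le_rpow_of_nonpos (by linarith : 0 < t) hNt (by linarith : 1 - σ ≤ 0)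
      linarith
  have hNm : (N:ℝ) ^ (-σ) ≤ t ^ (1-σ) / t := by
    have e : t ^ (1-σ) / t = t ^ (-σ) := by
      rw [← Real.rpow_sub_one (by linarith)]; congr 1; ring
    rw [e]
    exact Real.rpow_le_rpow_of_nonpos (by linarith : 0 < t) hNt (by linarith)
  have hlog2 : (1/2:ℝ) ≤ Real.log t := by
    have := Real.log_le_log (by norm_num) ht
    linarith [Real.log_two_gt_d9]
  have hlogN : Real.log N ≤ 1 + Real.log t := by
    have := Real.log_le_log (by linarith) hN2
    rw [Real.log_mul (by norm_num) (by linarith)] at this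
    linarith [Real.log_two_lt_d9]
  have c1 : ((N:ℝ) ^ (1 - σ) + 1) * (1 + Real.log N) ≤ (2 * t ^ (1-σ) + 1) * (5 * Real.log t) := by
    have : 0 ≤ Real.log N := Real.log_nonneg (by linarith)
    gcongr
    linarith
  have c2 : (N:ℝ) ^ (1 - σ) / ‖(σ:ℂ) + t * I - 1‖ ≤ 2 * t ^ (1-σ) := by
    rw [div_le_iff₀ (by linarith)]
    nlinarith
  have c3 : ‖(σ:ℂ) + t * I‖ * ((1 + 1/σ) * (N:ℝ) ^ (-σ)) ≤ 15 * t ^ (1-σ) := by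
    have h5 : 1 + 1/σ ≤ 5 := by
      have : 1/σ ≤ 4 := by rw [div_le_iff₀ (by linarith)]; linarith
      linarith
    calc ‖(σ:ℂ) + t * I‖ * ((1 + 1/σ) * (N:ℝ) ^ (-σ)) ≤ (3*t) * (5 * (t ^ (1-σ) / t)) := by gcongr
      _ = 15 * t ^ (1-σ) := by field_simp; ring
  nlinarith

end Shanks

namespace Shanks

noncomputable def dterm (k : ℕ) (s : ℂ) : ℂ := log (s + k + 1) - log (s + k) - (s + k)⁻¹

lemma dterm_bd (k : ℕ) {s : ℂ} (hs : 0 < s.re) : ‖dterm k s‖ ≤ 1 / ‖s + k‖ ^ 2 := by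
  have hk : 0 < (s + k).re := by simp; positivity
  generalize hz : s + k = z at hk
  have hn : 0 < ‖z‖ := norm_pos_iff.2 (by rintro rfl; simp at hk)
  have key : ∀ u ∈ Set.Icc (0:ℝ) 1, HasDerivWithinAt (fun u : ℝ => log (z + u) - (u:ℂ) * z⁻¹)
      ((z + u)⁻¹ - z⁻¹) (Set.Icc 0 1) u := by
    intro u hu
    have h0 : z + u ∈ slitPlane := Or.inl (by simp; linarith [hu.1])
    have h1 := (((hasDerivAt_id (u:ℂ)).const_add z).clog h0).sub ((hasDerivAt_id (u:ℂ)).mul_const z⁻¹)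
    have := h1.comp_ofReal.hasDerivWithinAt (s := Set.Icc 0 1)
    refine HasDerivWithinAt.congr_deriv this ?_
    simp
  have := (convex_Icc (0:ℝ) 1).norm_image_sub_le_of_norm_hasDerivWithin_le (C := 1 / ‖z‖^2) key ?_
    (Set.left_mem_Icc.2 (by norm_num)) (Set.right_mem_Icc.2 (by norm_num))
  · simp only [dterm, hz]
    simp at this ⊢
    refine le_trans (le_of_eq ?_) this
    congr 1; ring
  · intro u hu
    have hzu : ‖z‖ ≤ ‖z + u‖ := by
      rw [Complex.norm_def, Complex.norm_def]
      apply Real.sqrt_le_sqrt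
      simp only [normSq_apply]
      simp
      nlinarith [hu.1]
    have hz0 : z ≠ 0 := norm_pos_iff.1 hn
    have hz1 : z + u ≠ 0 := norm_pos_iff.1 (by linarith)
    have : (z + u)⁻¹ - z⁻¹ = - u / ((z+u) * z) := by field_simp; ring
    rw [this, norm_div, norm_mul, norm_neg, Complex.norm_real, Real.norm_of_nonneg hu.1, sq]
    gcongr
    exact hu.2

lemma summable_dbd : Summable fun k : ℕ => 1 / ((k:ℝ) + 1/8) ^ 2 := by
  have := (Real.summable_one_div_nat_add_rpow (1/8) 2).2 (by norm_num)
  refine this.congr fun k => ?_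
  rw [abs_of_pos (by positivity)]
  norm_num

lemma dterm_bd2 (k : ℕ) {s : ℂ} (hs : 1/8 < s.re) : ‖dterm k s‖ ≤ 1 / ((k:ℝ) + 1/8) ^ 2 := by
  refine (dterm_bd k (by linarith)).trans ?_
  gcongr
  refine le_trans ?_ (re_le_norm _)
  simp; linarith

lemma digamma_real {x : ℝ} (hx : 0 < x) : ∃ y : ℝ, digamma x = y ∧ |y - Real.log x| ≤ 1 / x := by
  have hd : ∀ x : ℝ, 0 < x → HasDerivAt (Real.log ∘ Real.Gamma) (deriv Real.Gamma x / Real.Gamma x) x := by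
    intro x hx
    exact ((Real.differentiableAt_Gamma (fun m => by
      have : (0:ℝ) ≤ m := by positivity
      linarith)).hasDerivAt.log (Real.Gamma_pos_of_pos hx).ne')
  have hr : ∀ x : ℝ, 0 < x → digamma x = ((deriv Real.Gamma x / Real.Gamma x : ℝ):ℂ) := by
    intro x hx
    have h1 : DifferentiableAt ℂ Gamma x := differentiableAt_Gamma _ (fun m h => by
      have : x = -(m:ℝ) := by exact_mod_cast h
      have : (0:ℝ) ≤ m := by positivity
      linarith)
    have h2 := h1.hasDerivAt.comp_ofReal
    have h3 := ((Real.differentiableAt_Gamma (s := x) (fun m => by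
      have : (0:ℝ) ≤ m := by positivity
      linarith)).hasDerivAt).ofReal_comp
    have h4 : (fun y : ℝ => Gamma (y:ℂ)) = fun y => ((Real.Gamma y : ℝ):ℂ) := by
      ext y; exact Gamma_ofReal y
    rw [h4] at h2
    have := h2.unique h3
    rw [digamma_def, logDeriv_apply, this, Gamma_ofReal]; push_cast; rfl
  have hf : ∀ x : ℝ, 0 < x → (Real.log ∘ Real.Gamma) (x+1) - (Real.log ∘ Real.Gamma) x = Real.log x := by
    intro x hx
    simp only [Function.comp]
    rw [Real.Gamma_add_one hx.ne', Real.log_mul hx.ne' (Real.Gamma_pos_of_pos hx).ne']; ring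
  refine ⟨_, hr x hx, ?_⟩
  have hc := Real.convexOn_log_Gamma
  have a1 := hc.le_slope_of_hasDerivAt (x := x) (y := x+1) hx (by simp; linarith) (by linarith) (hd x hx)
  have a2 := hc.slope_le_of_hasDerivAt (x := x) (y := x+1) hx (by simp; linarith) (by linarith) (hd (x+1) (by linarith))
  rw [slope_def_field, hf x hx] at a1 a2
  have e : digamma (x + 1) = digamma x + (x:ℂ)⁻¹ := digamma_apply_add_one _ (fun m h => by
      have : x = -(m:ℝ) := by exact_mod_cast h
      have : (0:ℝ) ≤ m := by positivity
      linarith)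
  have e2 := hr (x+1) (by linarith)
  push_cast at e2
  rw [e, hr x hx] at e2
  have e3 : deriv Real.Gamma x / Real.Gamma x + x⁻¹ = deriv Real.Gamma (x+1) / Real.Gamma (x+1) := by
    exact_mod_cast e2
  rw [abs_le, one_div]
  have : (x + 1 - x) = 1 := by ring
  rw [this, div_one] at a1 a2
  constructor
  · linarith
  · have : 0 < x⁻¹ := by positivity
    linarith

lemma ne_neg_nat {s : ℂ} (hs : 0 < s.re) (m : ℕ) : s ≠ -(m:ℂ) := by
  rintro rfl
  simp at hs
  have : (0:ℝ) ≤ m := by positivity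
  linarith

lemma dterm_telescope {s : ℂ} (hs : 0 < s.re) (N : ℕ) :
    digamma s - log s = digamma (s + N) - log (s + N) + ∑ k ∈ range N, dterm k s := by
  induction N with
  | zero => simp
  | succ N ih =>
    rw [ih, sum_range_succ]
    have := digamma_apply_add_one (s + N) (ne_neg_nat (by simp; positivity))
    have e : s + ((N + 1 : ℕ):ℂ) = s + N + 1 := by push_cast; ring
    rw [e, this, dterm]
    ring

lemma digamma_diff {s : ℂ} (hs : 0 < s.re) : DifferentiableAt ℂ digamma s := by
  have h1 : ∀ s : ℂ, 0 < s.re → DifferentiableAt ℂ Gamma s := fun s hs =>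
    differentiableAt_Gamma _ (ne_neg_nat hs)
  have h2 : DifferentiableOn ℂ Gamma {s | 0 < s.re} := fun s hs => (h1 s hs).differentiableWithinAt
  have ho : IsOpen {s : ℂ | 0 < s.re} := isOpen_lt continuous_const continuous_re
  have h3 := (h2.deriv ho).differentiableAt (ho.mem_nhds hs)
  rw [digamma_def]
  exact h3.div (h1 s hs) (Gamma_ne_zero_of_re_pos hs)

lemma digamma_eq {s : ℂ} (hs : 1/8 < s.re) : digamma s = log s + ∑' k, dterm k s := by
  set Ω : Set ℂ := {s | 1/8 < s.re}
  have ho : IsOpen Ω := isOpen_lt continuous_const continuous_re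
  have hconv : Convex ℝ Ω := convex_halfSpace_re_gt _
  have hU : DifferentiableOn ℂ (fun s => ∑' k, dterm k s) Ω := by
    apply differentiableOn_tsum_of_summable_norm summable_dbd _ ho (fun i w hw => dterm_bd2 i hw)
    intro k s hs
    have hs' : 1/8 < s.re := hs
    have hk : (0:ℝ) ≤ k := by positivity
    apply DifferentiableAt.differentiableWithinAt
    have h1 : s + k + 1 ∈ slitPlane := Or.inl (by simp; linarith)
    have h2 : s + k ∈ slitPlane := Or.inl (by simp; linarith)
    have h3 : s + k ≠ 0 := slitPlane_ne_zero h2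
    unfold dterm
    fun_prop (disch := assumption)
  have hf : DifferentiableOn ℂ digamma Ω := fun s hs =>
    (digamma_diff (by have : 1/8 < s.re := hs; linarith)).differentiableWithinAt
  have hl : DifferentiableOn ℂ log Ω := fun s hs =>
    (differentiableAt_log (Or.inl (by have : 1/8 < s.re := hs; linarith))).differentiableWithinAt
  have a1 := hf.analyticOnNhd ho
  have a2 := (hl.add hU).analyticOnNhd ho
  have hreal : ∀ x : ℝ, 1/8 < x → digamma x = log x + ∑' k, dterm k x := by
    intro x hx
    have h1 : HasSum (fun k => dterm k (x:ℂ)) (∑' k, dterm k x) :=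
      (Summable.of_norm_bounded summable_dbd (fun k => dterm_bd2 k (s := x) (by simpa using hx))).hasSum
    have h2 := h1.tendsto_sum_nat
    have h3 : Tendsto (fun N : ℕ => digamma (x + N) - log (x + N)) atTop (nhds 0) := by
      apply squeeze_zero_norm (a := fun N : ℕ => 1 / ((N:ℝ) + 1)  * (9))
      · intro N
        obtain ⟨y, hy, hb⟩ := digamma_real (x := x + N) (by positivity)
        push_cast at hy
        rw [hy]
        have : log ((x:ℂ) + N) = ((Real.log (x + N):ℝ):ℂ) := by
          rw [Complex.ofReal_log (by positivity)]; push_cast; rfl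
        rw [this, ← ofReal_sub, norm_real, Real.norm_eq_abs]
        refine hb.trans ?_
        have hN : (0:ℝ) ≤ N := by positivity
        rw [div_mul_eq_mul_div, div_le_div_iff₀ (by positivity) (by positivity)]
        nlinarith
      · have := (tendsto_one_div_add_atTop_nhds_zero_nat (𝕜 := ℝ)).mul_const 9
        simpa using this
    have h4 := h3.add h2
    have h5 : (fun N : ℕ => digamma (x + N) - log (x + N) + ∑ k ∈ range N, dterm k x) =
       fun N => digamma x - log x := by
      ext N; rw [← dterm_telescope (by simp; linarith)]
    rw [h5] at h4
    have := tendsto_nhds_unique tendsto_const_nhds h4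
    rw [zero_add, sub_eq_iff_eq_add] at this
    rw [this]; ring
  have hfe : ∃ᶠ z in nhdsWithin (1:ℂ) {1}ᶜ, digamma z = (log + fun s => ∑' k, dterm k s) z := by
    have ht : Tendsto (fun n : ℕ => (((1:ℝ) + 1 / ((n:ℝ)+1) : ℝ):ℂ)) atTop (nhdsWithin (1:ℂ) {1}ᶜ) := by
      apply tendsto_nhdsWithin_of_tendsto_nhds_of_eventually_within
      · have := (tendsto_one_div_add_atTop_nhds_zero_nat (𝕜 := ℝ)).const_add 1
        have := (continuous_ofReal.tendsto _).comp this
        simpa [Function.comp_def] using this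
      · refine Eventually.of_forall fun n => ?_
        simp only [Set.mem_compl_iff, Set.mem_singleton_iff]
        intro h
        have h' : (1:ℝ) + 1 / ((n:ℝ)+1) = 1 := ofReal_injective (by rw [h]; simp)
        have : (0:ℝ) < 1 / ((n:ℝ)+1) := by positivity
        linarith
    refine ht.frequently (Frequently.of_forall fun n => ?_)
    have : (0:ℝ) < 1 / ((n:ℝ)+1) := by positivity
    exact hreal _ (by linarith)
  have := a1.eqOn_of_preconnected_of_frequently_eq a2 hconv.isPreconnected (z₀ := 1) (by simp [Ω]; norm_num) hfe
  exact this hs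

lemma tele_sum {t : ℝ} (ht : 1 ≤ t) : HasSum (fun k : ℕ => 4 * (1 / (t + k) - 1 / (t + k + 1))) (4 / t) := by
  have h0 : ∀ k : ℕ, (0:ℝ) < t + k := fun k => by positivity
  rw [hasSum_iff_tendsto_nat_of_nonneg]
  · have : ∀ N : ℕ, ∑ k ∈ range N, 4 * (1 / (t + k) - 1 / (t + k + 1)) = 4 / t - 4 * (1 / (t + N)) := by
      intro N
      induction N with
      | zero => simp; ring
      | succ N ih => rw [sum_range_succ, ih]; push_cast; rw [← add_assoc]; ring
    simp_rw [this]
    have h1 : Tendsto (fun N : ℕ => 1 / (t + (N:ℝ))) atTop (nhds 0) := by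
      simp only [one_div]
      exact tendsto_inv_atTop_zero.comp (tendsto_atTop_add_const_left _ _ tendsto_natCast_atTop_atTop)
    simpa using (h1.const_mul 4).const_sub (4/t)
  · intro k
    have := h0 k
    have : 1 / (t + k + 1) ≤ 1 / (t + k) := one_div_le_one_div_of_le this (by linarith)
    linarith

theorem digamma_bd {s : ℂ} (hs : 1/8 < s.re) (ht : 1 ≤ s.im) : ‖digamma s - log s‖ ≤ 4 / s.im := by
  rw [digamma_eq hs, add_sub_cancel_left]
  refine tsum_of_norm_bounded (tele_sum ht) fun k => ?_
  refine (dterm_bd k (by linarith)).trans ?_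
  have h0 : (0:ℝ) ≤ k := by positivity
  have h1 : s.im^2 + k^2 ≤ ‖s + k‖^2 := by
    rw [← Complex.normSq_eq_norm_sq, normSq_apply]; simp
    nlinarith
  have h2 : (s.im + k) * (s.im + k + 1) ≤ 4 * (s.im^2 + k^2) := by
    nlinarith [sq_nonneg (s.im - k)]
  calc 1 / ‖s + k‖^2 ≤ 1 / ((s.im + k) * (s.im + k + 1) / 4) := by
        gcongr; linarith
    _ = _ := by field_simp; ring

end Shanks

namespace Shanks

noncomputable def XX (s : ℂ) : ℂ := 2 * (2 * Real.pi) ^ (-s) * Gamma s * cos (Real.pi * s / 2)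

noncomputable def qX (s : ℂ) : ℂ :=
  digamma s - (Real.log (2 * Real.pi) : ℝ) - (Real.pi / 2) * (sin (Real.pi * s / 2) / cos (Real.pi * s / 2))

noncomputable def eX (s : ℂ) : ℂ :=
  (digamma s - log s) - (Real.pi / 2) * (sin (Real.pi * s / 2) / cos (Real.pi * s / 2) - I)

lemma qX_eq (s : ℂ) : qX s = log s - (Real.log (2 * Real.pi) : ℝ) - Real.pi / 2 * I + eX s := by
  simp only [qX, eX]; ring

lemma zeta_fe {s : ℂ} (hs : 0 < s.re) (h1 : s ≠ 1) : riemannZeta (1 - s) = XX s * riemannZeta s :=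
  riemannZeta_one_sub (ne_neg_nat hs) h1

lemma norm_exp_mul_I (w : ℂ) : ‖exp (w * I)‖ = Real.exp (-w.im) := by
  rw [norm_exp]; simp

lemma cos_lower {w : ℂ} (hw : 0 < w.im) : w.im * Real.exp (- w.im) ≤ ‖cos w‖ := by
  have h1 : 2 * cos w = exp (w * I) + exp (-w * I) := two_cos w
  have h2 : ‖exp (-w * I)‖ ≤ ‖2 * cos w‖ + ‖exp (w * I)‖ := by
    have : exp (-w * I) = 2 * cos w - exp (w * I) := by rw [h1]; ring
    rw [this]; exact norm_sub_le _ _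
  rw [norm_exp_mul_I, norm_exp_mul_I, norm_mul] at h2
  simp at h2
  have h3 : Real.exp w.im = Real.exp (2 * w.im) * Real.exp (-w.im) := by
    rw [← Real.exp_add]; ring_nf
  have h4 := Real.add_one_le_exp (2 * w.im)
  have h5 := Real.exp_pos (-w.im)
  nlinarith

lemma cos_ne {s : ℂ} (hs : 0 < s.im) : cos (Real.pi * s / 2) ≠ 0 := by
  have h : (Real.pi * s / 2).im = Real.pi * s.im / 2 := by
    simp
  have hp : 0 < (Real.pi * s / 2).im := by rw [h]; have := Real.pi_pos; positivity
  have := cos_lower hp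
  intro h0
  rw [h0, norm_zero] at this
  have := mul_pos hp (Real.exp_pos (-(Real.pi * s / 2).im))
  linarith

lemma tan_bd {s : ℂ} (hs : 0 < s.im) :
    ‖(Real.pi / 2 : ℂ) * (sin (Real.pi * s / 2) / cos (Real.pi * s / 2) - I)‖ ≤ 1 / s.im := by
  have h : (Real.pi * s / 2).im = Real.pi * s.im / 2 := by
    simp
  have hpi := Real.pi_pos
  have hp : 0 < (Real.pi * s / 2).im := by rw [h]; positivity
  have hc := cos_ne hs
  have hl := cos_lower hp
  generalize hw : (Real.pi * s / 2 : ℂ) = w at *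
  have e : sin w / cos w - I = - I * exp (w * I) / cos w := by
    rw [exp_mul_I]; field_simp
    linear_combination (sin w) * I_sq
  rw [e, norm_mul, norm_div (-I * exp (w * I)), norm_mul, norm_neg, norm_I, norm_exp_mul_I, one_mul]
  have h2 : ‖(Real.pi / 2 : ℂ)‖ = Real.pi / 2 := by
    rw [norm_div, norm_real, Real.norm_of_nonneg hpi.le]; simp
  rw [h2]
  have h5 := Real.exp_pos (-w.im)
  calc Real.pi / 2 * (Real.exp (-w.im) / ‖cos w‖) ≤ Real.pi / 2 * (Real.exp (-w.im) / (w.im * Real.exp (-w.im))) := by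
        gcongr
    _ = Real.pi / 2 * (1 / w.im) := by field_simp
    _ = 1 / s.im := by rw [h]; field_simp

lemma eX_bd {s : ℂ} (hs : 1/8 < s.re) (ht : 1 ≤ s.im) : ‖eX s‖ ≤ 5 / s.im := by
  have h1 := digamma_bd hs ht
  have h2 := tan_bd (s := s) (by linarith)
  have := norm_sub_le (digamma s - log s) ((Real.pi / 2 : ℂ) * (sin (Real.pi * s / 2) / cos (Real.pi * s / 2) - I))
  have e : (5 : ℝ) / s.im = 4 / s.im + 1 / s.im := by ring
  rw [e]
  exact this.trans (by linarith)

lemma log_horiz {σ t : ℝ} (hσ : 0 ≤ σ) (ht : 0 < t) :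
    ‖log (σ + t * I) - (Real.log t + Real.pi / 2 * I)‖ ≤ σ / t := by
  have key : ∀ u ∈ Set.Icc (0:ℝ) σ, HasDerivWithinAt (fun u : ℝ => log (u + t * I))
      ((u + t * I)⁻¹) (Set.Icc 0 σ) u := by
    intro u hu
    have h0 : (u:ℂ) + t * I ∈ slitPlane := Or.inr (by simp; exact ht.ne')
    have h1 := (((hasDerivAt_id (u:ℂ)).add_const (t * I)).clog h0)
    have := h1.comp_ofReal.hasDerivWithinAt (s := Set.Icc 0 σ)
    refine HasDerivWithinAt.congr_deriv this ?_
    simp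
  have := (convex_Icc (0:ℝ) σ).norm_image_sub_le_of_norm_hasDerivWithin_le (C := 1 / t) key ?_
    (Set.left_mem_Icc.2 hσ) (Set.right_mem_Icc.2 hσ)
  · have e : log ((0:ℝ) + t * I) = Real.log t + Real.pi / 2 * I := by
      rw [ofReal_zero, zero_add, log_ofReal_mul ht I_ne_zero, log_I]
    rw [e] at this
    refine this.trans (le_of_eq ?_)
    rw [sub_zero, Real.norm_of_nonneg hσ]; ring
  · intro u hu
    rw [norm_inv, ← one_div]
    gcongr
    refine le_trans ?_ (abs_im_le_norm _)
    simp [abs_of_pos ht]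

lemma qX_bd {σ t : ℝ} (hσ : 1/8 < σ) (hσ2 : σ ≤ 3) (ht : 1 ≤ t) :
    ‖qX (σ + t * I) - (Real.log (t / (2 * Real.pi)) : ℝ)‖ ≤ 8 / t := by
  have h1 := eX_bd (s := σ + t * I) (by simpa using hσ) (by simpa using ht)
  have h2 := log_horiz (σ := σ) (t := t) (by linarith) (by linarith)
  have e : qX (σ + t * I) - (Real.log (t / (2 * Real.pi)) : ℝ) =
    (log (σ + t * I) - (Real.log t + Real.pi / 2 * I)) + eX (σ + t * I) := by
    rw [qX_eq, Real.log_div (by linarith) (by have := Real.pi_pos; positivity)]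
    push_cast; ring
  rw [e]
  refine (norm_add_le _ _).trans ?_
  simp at h1
  have : σ / t ≤ 3 / t := by gcongr
  have e3 : 8 / t = 3 / t + 5 / t := by ring
  linarith

lemma eX_diff {s : ℂ} (hs : 0 < s.re) (ht : 0 < s.im) : DifferentiableAt ℂ eX s := by
  have h1 := digamma_diff hs
  have h2 : s ∈ slitPlane := Or.inl hs
  have h3 := cos_ne ht
  unfold eX
  have h4 : DifferentiableAt ℂ (fun s : ℂ => cos (Real.pi * s / 2)) s := by fun_prop
  have h5 : DifferentiableAt ℂ (fun s : ℂ => sin (Real.pi * s / 2)) s := by fun_prop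
  exact (h1.sub (differentiableAt_log h2)).sub (((h5.div h4 h3).sub_const I).const_mul _)

lemma qX_hasDeriv {s : ℂ} (hs : 0 < s.re) (ht : 0 < s.im) :
    HasDerivAt qX (s⁻¹ + deriv eX s) s := by
  have h2 : s ∈ slitPlane := Or.inl hs
  have := (((hasDerivAt_log h2).sub_const (Real.log (2 * Real.pi) : ℂ)).sub_const (Real.pi / 2 * I)).add
    (eX_diff hs ht).hasDerivAt
  have e : qX = _ := funext qX_eq
  rw [e]; exact this

lemma qX_deriv_bd {s : ℂ} (hs : 1/2 ≤ s.re) (ht : 2 ≤ s.im) : ‖deriv qX s‖ ≤ 41 / s.im := by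
  rw [(qX_hasDeriv (by linarith) (by linarith)).deriv]
  have h1 : ‖s⁻¹‖ ≤ 1 / s.im := by
    rw [norm_inv, ← one_div]
    gcongr
    exact (le_abs_self _).trans (abs_im_le_norm _)
  have hz : ∀ z ∈ Metric.closedBall s (1/4), 1/4 ≤ z.re ∧ s.im / 2 ≤ z.im ∧ 1 ≤ z.im := by
    intro z hz
    rw [Metric.mem_closedBall, dist_eq] at hz
    have a1 := (abs_re_le_norm (z - s)).trans hz
    have a2 := (abs_im_le_norm (z - s)).trans hz
    rw [abs_le, sub_re] at a1
    rw [abs_le, sub_im] at a2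
    refine ⟨by linarith [a1.1], by linarith [a2.1], by linarith [a2.1]⟩
  have h2 : ‖deriv eX s‖ ≤ (10 / s.im) / (1/4) := by
    apply norm_deriv_le_of_forall_mem_sphere_norm_le (by norm_num)
    · apply DifferentiableOn.diffContOnCl
      intro z hzz
      rw [closure_ball _ (by norm_num)] at hzz
      obtain ⟨b1, b2, b3⟩ := hz z hzz
      exact (eX_diff (by linarith) (by linarith)).differentiableWithinAt
    · intro z hzz
      obtain ⟨b1, b2, b3⟩ := hz z (Metric.sphere_subset_closedBall hzz)
      refine (eX_bd (by linarith) b3).trans ?_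
      rw [div_le_div_iff₀ (by linarith) (by linarith)]
      linarith
  have e : 41 / s.im = 1 / s.im + (10 / s.im) / (1/4) := by ring
  rw [e]
  exact (norm_add_le _ _).trans (add_le_add h1 h2)

lemma XX_hasDeriv {s : ℂ} (hs : 0 < s.re) (ht : 0 < s.im) : HasDerivAt XX (XX s * qX s) s := by
  have hpi : (2 * Real.pi : ℂ) ≠ 0 := by simp [Real.pi_ne_zero]
  have hG := (differentiableAt_Gamma s (ne_neg_nat hs)).hasDerivAt
  have hG0 := Gamma_ne_zero_of_re_pos hs
  have hc := cos_ne ht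
  have h1 : HasDerivAt (fun s : ℂ => (2 * Real.pi : ℂ) ^ (-s)) _ s :=
    (hasDerivAt_neg s).const_cpow (Or.inl hpi)
  have h2 : HasDerivAt (fun s : ℂ => Real.pi * s / 2) (Real.pi * 1 / 2) s := ((hasDerivAt_id s).const_mul _).div_const 2
  have h3 := ((h1.const_mul 2).mul hG).mul h2.ccos
  refine HasDerivAt.congr_deriv (f := XX) h3 ?_
  have hl : log (2 * Real.pi) = ((Real.log (2 * Real.pi):ℝ):ℂ) := by
    rw [ofReal_log (by have := Real.pi_pos; positivity)]; push_cast; rfl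
  simp only [XX, qX, digamma_def, logDeriv_apply, Pi.mul_apply, hl]
  field_simp
  ring

lemma XX_half {t : ℝ} (ht : 0 < t) : ‖XX (1/2 + t * I)‖ = 1 := by
  set s : ℂ := 1/2 + t * I
  have hpi : (2 * Real.pi : ℂ) ≠ 0 := by simp [Real.pi_ne_zero]
  have hconj : (starRingEnd ℂ) s = 1 - s := by
    apply Complex.ext <;> simp [s] <;> norm_num
  have h22 : (starRingEnd ℂ) 2 = 2 := Complex.conj_ofNat 2
  have hX : XX (1 - s) = (starRingEnd ℂ) (XX s) := by
    rw [← hconj]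
    simp only [XX, map_mul]
    have e1 : (2 * Real.pi : ℂ) ^ (-(starRingEnd ℂ) s) = (starRingEnd ℂ) ((2 * Real.pi : ℂ) ^ (-s)) := by
      have := cpow_conj (2 * Real.pi : ℂ) (-s) ?_
      · rw [map_neg] at this
        rw [this]; simp [h22]
      · have : (2 * Real.pi : ℂ) = ((2 * Real.pi : ℝ):ℂ) := by push_cast; rfl
        rw [this, arg_ofReal_of_nonneg (by have := Real.pi_pos; positivity)]
        exact Real.pi_ne_zero.symm
    have e2 : cos (Real.pi * (starRingEnd ℂ) s / 2) = (starRingEnd ℂ) (cos (Real.pi * s / 2)) := by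
      rw [← cos_conj]; simp [h22]
    rw [e1, e2, Gamma_conj]; simp [h22]
  have hp : XX s * XX (1 - s) = 1 := by
    have hsin : sin (Real.pi * s) = 2 * sin (Real.pi * s / 2) * cos (Real.pi * s / 2) := by
      rw [← sin_two_mul]; ring_nf
    have hcos : cos (Real.pi * (1 - s) / 2) = sin (Real.pi * s / 2) := by
      rw [← cos_pi_div_two_sub]; ring_nf
    have hc := cos_ne (s := s) (by simpa [s] using ht)
    have hs0 : sin (Real.pi * s / 2) ≠ 0 := by
      rw [← hcos]
      have e2 : cos (Real.pi * (1 - s) / 2) = (starRingEnd ℂ) (cos (Real.pi * s / 2)) := by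
        rw [← cos_conj, ← hconj]; simp [h22]
      rw [e2]; simpa using hc
    have hpow : (2 * Real.pi : ℂ) ^ (-s) * (2 * Real.pi : ℂ) ^ (-(1 - s)) = (2 * Real.pi : ℂ)⁻¹ := by
      rw [← cpow_add _ _ hpi, ← cpow_neg_one]; ring_nf
    have hG := Gamma_mul_Gamma_one_sub s
    calc XX s * XX (1 - s) = 4 * ((2 * Real.pi : ℂ) ^ (-s) * (2 * Real.pi : ℂ) ^ (-(1 - s))) * (Gamma s * Gamma (1 - s))
          * cos (Real.pi * s / 2) * cos (Real.pi * (1 - s) / 2) := by simp only [XX]; ring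
      _ = 1 := by
        rw [hpow, hG, hcos, hsin]
        have : (Real.pi:ℂ) ≠ 0 := by simp [Real.pi_ne_zero]
        field_simp
        norm_num
  rw [hX] at hp
  have := congrArg norm hp
  rw [norm_mul, RCLike.norm_conj, norm_one] at this
  nlinarith [norm_nonneg (XX s)]

lemma XX_bd {σ t : ℝ} (hσ : 1/2 ≤ σ) (hσ2 : σ ≤ 3/2) (ht : 1 ≤ t) :
    ‖XX (σ + t * I)‖ ≤ Real.exp 8 * t ^ (σ - 1/2) := by
  set l := Real.log (t / (2 * Real.pi)) with hl
  have hpi := Real.pi_gt_three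
  let g : ℝ → ℂ := fun u => XX (u + t * I) * exp (-((u - 1/2 : ℝ) * l : ℂ))
  have hder : ∀ u : ℝ, 1/2 ≤ u → HasDerivAt g (g u * (qX (u + t * I) - l)) u := by
    intro u hu
    have h1 : HasDerivAt (fun z : ℂ => XX (z + t * I)) (XX (u + t * I) * qX (u + t * I)) (u:ℂ) := by
      have := (XX_hasDeriv (s := u + t * I) (by simp; linarith) (by simp; linarith))
      exact this.comp_add_const (u:ℂ) (t * I)
    have h2 : HasDerivAt (fun z : ℂ => exp (-((z - 1/2) * l : ℂ))) (exp (-((u - 1/2) * l : ℂ)) * (-(1 * l))) (u:ℂ) :=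
      ((((hasDerivAt_id (u:ℂ)).sub_const (1/2)).mul_const (l:ℂ)).neg).cexp
    have h3 := (h1.mul h2).comp_ofReal
    have e : g = fun y : ℝ => ((fun z : ℂ => XX (z + t * I)) * fun z : ℂ => exp (-((z - 1/2) * l : ℂ))) y := by
      ext y; simp [g]
    rw [e]
    refine HasDerivAt.congr_deriv h3 ?_
    simp only [Pi.mul_apply]
    ring
  have hG := norm_le_gronwallBound_of_norm_deriv_right_le (f := g) (f' := fun u => g u * (qX (u + t * I) - l))
    (δ := 1) (K := 8) (ε := 0) (a := 1/2) (b := 3/2)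
    (fun u hu => (hder u hu.1).continuousAt.continuousWithinAt)
    (fun u hu => (hder u hu.1).hasDerivWithinAt) (by
      have := XX_half (t := t) (by linarith)
      simp only [g]
      norm_num at this ⊢
      rw [this]) (by
      intro u hu
      rw [norm_mul, add_zero, mul_comm]
      gcongr
      refine (qX_bd (by linarith [hu.1]) (by linarith [hu.2]) ht).trans ?_
      rw [div_le_iff₀ (by linarith)]; linarith) σ ⟨hσ, hσ2⟩
  rw [gronwallBound_ε0, one_mul] at hG
  simp only [g, norm_mul] at hG
  have e1 : ‖exp (-((σ - 1/2 : ℝ) * l : ℂ))‖ = Real.exp (-((σ - 1/2) * l)) := by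
    rw [norm_exp]; norm_cast
  rw [e1, Real.exp_neg, ← div_eq_mul_inv, div_le_iff₀ (Real.exp_pos _)] at hG
  refine hG.trans ?_
  gcongr
  · linarith
  · rw [Real.rpow_def_of_pos (by linarith), mul_comm]
    gcongr
    · rw [hl]
      apply Real.log_le_log (by positivity)
      rw [div_le_iff₀ (by positivity)]
      nlinarith

end Shanks

namespace Shanks

lemma zeta_left_norm {σ t : ℝ} (h2 : σ < 1) (ht : 0 < t) :
    ‖riemannZeta (σ + t * I)‖ = ‖XX ((1 - σ : ℝ) + t * I)‖ * ‖riemannZeta ((1 - σ : ℝ) + t * I)‖ := by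
  have e : (starRingEnd ℂ) ((σ:ℂ) + t * I) = 1 - ((1 - σ : ℝ) + t * I) := by
    apply Complex.ext <;> simp
  rw [← norm_mul, ← zeta_fe (by simp; linarith) (fun h => by
    have := congrArg im h
    simp at this; linarith), ← e, riemannZeta_conj, RCLike.norm_conj]

theorem zeta_left : ∃ C > 0, ∀ σ t : ℝ, -1/4 ≤ σ → σ ≤ 1/2 → 2 ≤ t →
    ‖riemannZeta (σ + t * I)‖ ≤ C * (t ^ (1/2 : ℝ) + t ^ (1/2 - σ)) * Real.log t := by
  obtain ⟨C, hC, h⟩ := zeta_bd1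
  refine ⟨Real.exp 8 * C, by positivity, fun σ t h1 h2 ht => ?_⟩
  rw [zeta_left_norm (by linarith) (by linarith)]
  have a1 := XX_bd (σ := 1 - σ) (t := t) (by linarith) (by linarith) (by linarith)
  have a2 := h (1 - σ) t (by linarith) (by linarith) ht
  have e : t ^ (1/2 : ℝ) = t ^ (1/2 - σ) * t ^ σ := by
    rw [← Real.rpow_add (by linarith)]; ring_nf
  have e1 : 1 - (1 - σ) = σ := by ring
  have e2 : 1 - σ - 1/2 = 1/2 - σ := by ring
  rw [e1] at a2
  rw [e2] at a1
  have hl : 0 ≤ Real.log t := Real.log_nonneg (by linarith)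
  have ht0 : 0 < t := by linarith
  calc _ ≤ (Real.exp 8 * t ^ (1/2 - σ)) * (C * (t ^ σ + 1) * Real.log t) := by gcongr
    _ = _ := by rw [e]; ring

theorem zeta_strip : ∃ C > 0, ∀ σ t : ℝ, -1/4 ≤ σ → σ ≤ 3 → 2 ≤ t →
    ‖riemannZeta (σ + t * I)‖ ≤ C * t ^ (7/8 : ℝ) := by
  obtain ⟨C, hC, h⟩ := zeta_bd1
  obtain ⟨C2, hC2, h'⟩ := zeta_left
  refine ⟨16 * (C + C2), by positivity, fun σ t h1 h2 ht => ?_⟩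
  have ht0 : 0 < t := by linarith
  have ht1 : 1 ≤ t := by linarith
  have hl : 0 ≤ Real.log t := Real.log_nonneg (by linarith)
  have hl2 : Real.log t ≤ 8 * t ^ (1/8 : ℝ) := by
    have := Real.log_le_rpow_div ht0.le (ε := 1/8) (by norm_num)
    linarith
  have e : t ^ (3/4 : ℝ) * t ^ (1/8 : ℝ) = t ^ (7/8 : ℝ) := by
    rw [← Real.rpow_add ht0]; norm_num
  have hm : ∀ x : ℝ, x ≤ 3/4 → t ^ x ≤ t ^ (3/4 : ℝ) := fun x hx => Real.rpow_le_rpow_of_exponent_le ht1 hx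
  have h34 : 1 ≤ t ^ (3/4 : ℝ) := Real.one_le_rpow ht1 (by norm_num)
  rcases le_total σ (1/2) with hσ | hσ
  · refine (h' σ t h1 hσ ht).trans ?_
    calc C2 * (t ^ (1/2 : ℝ) + t ^ (1/2 - σ)) * Real.log t
        ≤ C2 * (t ^ (3/4 : ℝ) + t ^ (3/4 : ℝ)) * (8 * t ^ (1/8 : ℝ)) := by
          gcongr C2 * (?_ + ?_) * ?_
          · exact hm _ (by norm_num)
          · exact hm _ (by linarith)
      _ = 16 * C2 * t ^ (7/8 : ℝ) := by rw [← e]; ring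
      _ ≤ _ := by gcongr; linarith
  · refine (h σ t (by linarith) h2 ht).trans ?_
    calc C * (t ^ (1 - σ) + 1) * Real.log t
        ≤ C * (t ^ (3/4 : ℝ) + t ^ (3/4 : ℝ)) * (8 * t ^ (1/8 : ℝ)) := by
          gcongr
          · linarith
      _ = 16 * C * t ^ (7/8 : ℝ) := by rw [← e]; ring
      _ ≤ _ := by gcongr; linarith

theorem zetaD_strip (k : ℕ) : ∃ C > 0, ∀ σ t : ℝ, -1/8 ≤ σ → σ ≤ 2 → 3 ≤ t →
    ‖iteratedDeriv k riemannZeta (σ + t * I)‖ ≤ C * t ^ (7/8 : ℝ) := by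
  obtain ⟨C, hC, h⟩ := zeta_strip
  refine ⟨k.factorial * (C * 2) / (1/8) ^ k, by positivity, fun σ t h1 h2 ht => ?_⟩
  have ht0 : 0 < t := by linarith
  have hz : ∀ z ∈ Metric.closedBall ((σ:ℂ) + t * I) (1/8), -1/4 ≤ z.re ∧ z.re ≤ 3 ∧ 2 ≤ z.im ∧ z.im ≤ 2 * t := by
    intro z hz
    rw [Metric.mem_closedBall, dist_eq] at hz
    have a1 := (abs_re_le_norm _).trans hz
    have a2 := (abs_im_le_norm _).trans hz
    rw [abs_le, sub_re] at a1
    rw [abs_le, sub_im] at a2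
    simp at a1 a2
    refine ⟨by linarith [a1.1], by linarith [a1.2], by linarith [a2.1], by linarith [a2.2]⟩
  have := norm_iteratedDeriv_le_of_forall_mem_sphere_norm_le (f := riemannZeta) (c := (σ:ℂ) + t * I) (R := 1/8)
    (C := C * 2 * t ^ (7/8 : ℝ)) k (by norm_num) ?_ ?_
  · refine this.trans (le_of_eq ?_); ring
  · apply DifferentiableOn.diffContOnCl
    intro z hzz
    rw [closure_ball _ (by norm_num)] at hzz
    obtain ⟨b1, b2, b3, b4⟩ := hz z hzz
    exact (differentiableAt_riemannZeta (by rintro rfl; simp at b3; linarith)).differentiableWithinAt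
  · intro z hzz
    obtain ⟨b1, b2, b3, b4⟩ := hz z (Metric.sphere_subset_closedBall hzz)
    have := h z.re z.im b1 b2 b3
    rw [re_add_im] at this
    refine this.trans ?_
    rw [mul_assoc]
    gcongr
    calc z.im ^ (7/8 : ℝ) ≤ (2 * t) ^ (7/8 : ℝ) := by gcongr
      _ = 2 ^ (7/8 : ℝ) * t ^ (7/8 : ℝ) := Real.mul_rpow (by norm_num) ht0.le
      _ ≤ 2 ^ (1 : ℝ) * t ^ (7/8 : ℝ) := by
          gcongr
          · norm_num
          · norm_num
      _ = _ := by norm_num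

end Shanks

namespace Shanks

lemma factor {U : Set ℂ} (hU : IsOpen U) {f : ℂ → ℂ} (hf : DifferentiableOn ℂ f U) (S : Finset ℂ)
    (hS : ∀ ρ ∈ S, ρ ∈ U) (hord : ∀ ρ ∈ S, analyticOrderAt f ρ ≠ ⊤) :
    ∃ g : ℂ → ℂ, DifferentiableOn ℂ g U ∧ (∀ ρ ∈ S, g ρ ≠ 0) ∧
      ∀ z, f z = (∏ ρ ∈ S, (z - ρ) ^ analyticOrderNatAt f ρ) * g z := by
  classical
  have han : ∀ ρ ∈ S, AnalyticAt ℂ f ρ := fun ρ hρ => hf.analyticAt (hU.mem_nhds (hS ρ hρ))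
  have hex : ∀ ρ : ℂ, ∃ h : ℂ → ℂ, ρ ∈ S → AnalyticAt ℂ h ρ ∧ h ρ ≠ 0 ∧
      f =ᶠ[nhds ρ] fun z ↦ (z - ρ) ^ analyticOrderNatAt f ρ • h z := by
    intro ρ
    by_cases hρ : ρ ∈ S
    · obtain ⟨h, hh⟩ := (han ρ hρ).analyticOrderAt_ne_top.1 (hord ρ hρ)
      exact ⟨h, fun _ => hh⟩
    · exact ⟨0, fun h => absurd h hρ⟩
  choose h hh using hex
  set m := analyticOrderNatAt f
  let P : Finset ℂ → ℂ → ℂ := fun S z => ∏ ρ ∈ S, (z - ρ) ^ m ρ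
  have hP0 : ∀ (S : Finset ℂ) (z : ℂ), z ∉ S → P S z ≠ 0 := by
    intro S z hz
    refine prod_ne_zero_iff.2 fun ρ hρ => pow_ne_zero _ (sub_ne_zero.2 ?_)
    rintro rfl; exact hz hρ
  have hPd : ∀ S, Differentiable ℂ (P S) := by
    intro S; simp only [P]; fun_prop
  have hsplit : ∀ ρ ∈ S, ∀ z, P S z = (z - ρ) ^ m ρ * P (S.erase ρ) z := by
    intro ρ hρ z
    exact (mul_prod_erase S (fun ρ => (z - ρ) ^ m ρ) hρ).symm
  let g : ℂ → ℂ := fun z => if z ∈ S then h z z / P (S.erase z) z else f z / P S z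
  have hloc : ∀ ρ ∈ S, g =ᶠ[nhds ρ] fun z => h ρ z / P (S.erase ρ) z := by
    intro ρ hρ
    have h1 : ∀ᶠ z in nhds ρ, z ∉ S.erase ρ :=
      (S.erase ρ).finite_toSet.isClosed.isOpen_compl.eventually_mem (by simp)
    filter_upwards [h1, (hh ρ hρ).2.2] with z hz1 hz2
    by_cases hzρ : z = ρ
    · subst hzρ; simp [g, hρ]
    · have hzS : z ∉ S := fun hc => hz1 (mem_erase.2 ⟨hzρ, hc⟩)
      simp only [g, hzS, if_false]
      rw [hz2, hsplit ρ hρ z, smul_eq_mul]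
      have := hP0 _ z hz1
      have : (z - ρ) ^ m ρ ≠ 0 := pow_ne_zero _ (sub_ne_zero.2 hzρ)
      field_simp
  refine ⟨g, ?_, ?_, ?_⟩
  · intro z hz
    apply DifferentiableAt.differentiableWithinAt
    by_cases hzS : z ∈ S
    · refine (DifferentiableAt.congr_of_eventuallyEq ?_ (hloc z hzS))
      exact (hh z hzS).1.differentiableAt.div (hPd _ z) (hP0 _ z (by simp))
    · have h1 : ∀ᶠ w in nhds z, w ∉ S :=
        S.finite_toSet.isClosed.isOpen_compl.eventually_mem (by simpa using hzS)
      have : g =ᶠ[nhds z] fun w => f w / P S w := by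
        filter_upwards [h1] with w hw
        simp [g, hw]
      refine (DifferentiableAt.congr_of_eventuallyEq ?_ this)
      exact (hf.differentiableAt (hU.mem_nhds hz)).div (hPd _ z) (hP0 _ z hzS)
  · intro ρ hρ
    simp only [g, hρ, if_true]
    exact div_ne_zero (hh ρ hρ).2.1 (hP0 _ _ (by simp))
  · intro z
    show f z = P S z * g z
    by_cases hzS : z ∈ S
    · have e := (hh z hzS).2.2.eq_of_nhds
      simp only [g, hzS, if_true]
      have := hP0 (S.erase z) z (by simp)
      rw [e, hsplit z hzS z, smul_eq_mul]
      field_simp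
    · simp only [g, hzS, if_false]
      have := hP0 _ z hzS
      field_simp

lemma logDeriv_factor {f g : ℂ → ℂ} {S : Finset ℂ} {m : ℂ → ℕ} {z : ℂ}
    (hfg : ∀ z, f z = (∏ ρ ∈ S, (z - ρ) ^ m ρ) * g z) (hz : z ∉ S) (hg : DifferentiableAt ℂ g z) (hg0 : g z ≠ 0) :
    deriv f z / f z = ∑ ρ ∈ S, (m ρ : ℂ) * (z - ρ)⁻¹ + deriv g z / g z := by
  have e : f = fun z => (∏ ρ ∈ S, (z - ρ) ^ m ρ) * g z := funext hfg
  have hne : ∀ ρ ∈ S, (z - ρ) ^ m ρ ≠ 0 := by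
    intro ρ hρ
    refine pow_ne_zero _ (sub_ne_zero.2 ?_)
    rintro rfl; exact hz hρ
  have h1 := logDeriv_mul (f := fun z => ∏ ρ ∈ S, (z - ρ) ^ m ρ) (g := g) z (prod_ne_zero_iff.2 hne) hg0
    (by fun_prop) hg
  have h2 := logDeriv_prod (s := S) (f := fun ρ z => (z - ρ) ^ m ρ) (x := z) hne (by intros; fun_prop)
  rw [← logDeriv_apply f, ← logDeriv_apply g, e, h1, h2]
  congr 1
  refine sum_congr rfl fun ρ _ => ?_
  rw [logDeriv_fun_pow (by fun_prop)]
  simp [logDeriv_apply]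

lemma order_ne_top_ball {f : ℂ → ℂ} {c : ℂ} {R : ℝ} (hR : 0 < R)
    (hf : DifferentiableOn ℂ f (Metric.ball c R)) (hc : f c ≠ 0) {z : ℂ} (hz : z ∈ Metric.ball c R) :
    analyticOrderAt f z ≠ ⊤ := by
  intro h
  rw [analyticOrderAt_eq_top] at h
  have := (hf.analyticOnNhd Metric.isOpen_ball).eqOn_zero_of_preconnected_of_eventuallyEq_zero
    (convex_ball c R).isPreconnected hz h (Metric.mem_ball_self hR)
  exact hc this

open Metric in
lemma zero_count {f : ℂ → ℂ} {c : ℂ} {M : ℝ} (hf : DifferentiableOn ℂ f (Metric.ball c 2)) (hc : f c ≠ 0)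
    (hM : 1 ≤ M) (hfM : ∀ z ∈ Metric.closedBall c (15/8), ‖f z‖ ≤ M)
    (S : Finset ℂ) (hS : ∀ z ∈ S, z ∈ closedBall c (7/4)) (hS0 : ∀ z ∈ closedBall c (7/4), f z = 0 → z ∈ S) :
    ((∑ ρ ∈ S, analyticOrderNatAt f ρ : ℕ) : ℝ) ≤ 15 * Real.log (M / ‖f c‖) := by
  have hsub : ∀ r : ℝ, r < 2 → closedBall c r ⊆ ball c 2 := fun r hr => closedBall_subset_ball hr
  have a0 := hf.analyticOnNhd isOpen_ball
  have h := AnalyticOnNhd.sum_divisor_le (f := f) (c := c) (r := 7/4) (R := 15/8) (M := M) (by norm_num) (by norm_num [abs_of_pos])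
    hM (by rw [abs_of_pos (by norm_num)]; exact a0.mono (hsub _ (by norm_num))) hc
    (by intro z hz; rw [abs_of_pos (by norm_num)] at hz; exact hfM z (sphere_subset_closedBall hz))
  rw [abs_of_pos (by norm_num)] at h
  have e : ∑ᶠ u, MeromorphicOn.divisor f (closedBall c (7/4)) u = ((∑ ρ ∈ S, analyticOrderNatAt f ρ : ℕ) : ℤ) := by
    rw [finsum_eq_sum_of_support_subset (s := S)]
    · push_cast
      refine sum_congr rfl fun ρ hρ => ?_
      rw [MeromorphicOn.AnalyticOnNhd.divisor_apply (a0.mono (hsub _ (by norm_num))) (hS ρ hρ)]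
      have := order_ne_top_ball (by norm_num) hf hc (hsub (7/4) (by norm_num) (hS ρ hρ))
      rw [analyticOrderNatAt]
      obtain ⟨n, hn⟩ := ENat.ne_top_iff_exists.1 this
      rw [← hn]; simp
    · intro z hz
      rw [Function.mem_support] at hz
      have hzb : z ∈ closedBall c (7/4) := by
        by_contra hcon
        exact hz ((MeromorphicOn.divisor f _).apply_eq_zero_of_notMem hcon)
      apply hS0 z hzb
      by_contra h0
      apply hz
      rw [MeromorphicOn.AnalyticOnNhd.divisor_apply (a0.mono (hsub _ (by norm_num))) hzb]
      rw [(a0 z (hsub _ (by norm_num) hzb)).analyticOrderAt_eq_zero.2 h0]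
      simp
  rw [e] at h
  have hl : 1/15 ≤ Real.log ((15/8) / (7/4)) := by
    have := Real.one_sub_inv_le_log_of_pos (x := (15/8) / (7/4)) (by norm_num)
    norm_num at this ⊢; linarith
  rw [le_div_iff₀ (by linarith)] at h
  have hn : (0:ℝ) ≤ ((∑ ρ ∈ S, analyticOrderNatAt f ρ : ℕ) : ℝ) := by positivity
  push_cast at h hn ⊢
  nlinarith

end Shanks

namespace Shanks

open Metric in
lemma landau {f : ℂ → ℂ} {c : ℂ} {M : ℝ} (hf : DifferentiableOn ℂ f (ball c 2)) (hc : f c ≠ 0)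
    (hM : 1 ≤ M) (hfM : ∀ z ∈ closedBall c (15/8), ‖f z‖ ≤ M)
    (S : Finset ℂ) (hS : ∀ z ∈ S, z ∈ closedBall c (7/4)) (hS0 : ∀ z ∈ closedBall c (7/4), f z = 0 → z ∈ S)
    {z : ℂ} (hz : z ∈ closedBall c (3/2)) {η : ℝ} (hη : 0 < η) (hzη : ∀ ρ ∈ S, η ≤ ‖z - ρ‖) :
    ‖deriv f z / f z‖ ≤ 15 * Real.log (M / ‖f c‖) / η + 208 * (46 * Real.log (M / ‖f c‖) + 1) := by
  set B := Real.log (M / ‖f c‖) with hB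
  have hsub : ∀ r : ℝ, r < 2 → closedBall c r ⊆ ball c 2 := fun r hr => closedBall_subset_ball hr
  have hSU : ∀ ρ ∈ S, ρ ∈ ball c 2 := fun ρ hρ => hsub _ (by norm_num) (hS ρ hρ)
  have hord : ∀ ρ ∈ S, analyticOrderAt f ρ ≠ ⊤ := fun ρ hρ =>
    order_ne_top_ball (by norm_num) hf hc (hSU ρ hρ)
  have hcnt := zero_count hf hc hM hfM S hS hS0
  obtain ⟨g, hg, hgS, hfg⟩ := factor isOpen_ball hf S hSU hord
  set m := analyticOrderNatAt f
  set N := ∑ ρ ∈ S, m ρ with hN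
  rw [← hB] at hcnt
  have hfc : 0 < ‖f c‖ := norm_pos_iff.2 hc
  have hMf : 0 < M / ‖f c‖ := by positivity
  -- lower bound for product on the sphere
  have hgb : ∀ w ∈ sphere c (15/8), ‖g w‖ ≤ M * 8 ^ N := by
    intro w hw
    have h1 := hfM w (sphere_subset_closedBall hw)
    rw [hfg w, norm_mul, norm_prod] at h1
    have h2 : (1/8 : ℝ) ^ N ≤ ∏ ρ ∈ S, ‖(w - ρ) ^ m ρ‖ := by
      rw [hN, ← prod_pow_eq_pow_sum]
      refine prod_le_prod (fun _ _ => by positivity) fun ρ hρ => ?_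
      rw [norm_pow]
      gcongr
      have a1 := hS ρ hρ
      rw [mem_sphere] at hw
      rw [mem_closedBall] at a1
      have := dist_triangle w ρ c
      rw [← dist_eq]
      linarith
    have h3 : (1/8 : ℝ) ^ N * ‖g w‖ ≤ M := le_trans (by gcongr) h1
    have h4 : (1/8 : ℝ) ^ N * 8 ^ N = 1 := by rw [← mul_pow]; norm_num
    calc ‖g w‖ = ((1/8 : ℝ) ^ N * ‖g w‖) * 8 ^ N := by linear_combination (-‖g w‖) * h4
      _ ≤ M * 8 ^ N := by gcongr
  have hgb2 : ∀ w ∈ closedBall c (15/8), ‖g w‖ ≤ M * 8 ^ N := by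
    intro w hw
    apply norm_le_of_forall_mem_frontier_norm_le (f := g) (U := ball c (15/8)) isBounded_ball
    · apply DifferentiableOn.diffContOnCl
      rw [closure_ball _ (by norm_num)]
      exact hg.mono (hsub _ (by norm_num))
    · rw [frontier_ball _ (by norm_num)]
      exact hgb
    · rw [closure_ball _ (by norm_num)]
      exact hw
  have hgc : ‖f c‖ ≤ 2 ^ N * ‖g c‖ := by
    rw [hfg c, norm_mul, norm_prod]
    gcongr
    rw [hN, ← prod_pow_eq_pow_sum]
    refine prod_le_prod (fun _ _ => by positivity) fun ρ hρ => ?_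
    rw [norm_pow]
    gcongr
    have a1 := hS ρ hρ
    rw [mem_closedBall, dist_comm, dist_eq] at a1
    linarith
  have hgc0 : 0 < ‖g c‖ := by
    by_contra hcon
    have : ‖g c‖ = 0 := le_antisymm (not_lt.1 hcon) (norm_nonneg _)
    rw [this, mul_zero] at hgc
    linarith
  have hgne : ∀ w ∈ closedBall c (7/4), g w ≠ 0 := by
    intro w hw h0
    by_cases hwS : w ∈ S
    · exact hgS w hwS h0
    · exact hwS (hS0 w hw (by rw [hfg w, h0, mul_zero]))
  -- logarithm
  have hb74 : ball c (7/4) ⊆ ball c 2 := ball_subset_ball (by norm_num)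
  have hg74 := hg.mono hb74
  have hq : DifferentiableOn ℂ (fun w => deriv g w / g w) (ball c (7/4)) := by
    apply DifferentiableOn.div (hg74.deriv isOpen_ball) hg74
    exact fun w hw => hgne w (ball_subset_closedBall hw)
  obtain ⟨h, hhc, hh⟩ := hq.isExactOn_ball.with_val_at c 0
  have hexp : ∀ w ∈ ball c (7/4), exp (h w) = g w / g c := by
    have key : ∀ w ∈ ball c (7/4), HasDerivWithinAt (fun w => g w * exp (- h w)) 0 (ball c (7/4)) w := by
      intro w hw
      have h1 := (hg74.differentiableAt (isOpen_ball.mem_nhds hw)).hasDerivAt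
      have h2 := (h1.mul (hh w hw).neg.cexp).hasDerivWithinAt (s := ball c (7/4))
      refine HasDerivWithinAt.congr_deriv h2 ?_
      have := hgne w (ball_subset_closedBall hw)
      simp only [Pi.neg_apply]
      field_simp
      ring
    intro w hw
    have := (convex_ball c (7/4)).norm_image_sub_le_of_norm_hasDerivWithin_le (C := 0) key (by simp)
      (mem_ball_self (by norm_num)) hw
    rw [zero_mul] at this
    have := sub_eq_zero.1 (norm_le_zero_iff.1 this)
    rw [hhc, neg_zero, exp_zero, mul_one, exp_neg] at this
    have h0 := exp_ne_zero (h w)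
    rw [← this]
    have := hgne w (ball_subset_closedBall hw)
    field_simp
  have hNB : (N:ℝ) ≤ 15 * B := hcnt
  have hB0 : 0 ≤ B := by
    have : (0:ℝ) ≤ N := by positivity
    linarith
  have hre : ∀ w ∈ ball c (7/4), (h w).re ≤ 46 * B + 1 := by
    intro w hw
    have h1 : Real.exp (h w).re = ‖g w‖ / ‖g c‖ := by
      rw [← norm_exp, hexp w hw, norm_div]
    have h2 : ‖g w‖ / ‖g c‖ ≤ (M / ‖f c‖) * 16 ^ N := by
      have a1 := hgb2 w (closedBall_subset_closedBall (by norm_num) (ball_subset_closedBall hw))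
      rw [div_le_iff₀ hgc0]
      calc ‖g w‖ ≤ M * 8 ^ N := a1
        _ = (M / ‖f c‖) * 8 ^ N * ‖f c‖ := by field_simp
        _ ≤ (M / ‖f c‖) * 8 ^ N * (2 ^ N * ‖g c‖) := by gcongr
        _ = (M / ‖f c‖) * 16 ^ N * ‖g c‖ := by
          have : (16:ℝ) ^ N = 8 ^ N * 2 ^ N := by rw [← mul_pow]; norm_num
          rw [this]; ring
    have h3 : (M / ‖f c‖) * 16 ^ N ≤ Real.exp (B + 3 * N) := by
      rw [Real.exp_add, hB, Real.exp_log hMf, mul_comm (3:ℝ), Real.exp_nat_mul]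
      gcongr
      have := Real.exp_one_gt_d9
      calc (16:ℝ) ≤ 2.7 ^ 3 := by norm_num
        _ ≤ (Real.exp 1) ^ 3 := by gcongr; linarith
        _ = Real.exp 3 := by rw [← Real.exp_nat_mul]; norm_num
    have := Real.exp_le_exp.1 ((h1.le.trans h2).trans h3)
    linarith
  have hbd : ∀ w ∈ closedBall c (13/8), ‖h w‖ ≤ 26 * (46 * B + 1) := by
    intro w hw
    have hw' : ‖w - c‖ ≤ 13/8 := by rwa [mem_closedBall, dist_eq] at hw
    have := borelCaratheodory_zero (f := fun u => h (c + u)) (M := 46 * B + 1) (R := 7/4) (z := w - c) (by linarith)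
      ?_ ?_ (by norm_num) ?_ (by simpa using hhc)
    · simp only [add_sub_cancel] at this
      refine this.trans ?_
      rw [div_le_iff₀ (by linarith)]
      have : 0 ≤ 46 * B + 1 := by linarith
      nlinarith [norm_nonneg (w - c)]
    · intro u hu
      apply DifferentiableAt.differentiableWithinAt
      have : c + u ∈ ball c (7/4) := by simpa [dist_eq] using hu
      exact (hh _ this).differentiableAt.comp u (by fun_prop)
    · intro u hu
      have : c + u ∈ ball c (7/4) := by simpa [dist_eq] using hu
      exact hre _ this
    · rw [mem_ball, dist_zero_right]; linarith
  have hzz : ‖z - c‖ ≤ 3/2 := by rwa [mem_closedBall, dist_eq] at hz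
  have hz74 : z ∈ ball c (7/4) := by rw [mem_ball, dist_eq]; linarith
  have hder : ‖deriv h z‖ ≤ 26 * (46 * B + 1) / (1/8) := by
    have hsub2 : closedBall z (1/8) ⊆ closedBall c (13/8) := by
      apply closedBall_subset_closedBall'
      rw [dist_eq]; linarith
    apply norm_deriv_le_of_forall_mem_sphere_norm_le (by norm_num)
    · apply DifferentiableOn.diffContOnCl
      rw [closure_ball _ (by norm_num)]
      intro u hu
      have hu' := hsub2 hu
      have : u ∈ ball c (7/4) := closedBall_subset_ball (by norm_num) hu'
      exact (hh _ this).differentiableAt.differentiableWithinAt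
    · intro u hu
      exact hbd u (hsub2 (sphere_subset_closedBall hu))
  rw [(hh z hz74).deriv] at hder
  have hzS : z ∉ S := by
    intro hc
    have := hzη z hc
    simp at this; linarith
  rw [logDeriv_factor hfg hzS (hg74.differentiableAt (isOpen_ball.mem_nhds hz74))
    (hgne z (ball_subset_closedBall hz74))]
  refine (norm_add_le _ _).trans (add_le_add ?_ (hder.trans (le_of_eq (by ring))))
  calc ‖∑ ρ ∈ S, (m ρ : ℂ) * (z - ρ)⁻¹‖ ≤ ∑ ρ ∈ S, (m ρ : ℝ) * η⁻¹ := by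
        refine norm_sum_le_of_le _ fun ρ hρ => ?_
        rw [norm_mul, norm_inv, norm_natCast]
        gcongr
        exact hzη ρ hρ
    _ = (N:ℝ) / η := by rw [← sum_mul, hN]; push_cast; ring
    _ ≤ 15 * B / η := by gcongr

end Shanks

namespace Shanks

lemma zeta_re_two {s : ℂ} (hs : 2 ≤ s.re) : ‖riemannZeta s - 1‖ ≤ 7/10 := by
  rw [zeta_eq_tsum_one_div_nat_add_one_cpow (by linarith)]
  have hsum2 : HasSum (fun n : ℕ => 1 / ((n:ℝ)+1)^2) (Real.pi^2/6) := by
    have h := hasSum_zeta_two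
    have := (hasSum_nat_add_iff' 1).mpr h
    simpa using this
  have hle : ∀ n : ℕ, ‖1 / ((n:ℂ)+1)^s‖ ≤ 1 / ((n:ℝ)+1)^2 := by
    intro n
    have h1 : ((n:ℂ)+1) = (((n:ℝ)+1 : ℝ) : ℂ) := by push_cast; ring
    rw [norm_div, norm_one, h1, Complex.norm_cpow_eq_rpow_re_of_pos (by positivity)]
    apply one_div_le_one_div_of_le (by positivity)
    rw [← Real.rpow_natCast]
    apply Real.rpow_le_rpow_of_exponent_le
    · have : (0:ℝ) ≤ n := by positivity
      linarith
    · simpa using hs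
  have hsum : Summable (fun n : ℕ => 1 / ((n:ℂ)+1)^s) :=
    Summable.of_norm_bounded hsum2.summable hle
  rw [hsum.tsum_eq_zero_add]
  simp only [Nat.cast_zero, zero_add, one_cpow, div_one, add_sub_cancel_left]
  have h3 : HasSum (fun n : ℕ => 1 / (((n+1:ℕ):ℝ)+1)^2) (Real.pi^2/6 - 1) := by
    have := (hasSum_nat_add_iff' 1).mpr hsum2
    simpa using this
  refine (tsum_of_norm_bounded h3 (fun n => hle (n+1))).trans ?_
  nlinarith [Real.pi_lt_d2, Real.pi_pos]

lemma zeta_conj_deriv (s : ℂ) : deriv riemannZeta (starRingEnd ℂ s) = starRingEnd ℂ (deriv riemannZeta s) := by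
  have h := congrFun (deriv_conj_conj (𝕜 := ℂ) (f := riemannZeta)) (starRingEnd ℂ s)
  have h2 : (starRingEnd ℂ) ∘ riemannZeta ∘ (starRingEnd ℂ) = riemannZeta := by
    funext z; simp [Function.comp, riemannZeta_conj]
  rw [h2] at h
  simpa using h

lemma XX_ne {s : ℂ} (h1 : 0 < s.re) (h2 : 0 < s.im) : XX s ≠ 0 := by
  unfold XX
  have := cos_ne h2
  have h3 : Gamma s ≠ 0 := Complex.Gamma_ne_zero_of_re_pos h1
  have h4 : (2 * (Real.pi:ℂ)) ≠ 0 := by simp [Real.pi_ne_zero]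
  simp_all [Complex.cpow_eq_zero_iff]

lemma zeta_refl_ne {s : ℂ} (h1 : 0 < s.re) (h2 : 0 < s.im) (h0 : riemannZeta s ≠ 0) :
    riemannZeta (1 - starRingEnd ℂ s) ≠ 0 := by
  have hs1 : s ≠ 1 := by rintro rfl; simp at h2
  have h := zeta_fe h1 hs1
  have e : (1 - starRingEnd ℂ s) = starRingEnd ℂ (1 - s) := by simp
  rw [e, riemannZeta_conj, h]
  simp [XX_ne h1 h2, h0]

lemma zeta_refl_logDeriv {s : ℂ} (h1 : 0 < s.re) (h2 : 0 < s.im) (h0 : riemannZeta s ≠ 0) :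
    deriv riemannZeta (1 - starRingEnd ℂ s) / riemannZeta (1 - starRingEnd ℂ s)
      = - starRingEnd ℂ (qX s + deriv riemannZeta s / riemannZeta s) := by
  have hs1 : s ≠ 1 := by rintro rfl; simp at h2
  have hs0 : (1 - s) ≠ 1 := by
    intro h; have : s = 0 := by linear_combination -h
    rw [this] at h1; simp at h1
  have h := zeta_fe h1 hs1
  have hX := XX_ne h1 h2
  have e : (1 - starRingEnd ℂ s) = starRingEnd ℂ (1 - s) := by simp
  have hev : (fun z => riemannZeta (1 - z)) =ᶠ[nhds s] fun z => XX z * riemannZeta z := by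
    have hh : ∀ᶠ z in nhds s, 0 < z.im :=
      (isOpen_lt continuous_const Complex.continuous_im).mem_nhds h2
    have hr : ∀ᶠ z in nhds s, 0 < z.re :=
      (isOpen_lt continuous_const Complex.continuous_re).mem_nhds h1
    filter_upwards [hh, hr] with z hz hz'
    exact zeta_fe hz' (by rintro rfl; simp at hz)
  have d1 : HasDerivAt (fun z => riemannZeta (1 - z)) (-(deriv riemannZeta (1 - s))) s := by
    have := ((differentiableAt_riemannZeta hs0).hasDerivAt).comp s ((hasDerivAt_id s).const_sub 1)
    simpa [Function.comp_def] using this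
  have d2 := (XX_hasDeriv h1 h2).mul (differentiableAt_riemannZeta hs1).hasDerivAt
  have d3 := d1.unique (d2.congr_of_eventuallyEq hev)
  rw [e, zeta_conj_deriv, riemannZeta_conj, h, ← map_div₀, ← map_neg]
  congr 1
  have : deriv riemannZeta (1 - s) = -(XX s * qX s * riemannZeta s + XX s * deriv riemannZeta s) := by
    rw [← d3]; ring
  rw [this]
  field_simp

lemma refl_pt (σ t : ℝ) : ((σ:ℂ) + t*I) = 1 - starRingEnd ℂ (((1-σ:ℝ):ℂ) + t*I) := by
  simp; ring

theorem logDeriv_right (δ : ℝ) (hδ : 0 < δ) : ∃ C > 0, ∃ T0 ≥ 3, ∀ T ≥ T0, AdmissibleHeight δ T →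
    ∀ σ : ℝ, 1/2 ≤ σ → σ ≤ 9/8 → riemannZeta (σ + T*I) ≠ 0 ∧
      ‖deriv riemannZeta (σ + T*I) / riemannZeta (σ + T*I)‖ ≤ C * Real.log T ^ 2 := by
  obtain ⟨C, hC, hz⟩ := zeta_strip
  have hev : ∀ᶠ T : ℝ in atTop, C * (2*T)^(7/8:ℝ) + 2 ≤ T := by
    have h1 : ∀ᶠ T : ℝ in atTop, 4 ≤ T := eventually_ge_atTop 4
    have h2 : ∀ᶠ T : ℝ in atTop, 2 * C * 2^(7/8:ℝ) ≤ T^(1/8:ℝ) :=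
      (tendsto_rpow_atTop (by norm_num)).eventually_ge_atTop _
    filter_upwards [h1, h2] with T h1 h2
    have h3 : T^(7/8:ℝ) * T^(1/8:ℝ) = T := by
      rw [← Real.rpow_add (by linarith)]; norm_num
    rw [Real.mul_rpow (by norm_num) (by linarith)]
    have h4 := mul_le_mul_of_nonneg_left h2 (show 0 ≤ T^(7/8:ℝ) by positivity)
    rw [h3] at h4
    nlinarith
  obtain ⟨T1, hT1⟩ := eventually_atTop.mp hev
  refine ⟨30/δ + 208*(92+1), by positivity, max T1 10, le_trans (by norm_num) (le_max_right _ _), ?_⟩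
  intro T hT hadm σ hσ1 hσ2
  have hT10 : 10 ≤ T := (le_max_right _ _).trans hT
  have hTb := hT1 T ((le_max_left _ _).trans hT)
  have hL : 1 ≤ Real.log T := by
    rw [Real.le_log_iff_exp_le (by linarith)]
    linarith [Real.exp_one_lt_d9]
  set z : ℂ := (σ:ℂ) + T*I with hzdef
  have hzre : z.re = σ := by simp [hzdef]
  have hzim : z.im = T := by simp [hzdef]
  have hη : 0 < δ / Real.log T := by positivity
  set c : ℂ := (2:ℂ) + T*I with hc
  have hcre : c.re = 2 := by simp [hc]
  have hcim : c.im = T := by simp [hc]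
  have hne : riemannZeta z ≠ 0 := by
    intro h0
    rcases lt_or_ge σ 1 with h | h
    · have := hadm z ⟨h0, by rw [hzre]; linarith, by rw [hzre]; exact h⟩
      rw [hzim] at this; simp at this; linarith
    · exact riemannZeta_ne_zero_of_one_le_re (by rw [hzre]; exact h) h0
  refine ⟨hne, ?_⟩
  have hfc : ‖riemannZeta c - 1‖ ≤ 7/10 := zeta_re_two (by rw [hcre])
  have hfc2 : 3/10 ≤ ‖riemannZeta c‖ := by
    have h : ‖(1:ℂ)‖ ≤ ‖riemannZeta c‖ + ‖riemannZeta c - 1‖ := by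
      have := norm_sub_le (riemannZeta c) (riemannZeta c - 1)
      simpa using this
    rw [norm_one] at h; linarith
  have hfin := (isCompact_closedBall c (7/4)).inter_riemannZetaZeros_finite
  have hl := landau (f := riemannZeta) (c := c) (M := T) (S := hfin.toFinset) (z := z) (η := δ / Real.log T)
    ?_ ?_ (by linarith) ?_ ?_ ?_ ?_ hη ?_
  · have hlog : Real.log (T/‖riemannZeta c‖) ≤ 2 * Real.log T := by
      have : Real.log (T^2) = 2 * Real.log T := by simp
      rw [← this]
      apply Real.log_le_log (by positivity)
      rw [div_le_iff₀ (by linarith)]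
      nlinarith
    refine hl.trans ?_
    have e : (30/δ + 208*(92+1)) * Real.log T ^ 2 = 15*(2*Real.log T)/(δ/Real.log T) + 208*(92*Real.log T^2+Real.log T^2) := by
      field_simp; ring
    rw [e]
    gcongr ?_ + 208 * ?_
    · gcongr
    · nlinarith
  · intro w hw
    apply (differentiableAt_riemannZeta _).differentiableWithinAt
    rintro rfl
    rw [Metric.mem_ball, dist_eq] at hw
    have := Complex.abs_im_le_norm (1 - c)
    simp [hcim, abs_of_pos (show 0 < T by linarith)] at this
    linarith
  · intro h; rw [h] at hfc2; simp at hfc2; linarith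
  · intro w hw
    rw [Metric.mem_closedBall, dist_eq] at hw
    have h1 := abs_le.mp ((Complex.abs_im_le_norm (w - c)).trans hw)
    have h2 := abs_le.mp ((Complex.abs_re_le_norm (w - c)).trans hw)
    simp only [sub_im, sub_re, hcre, hcim] at h1 h2
    rcases le_or_gt w.re 2 with h | h
    · have h3 := hz w.re w.im (by linarith) (by linarith) (by linarith)
      rw [re_add_im] at h3
      refine h3.trans (le_trans ?_ hTb)
      have : w.im^(7/8:ℝ) ≤ (2*T)^(7/8:ℝ) := Real.rpow_le_rpow (by linarith) (by linarith) (by norm_num)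
      nlinarith
    · have h3 := zeta_re_two h.le
      have h4 := norm_add_le (riemannZeta w - 1) 1
      simp at h4; linarith
  · intro w hw; simp at hw; simpa using hw.1
  · intro w hw h0; simp [mem_riemannZetaZeros, h0]; simpa using hw
  · rw [Metric.mem_closedBall, dist_eq]
    have : z - c = ((σ - 2:ℝ):ℂ) := by rw [hzdef, hc]; push_cast; ring
    rw [this, Complex.norm_real, Real.norm_eq_abs, abs_le]
    constructor <;> linarith
  · intro ρ hρ
    simp [mem_riemannZetaZeros] at hρ
    obtain ⟨h1, h2⟩ := hρ
    rw [dist_eq] at h1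
    have h3 := abs_le.mp ((Complex.abs_re_le_norm (ρ - c)).trans h1)
    simp only [sub_re, hcre] at h3
    have := hadm ρ ⟨h2, by linarith, by
      by_contra hcon
      exact riemannZeta_ne_zero_of_one_le_re (not_lt.mp hcon) h2⟩
    refine this.trans ?_
    have h5 := Complex.abs_im_le_norm (z - ρ)
    rwa [sub_im, hzim] at h5

theorem logDeriv_adm (δ : ℝ) (hδ : 0 < δ) : ∃ C > 0, ∃ T0 ≥ 3, ∀ T ≥ T0, AdmissibleHeight δ T →
    ∀ σ : ℝ, -1/8 ≤ σ → σ ≤ 9/8 → riemannZeta (σ + T*I) ≠ 0 ∧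
      ‖deriv riemannZeta (σ + T*I) / riemannZeta (σ + T*I)‖ ≤ C * Real.log T ^ 2 := by
  obtain ⟨C, hC, T0, hT0, h⟩ := logDeriv_right δ hδ
  refine ⟨C + 9, by positivity, max T0 10, le_trans (by norm_num) (le_max_right _ _), ?_⟩
  intro T hT hadm σ hσ1 hσ2
  have hT10 : 10 ≤ T := (le_max_right _ _).trans hT
  have hTT := (le_max_left _ _).trans hT
  have hL : 1 ≤ Real.log T := by
    rw [Real.le_log_iff_exp_le (by linarith)]
    linarith [Real.exp_one_lt_d9]
  rcases le_or_gt (1/2) σ with h1 | h1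
  · obtain ⟨h2, h3⟩ := h T hTT hadm σ h1 hσ2
    refine ⟨h2, h3.trans ?_⟩
    gcongr; linarith
  · obtain ⟨h2, h3⟩ := h T hTT hadm (1-σ) (by linarith) (by linarith)
    have hre : 0 < (((1-σ:ℝ):ℂ) + T*I).re := by simp; linarith
    have him : 0 < (((1-σ:ℝ):ℂ) + T*I).im := by simp; linarith
    rw [refl_pt]
    refine ⟨zeta_refl_ne hre him h2, ?_⟩
    rw [zeta_refl_logDeriv hre him h2, norm_neg, Complex.norm_conj]
    refine (norm_add_le _ _).trans ?_
    have hq := qX_bd (σ := 1-σ) (t := T) (by linarith) (by linarith) (by linarith)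
    have hq2 : ‖qX (((1-σ:ℝ):ℂ) + T*I)‖ ≤ 8/T + Real.log T := by
      have h5 := norm_le_norm_add_norm_sub' (qX (((1-σ:ℝ):ℂ) + T*I)) ((Real.log (T/(2*Real.pi)):ℝ):ℂ)
      rw [Complex.norm_real, Real.norm_eq_abs, abs_of_nonneg] at h5
      · have : Real.log (T/(2*Real.pi)) ≤ Real.log T := by
          apply Real.log_le_log
          · positivity
          · apply div_le_self (by linarith)
            linarith [Real.pi_gt_three]
        linarith
      · apply Real.log_nonneg
        rw [le_div_iff₀ (by positivity)]
        linarith [Real.pi_lt_d2]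
    have h8 : 8/T ≤ 1 := by rw [div_le_one (by linarith)]; linarith
    nlinarith
end Shanks

namespace Shanks

/-- Boundary integral over a rectangle. -/
noncomputable def rectI (f : ℂ → ℂ) (b a t0 T : ℝ) : ℂ :=
  (∫ x in b..a, f (x + t0*I)) - (∫ x in b..a, f (x+T*I)) + I*(∫ y in t0..T, f (a+y*I))
    - I*(∫ y in t0..T, f (b+y*I))

/-- Boundary of a rectangle. -/
def rectBd (b a t0 T : ℝ) : Set ℂ :=
  {z | (b ≤ z.re ∧ z.re ≤ a ∧ (z.im = t0 ∨ z.im = T)) ∨ (t0 ≤ z.im ∧ z.im ≤ T ∧ (z.re = a ∨ z.re = b))}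

section
variable {b a t0 T : ℝ}

lemma rectBd_int {f : ℂ → ℂ} (hab : b ≤ a) (ht : t0 ≤ T) (hf : ContinuousOn f (rectBd b a t0 T)) :
    IntervalIntegrable (fun x : ℝ => f (x + t0*I)) MeasureTheory.volume b a ∧
    IntervalIntegrable (fun x : ℝ => f (x + T*I)) MeasureTheory.volume b a ∧
    IntervalIntegrable (fun y : ℝ => f (a + y*I)) MeasureTheory.volume t0 T ∧
    IntervalIntegrable (fun y : ℝ => f (b + y*I)) MeasureTheory.volume t0 T := by
  refine ⟨?_, ?_, ?_, ?_⟩ <;>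
  · apply ContinuousOn.intervalIntegrable
    refine hf.comp (by fun_prop) ?_
    intro x hx
    rw [Set.uIcc_of_le (by assumption)] at hx
    simp [rectBd, hx.1, hx.2]

lemma rectI_add {f g : ℂ → ℂ} (hab : b ≤ a) (ht : t0 ≤ T) (hf : ContinuousOn f (rectBd b a t0 T))
    (hg : ContinuousOn g (rectBd b a t0 T)) :
    rectI (fun z => f z + g z) b a t0 T = rectI f b a t0 T + rectI g b a t0 T := by
  obtain ⟨f1, f2, f3, f4⟩ := rectBd_int hab ht hf
  obtain ⟨g1, g2, g3, g4⟩ := rectBd_int hab ht hg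
  unfold rectI
  rw [intervalIntegral.integral_add f1 g1, intervalIntegral.integral_add f2 g2,
    intervalIntegral.integral_add f3 g3, intervalIntegral.integral_add f4 g4]
  ring

lemma rectI_const_mul {f : ℂ → ℂ} (c : ℂ) :
    rectI (fun z => c * f z) b a t0 T = c * rectI f b a t0 T := by
  unfold rectI
  simp only [intervalIntegral.integral_const_mul]
  ring

lemma rectI_sum {ι : Type*} (S : Finset ι) {f : ι → ℂ → ℂ} (hab : b ≤ a) (ht : t0 ≤ T)
    (hf : ∀ i ∈ S, ContinuousOn (f i) (rectBd b a t0 T)) :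
    rectI (fun z => ∑ i ∈ S, f i z) b a t0 T = ∑ i ∈ S, rectI (f i) b a t0 T := by
  classical
  induction S using Finset.induction_on with
  | empty => simp [rectI]
  | insert i S hi ih =>
    simp only [Finset.sum_insert hi]
    rw [rectI_add hab ht (hf i (by simp)), ih (fun j hj => hf j (by simp [hj]))]
    exact continuousOn_finsetSum _ fun j hj => hf j (by simp [hj])

lemma rectI_congr {f g : ℂ → ℂ} (hab : b ≤ a) (ht : t0 ≤ T) (h : ∀ z ∈ rectBd b a t0 T, f z = g z) :
    rectI f b a t0 T = rectI g b a t0 T := by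
  unfold rectI
  congr 1
  · congr 1
    · congr 1 <;>
      · apply intervalIntegral.integral_congr
        intro x hx
        rw [Set.uIcc_of_le (by assumption)] at hx
        exact h _ (by simp [rectBd, hx.1, hx.2])
    · congr 1
      apply intervalIntegral.integral_congr
      intro x hx
      rw [Set.uIcc_of_le (by assumption)] at hx
      exact h _ (by simp [rectBd, hx.1, hx.2])
  · congr 1
    apply intervalIntegral.integral_congr
    intro x hx
    rw [Set.uIcc_of_le (by assumption)] at hx
    exact h _ (by simp [rectBd, hx.1, hx.2])

lemma rectI_zero {f : ℂ → ℂ} (hab : b ≤ a) (ht : t0 ≤ T)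
    (hf : DifferentiableOn ℂ f (Set.Icc b a ×ℂ Set.Icc t0 T)) : rectI f b a t0 T = 0 := by
  have := integral_boundary_rect_eq_zero_of_differentiableOn f (b + t0*I) (a + T*I) (by
    simpa [Set.uIcc_of_le hab, Set.uIcc_of_le ht] using hf)
  simpa [rectI] using this

lemma log_neg_pos {w : ℂ} (h : 0 < w.im) : Complex.log (-w) = Complex.log w - Real.pi * I := by
  rw [Complex.log, Complex.log, norm_neg, arg_neg_eq_arg_sub_pi_of_im_pos h]
  push_cast; ring

lemma log_neg_neg {w : ℂ} (h : w.im < 0) : Complex.log (-w) = Complex.log w + Real.pi * I := by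
  rw [Complex.log, Complex.log, norm_neg, arg_neg_eq_arg_add_pi_of_im_neg h]
  push_cast; ring

lemma rectI_inv {ρ : ℂ} (h1 : b < ρ.re) (h2 : ρ.re < a) (h3 : t0 < ρ.im) (h4 : ρ.im < T) :
    rectI (fun z => (z - ρ)⁻¹) b a t0 T = 2 * Real.pi * I := by
  have hab : b ≤ a := by linarith
  have ht : t0 ≤ T := by linarith
  have hcont : ContinuousOn (fun z => (z - ρ)⁻¹) (rectBd b a t0 T) := by
    apply ContinuousOn.inv₀ (by fun_prop)
    intro z hz h
    rw [sub_eq_zero] at h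
    subst h
    rcases hz with ⟨_, _, h | h⟩ | ⟨_, _, h | h⟩ <;> linarith
  obtain ⟨f1, f2, f3, f4⟩ := rectBd_int hab ht hcont
  have e1 : ∫ x in b..a, ((x + t0*I : ℂ) - ρ)⁻¹ = Complex.log (a + t0*I - ρ) - Complex.log (b + t0*I - ρ) := by
    apply intervalIntegral.integral_eq_sub_of_hasDerivAt (f := fun x : ℝ => Complex.log (x + t0*I - ρ))
    · intro x _
      have hd : HasDerivAt (fun x : ℝ => ((x:ℂ) + t0*I - ρ)) 1 x := by
        simpa using ((Complex.ofRealCLM.hasDerivAt (x := x)).add_const (t0*I)).sub_const ρ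
      have := hd.clog_real (by right; simp; linarith)
      simpa using this
    · exact f1
  have e2 : ∫ x in b..a, ((x + T*I : ℂ) - ρ)⁻¹ = Complex.log (a + T*I - ρ) - Complex.log (b + T*I - ρ) := by
    apply intervalIntegral.integral_eq_sub_of_hasDerivAt (f := fun x : ℝ => Complex.log (x + T*I - ρ))
    · intro x _
      have hd : HasDerivAt (fun x : ℝ => ((x:ℂ) + T*I - ρ)) 1 x := by
        simpa using ((Complex.ofRealCLM.hasDerivAt (x := x)).add_const (T*I)).sub_const ρ
      have := hd.clog_real (by right; simp; linarith)
      simpa using this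
    · exact f2
  have hd (c : ℝ) (y : ℝ) : HasDerivAt (fun y : ℝ => ((c:ℂ) + y*I - ρ)) I y := by
    simpa using (((Complex.ofRealCLM.hasDerivAt (x := y)).mul_const I).const_add (c:ℂ)).sub_const ρ
  have e3 : ∫ y in t0..T, I * ((a + y*I : ℂ) - ρ)⁻¹ = Complex.log (a + T*I - ρ) - Complex.log (a + t0*I - ρ) := by
    apply intervalIntegral.integral_eq_sub_of_hasDerivAt (f := fun y : ℝ => Complex.log (a + y*I - ρ))
    · intro y _
      have := (hd a y).clog_real (by left; simp; linarith)
      simpa [div_eq_mul_inv] using this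
    · exact f3.const_mul I
  have e4 : ∫ y in t0..T, I * ((b + y*I : ℂ) - ρ)⁻¹ = Complex.log (-(b + T*I - ρ)) - Complex.log (-(b + t0*I - ρ)) := by
    apply intervalIntegral.integral_eq_sub_of_hasDerivAt (f := fun y : ℝ => Complex.log (-(b + y*I - ρ)))
    · intro y _
      have := (hd b y).neg.clog_real (by left; simp; linarith)
      refine HasDerivAt.congr_deriv this ?_
      rw [Pi.neg_apply, neg_div_neg_eq, div_eq_mul_inv]
    · exact f4.const_mul I
  unfold rectI
  rw [← intervalIntegral.integral_const_mul, ← intervalIntegral.integral_const_mul, e1, e2, e3, e4,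
    log_neg_pos (by simp; linarith), log_neg_neg (by simp; linarith)]
  ring

lemma rectI_cauchy {F : ℂ → ℂ} {U : Set ℂ} (hU : IsOpen U) (hF : DifferentiableOn ℂ F U)
    (hUR : Set.Icc b a ×ℂ Set.Icc t0 T ⊆ U)
    {ρ : ℂ} (h1 : b < ρ.re) (h2 : ρ.re < a) (h3 : t0 < ρ.im) (h4 : ρ.im < T) :
    rectI (fun z => (z - ρ)⁻¹ * F z) b a t0 T = 2 * Real.pi * I * F ρ := by
  have hab : b ≤ a := by linarith
  have ht : t0 ≤ T := by linarith
  have hbd : ∀ z ∈ rectBd b a t0 T, z - ρ ≠ 0 := by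
    intro z hz h
    rw [sub_eq_zero] at h
    subst h
    rcases hz with ⟨_, _, h | h⟩ | ⟨_, _, h | h⟩ <;> linarith
  have hρU : ρ ∈ U := hUR ⟨⟨h1.le, h2.le⟩, ⟨h3.le, h4.le⟩⟩
  have hds : DifferentiableOn ℂ (dslope F ρ) U :=
    (Complex.differentiableOn_dslope (hU.mem_nhds hρU)).2 hF
  have hsub : rectBd b a t0 T ⊆ Set.Icc b a ×ℂ Set.Icc t0 T := by
    rintro z (⟨h1, h2, h | h⟩ | ⟨h1, h2, h | h⟩) <;>
    simp [Complex.mem_reProdIm, *]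
  rw [rectI_congr (g := fun z => dslope F ρ z + F ρ * (z - ρ)⁻¹) hab ht, rectI_add hab ht, rectI_const_mul,
    rectI_inv h1 h2 h3 h4, rectI_zero hab ht (hds.mono hUR)]
  · ring
  · exact (hds.mono hUR).continuousOn.mono hsub
  · exact continuousOn_const.mul ((by fun_prop : ContinuousOn (fun z => z - ρ) _).inv₀ hbd)
  · intro z hz
    have := hbd z hz
    rw [dslope_of_ne _ (sub_ne_zero.1 this), slope_def_field]
    field_simp
    ring

lemma uhp_open : IsOpen {z : ℂ | 0 < z.im} := isOpen_lt continuous_const Complex.continuous_im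

lemma zeta_diffOn : DifferentiableOn ℂ riemannZeta {z : ℂ | 0 < z.im} := by
  intro z hz
  apply (differentiableAt_riemannZeta _).differentiableWithinAt
  rintro rfl; simp at hz

lemma zeta_order_ne_top {z : ℂ} (hz : 0 < z.im) : analyticOrderAt riemannZeta z ≠ ⊤ := by
  intro h
  rw [analyticOrderAt_eq_top] at h
  have := (zeta_diffOn.analyticOnNhd uhp_open).eqOn_zero_of_preconnected_of_eventuallyEq_zero
    (convex_halfSpace_im_gt 0).isPreconnected hz h (show (2 + I : ℂ) ∈ _ by simp)
  exact riemannZeta_ne_zero_of_one_le_re (by simp) this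

lemma zetaZeroOrder_eq {z : ℂ} (hz : 0 < z.im) : zetaZeroOrder z = analyticOrderNatAt riemannZeta z := by
  have han : AnalyticAt ℂ riemannZeta z := zeta_diffOn.analyticAt (uhp_open.mem_nhds hz)
  have h : analyticOrderAt riemannZeta z = (analyticOrderNatAt riemannZeta z : ℕ) :=
    (Nat.cast_analyticOrderNatAt (zeta_order_ne_top hz)).symm
  rw [analyticOrderAt_eq_nat_iff_iteratedDeriv_eq_zero han] at h
  unfold zetaZeroOrder
  apply le_antisymm
  · exact Nat.sInf_le h.2
  · apply le_csInf ⟨_, h.2⟩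
    intro k hk
    by_contra hcon
    exact hk (h.1 k (not_le.1 hcon))

theorem arg_principle {F : ℂ → ℂ} (hF : DifferentiableOn ℂ F {z : ℂ | 0 < z.im}) (hab : b ≤ a) (ht0 : 0 < t0)
    (ht : t0 ≤ T) (hbd : ∀ z ∈ rectBd b a t0 T, riemannZeta z ≠ 0) (S : Finset ℂ)
    (hS : ∀ z, z ∈ S ↔ z ∈ Set.Icc b a ×ℂ Set.Icc t0 T ∧ riemannZeta z = 0) :
    rectI (fun z => deriv riemannZeta z / riemannZeta z * F z) b a t0 T =
      2 * Real.pi * I * ∑ ρ ∈ S, (zetaZeroOrder ρ : ℂ) * F ρ := by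
  have hsub : rectBd b a t0 T ⊆ Set.Icc b a ×ℂ Set.Icc t0 T := by
    rintro z (⟨h1, h2, h | h⟩ | ⟨h1, h2, h | h⟩) <;>
    simp [Complex.mem_reProdIm, *]
  have hUR : Set.Icc b a ×ℂ Set.Icc t0 T ⊆ {z : ℂ | 0 < z.im} := by
    intro z hz
    exact lt_of_lt_of_le ht0 hz.2.1
  obtain ⟨g, hg, hgS, hfg⟩ := factor uhp_open zeta_diffOn S (fun ρ hρ => hUR ((hS ρ).1 hρ).1)
    (fun ρ hρ => zeta_order_ne_top (hUR ((hS ρ).1 hρ).1))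
  have hg0 : ∀ z ∈ Set.Icc b a ×ℂ Set.Icc t0 T, g z ≠ 0 := by
    intro z hz h
    by_cases hzS : z ∈ S
    · exact hgS z hzS h
    · apply hzS
      rw [hS]
      exact ⟨hz, by rw [hfg, h, mul_zero]⟩
  have hSbd : ∀ z ∈ rectBd b a t0 T, z ∉ S := fun z hz h => hbd z hz ((hS z).1 h).2
  have hG : DifferentiableOn ℂ (fun z => deriv g z / g z * F z) (Set.Icc b a ×ℂ Set.Icc t0 T) :=
    (((hg.deriv uhp_open).mono hUR).div (hg.mono hUR) hg0).mul (hF.mono hUR)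
  have hc1 : ∀ ρ ∈ S, ContinuousOn (fun z => (zetaZeroOrder ρ : ℂ) * ((z - ρ)⁻¹ * F z)) (rectBd b a t0 T) := by
    intro ρ hρ
    refine continuousOn_const.mul (ContinuousOn.mul (ContinuousOn.inv₀ (by fun_prop) ?_)
      ((hF.mono hUR).continuousOn.mono hsub))
    intro z hz h
    rw [sub_eq_zero] at h
    exact hSbd z hz (h ▸ hρ)
  rw [rectI_congr (g := fun z => ∑ ρ ∈ S, (zetaZeroOrder ρ : ℂ) * ((z - ρ)⁻¹ * F z) + deriv g z / g z * F z) hab ht,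
    rectI_add hab ht (continuousOn_finsetSum _ hc1) (hG.continuousOn.mono hsub), rectI_sum S hab ht hc1,
    rectI_zero hab ht hG, add_zero, mul_sum]
  · refine sum_congr rfl fun ρ hρ => ?_
    have hρ' := (hS ρ).1 hρ
    obtain ⟨⟨⟨q1, q2⟩, q3, q4⟩, h0⟩ := hρ'
    have hnb : ρ ∉ rectBd b a t0 T := fun h => hbd ρ h h0
    simp only [rectBd, Set.mem_ofPred_eq, not_or, not_and] at hnb
    have n1 := hnb.1 q1 q2
    have n2 := hnb.2 q3 q4
    rw [rectI_const_mul, rectI_cauchy uhp_open hF hUR (lt_of_le_of_ne q1 (Ne.symm n2.2)) (lt_of_le_of_ne q2 n2.1)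
      (lt_of_le_of_ne q3 (Ne.symm n1.1)) (lt_of_le_of_ne q4 n1.2)]
    ring
  · intro z hz
    have hzR := hsub hz
    rw [logDeriv_factor hfg (hSbd z hz) (hg.differentiableAt (uhp_open.mem_nhds (hUR hzR))) (hg0 z hzR),
      add_mul, sum_mul]
    congr 1
    refine sum_congr rfl fun ρ hρ => ?_
    rw [zetaZeroOrder_eq (hUR ((hS ρ).1 hρ).1)]
    ring
end

lemma zeta_ne_of_re_nonpos {z : ℂ} (h1 : z.re ≤ 0) (h2 : 0 < z.im) : riemannZeta z ≠ 0 := by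
  have h := zeta_refl_ne (s := 1 - starRingEnd ℂ z) (by simp; linarith) (by simpa using h2)
    (riemannZeta_ne_zero_of_one_le_re (by simp; linarith))
  simpa using h

lemma exists_t0 : ∃ t0 : ℝ, 3 ≤ t0 ∧ t0 ≤ 4 ∧ ∀ z : ℂ, z.im = t0 → riemannZeta z ≠ 0 := by
  have hfin := ((isCompact_Icc (a := (-1:ℝ)) (b := 2)).reProdIm (isCompact_Icc (a := (3:ℝ)) (b := 4))).inter_riemannZetaZeros_finite
  have hfin2 := hfin.image Complex.im
  have : ((Set.Icc (3:ℝ) 4) \ (Complex.im '' ((Set.Icc (-1:ℝ) 2 ×ℂ Set.Icc (3:ℝ) 4) ∩ riemannZetaZeros))).Nonempty :=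
    ((Set.Icc_infinite (by norm_num : (3:ℝ) < 4)).sdiff hfin2).nonempty
  obtain ⟨t, ht, hn⟩ := this
  refine ⟨t, ht.1, ht.2, ?_⟩
  intro z hz h0
  apply hn
  refine ⟨z, ⟨⟨⟨?_, ?_⟩, by simpa [hz] using ht⟩, h0⟩, hz⟩
  · by_contra hc
    exact zeta_ne_of_re_nonpos (by linarith) (by rw [hz]; linarith [ht.1]) h0
  · by_contra hc
    exact riemannZeta_ne_zero_of_one_le_re (by linarith) h0

theorem zeroSum_eq (n : ℕ) : ∃ t0 : ℝ, 3 ≤ t0 ∧ t0 ≤ 4 ∧ ∃ K : ℂ, ∀ T : ℝ, t0 ≤ T →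
    (∀ σ : ℝ, -1/8 ≤ σ → σ ≤ 9/8 → riemannZeta (σ + T*I) ≠ 0) →
    2 * Real.pi * I * zetaZeroSum n T = K +
      rectI (fun z => deriv riemannZeta z / riemannZeta z * iteratedDeriv n riemannZeta z) (-1/8) (9/8) t0 T := by
  classical
  obtain ⟨t0, h3, h4, hz⟩ := exists_t0
  refine ⟨t0, h3, h4, 2 * Real.pi * I * zetaZeroSum n t0, ?_⟩
  intro T hT hTz
  have hfin := ((isCompact_Icc (a := (-1/8:ℝ)) (b := 9/8)).reProdIm (isCompact_Icc (a := t0) (b := T))).inter_riemannZetaZeros_finite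
  have hF : DifferentiableOn ℂ (iteratedDeriv n riemannZeta) {z : ℂ | 0 < z.im} := by
    induction n with
    | zero => simpa using zeta_diffOn
    | succ k ih => rw [iteratedDeriv_succ]; exact ih.deriv uhp_open
  rw [arg_principle hF (by norm_num) (by linarith) hT ?_ hfin.toFinset ?_]
  · have key : zetaZeroSum n T = zetaZeroSum n t0 + ∑ ρ ∈ hfin.toFinset, (zetaZeroOrder ρ : ℂ) * iteratedDeriv n riemannZeta ρ := by
      have hset : {ρ : ℂ | IsNontrivialZero ρ ∧ 0 < ρ.im ∧ ρ.im ≤ T} =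
          {ρ : ℂ | IsNontrivialZero ρ ∧ 0 < ρ.im ∧ ρ.im ≤ t0} ∪ (hfin.toFinset : Set ℂ) := by
        ext ρ
        simp only [Set.mem_ofPred_eq, Set.mem_union, Finset.mem_coe, Set.Finite.mem_toFinset, Set.mem_inter_iff,
          Complex.mem_reProdIm, mem_riemannZetaZeros, Set.mem_Icc]
        constructor
        · rintro ⟨hn, h1, h2⟩
          rcases le_or_gt ρ.im t0 with h | h
          · exact Or.inl ⟨hn, h1, h⟩
          · exact Or.inr ⟨⟨⟨by linarith [hn.2.1], by linarith [hn.2.2]⟩, h.le, h2⟩, hn.1⟩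
        · rintro (⟨hn, h1, h2⟩ | ⟨⟨⟨a1, a2⟩, a3, a4⟩, h0⟩)
          · exact ⟨hn, h1, by linarith⟩
          · refine ⟨⟨h0, ?_, ?_⟩, by linarith, a4⟩
            · by_contra hc
              exact zeta_ne_of_re_nonpos (not_lt.1 hc) (by linarith) h0
            · by_contra hc
              exact riemannZeta_ne_zero_of_one_le_re (not_lt.1 hc) h0
      unfold zetaZeroSum
      rw [hset, finsum_mem_union, finsum_mem_coe_finset]
      · rw [Set.disjoint_left]
        rintro ρ ⟨hn, h1, h2⟩ hρ
        simp only [Finset.mem_coe, Set.Finite.mem_toFinset, Set.mem_inter_iff,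
          Complex.mem_reProdIm, mem_riemannZetaZeros, Set.mem_Icc] at hρ
        exact hz ρ (le_antisymm h2 hρ.1.2.1) hn.1
      · refine Set.Finite.subset (((isCompact_Icc (a := (0:ℝ)) (b := 1)).reProdIm (isCompact_Icc (a := 0) (b := t0))).inter_riemannZetaZeros_finite) ?_
        rintro ρ ⟨hn, h1, h2⟩
        exact ⟨⟨⟨hn.2.1.le, hn.2.2.le⟩, h1.le, h2⟩, hn.1⟩
      · exact Finset.finite_toSet _
    rw [key]; ring
  · rintro z (⟨h1, h2, h | h⟩ | ⟨h1, h2, h | h⟩)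
    · exact hz z h
    · have := hTz z.re (by linarith) (by linarith)
      rw [← h, re_add_im] at this
      exact this
    · exact riemannZeta_ne_zero_of_one_le_re (by rw [h]; norm_num)
    · exact zeta_ne_of_re_nonpos (by rw [h]; norm_num) (by linarith)
  · intro z
    simp [mem_riemannZetaZeros]
end Shanks

namespace Shanks

/-- The phase. -/
noncomputable def ph (c t : ℝ) : ℝ := t * Real.log (t/c) - t

lemma ph_hasDeriv {c t : ℝ} (hc : 0 < c) (ht : 0 < t) : HasDerivAt (ph c) (Real.log (t/c)) t := by
  unfold ph
  have h1 : HasDerivAt (fun t : ℝ => Real.log (t/c)) (t⁻¹) t := by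
    have := ((hasDerivAt_id t).div_const c).log (by simp; constructor <;> linarith)
    refine HasDerivAt.congr_deriv this ?_
    simp; field_simp
  refine HasDerivAt.congr_deriv (((hasDerivAt_id t).mul h1).sub (hasDerivAt_id t)) ?_
  simp; field_simp; ring

lemma eph_hasDeriv {c t : ℝ} (hc : 0 < c) (ht : 0 < t) :
    HasDerivAt (fun t : ℝ => Complex.exp (I * ph c t)) (Complex.exp (I * ph c t) * (I * Real.log (t/c))) t :=
  (((ph_hasDeriv hc ht).ofReal_comp).const_mul I).cexp

lemma norm_eph (c t : ℝ) : ‖Complex.exp (I * ph c t)‖ = 1 := by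
  rw [mul_comm]; exact Complex.norm_exp_ofReal_mul_I _

lemma eph_cont {c α β : ℝ} (hc : 0 < c) (hα : 0 < α) :
    ContinuousOn (fun t : ℝ => Complex.exp (I * ph c t)) (Set.Icc α β) := fun t ht =>
  (eph_hasDeriv hc (by linarith [ht.1])).continuousAt.continuousWithinAt

lemma first_deriv {c α β κ : ℝ} (hc : 0 < c) (hα : 0 < α) (hαβ : α ≤ β) (hκ : 0 < κ)
    (h : ∀ t ∈ Set.Icc α β, κ ≤ |Real.log (t/c)|) :
    ‖∫ t in α..β, Complex.exp (I * ph c t)‖ ≤ 4/κ := by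
  have hne : ∀ t ∈ Set.Icc α β, Real.log (t/c) ≠ 0 := by
    intro t ht h0
    have := h t ht
    rw [h0] at this; simp at this; linarith
  have hlog : ∀ t ∈ Set.Icc α β, HasDerivAt (fun t : ℝ => Real.log (t/c)) (t⁻¹) t := by
    intro t ht
    have h0 : 0 < t := by linarith [ht.1]
    have := ((hasDerivAt_id t).div_const c).log (by simp; constructor <;> linarith)
    refine HasDerivAt.congr_deriv this ?_
    simp; field_simp
  have hlogc : ContinuousOn (fun t : ℝ => Real.log (t/c)) (Set.Icc α β) := fun t ht =>
    (hlog t ht).continuousAt.continuousWithinAt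
  have hr : ∀ t ∈ Set.Icc α β, HasDerivAt (fun t : ℝ => -(Real.log (t/c))⁻¹) (t⁻¹ * (Real.log (t/c)^2)⁻¹) t := by
    intro t ht
    refine HasDerivAt.congr_deriv ((hlog t ht).inv (hne t ht)).neg ?_
    field_simp
  have hd : ∀ t ∈ Set.Icc α β, HasDerivAt (fun t : ℝ => Complex.exp (I * ph c t) * (-I) * ((Real.log (t/c))⁻¹ : ℝ))
      (Complex.exp (I * ph c t) + Complex.exp (I * ph c t) * I * ((t⁻¹ * (Real.log (t/c)^2)⁻¹ : ℝ) : ℂ)) t := by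
    intro t ht
    have h0 : 0 < t := by linarith [ht.1]
    have h1 := ((eph_hasDeriv hc h0).mul_const (-I)).mul ((hlog t ht).inv (hne t ht)).ofReal_comp
    refine HasDerivAt.congr_deriv h1 ?_
    have hh : (Real.log (t/c) : ℂ) ≠ 0 := by exact_mod_cast hne t ht
    simp only [Pi.inv_apply]
    push_cast
    have ht' : (t : ℂ) ≠ 0 := by exact_mod_cast h0.ne'
    generalize Complex.exp (I * ph c t) = E
    generalize (Real.log (t/c) : ℂ) = l at hh
    have e1 : E * (I * l) * -I * l⁻¹ = E := by
      linear_combination (-E * l * l⁻¹) * I_sq + E * mul_inv_cancel₀ hh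
    rw [e1]
    ring
  have hu : Set.uIcc α β = Set.Icc α β := Set.uIcc_of_le hαβ
  have hri : IntervalIntegrable (fun t : ℝ => t⁻¹ * (Real.log (t/c)^2)⁻¹) MeasureTheory.volume α β := by
    apply ContinuousOn.intervalIntegrable
    rw [hu]
    apply ContinuousOn.mul
    · apply ContinuousOn.inv₀ continuousOn_id
      intro t ht; have := ht.1; simp; linarith
    · exact (hlogc.pow 2).inv₀ (fun t ht => pow_ne_zero _ (hne t ht))
  have hi1 : IntervalIntegrable (fun t : ℝ => Complex.exp (I * ph c t)) MeasureTheory.volume α β := by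
    apply ContinuousOn.intervalIntegrable
    rw [hu]; exact eph_cont hc hα
  have hi2 : IntervalIntegrable (fun t : ℝ => Complex.exp (I * ph c t) * I * ((t⁻¹ * (Real.log (t/c)^2)⁻¹ : ℝ) : ℂ))
      MeasureTheory.volume α β := by
    apply ContinuousOn.intervalIntegrable
    rw [hu]
    apply ((eph_cont hc hα).mul continuousOn_const).mul
    apply Complex.continuous_ofReal.comp_continuousOn
    apply ContinuousOn.mul
    · apply ContinuousOn.inv₀ continuousOn_id
      intro t ht; have := ht.1; simp; linarith
    · exact (hlogc.pow 2).inv₀ (fun t ht => pow_ne_zero _ (hne t ht))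
  have e1 := intervalIntegral.integral_eq_sub_of_hasDerivAt (fun t ht => hd t (hu ▸ ht)) (hi1.add hi2)
  rw [intervalIntegral.integral_add hi1 hi2] at e1
  have e2 := intervalIntegral.integral_eq_sub_of_hasDerivAt (fun t ht => hr t (hu ▸ ht)) hri
  have hb : ∀ t ∈ Set.Icc α β, |(Real.log (t/c))⁻¹| ≤ 1/κ := by
    intro t ht
    rw [abs_inv, ← one_div]
    exact one_div_le_one_div_of_le hκ (h t ht)
  have hA := hb α ⟨le_rfl, hαβ⟩
  have hB := hb β ⟨hαβ, le_rfl⟩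
  have b2 : ‖∫ t in α..β, Complex.exp (I * ph c t) * I * ((t⁻¹ * (Real.log (t/c)^2)⁻¹ : ℝ) : ℂ)‖ ≤ 2/κ := by
    refine (intervalIntegral.norm_integral_le_integral_norm hαβ).trans ?_
    have : ∫ t in α..β, ‖Complex.exp (I * ph c t) * I * ((t⁻¹ * (Real.log (t/c)^2)⁻¹ : ℝ) : ℂ)‖ =
        ∫ t in α..β, t⁻¹ * (Real.log (t/c)^2)⁻¹ := by
      apply intervalIntegral.integral_congr
      intro t ht
      rw [hu] at ht
      have h0 : 0 < t := by linarith [ht.1]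
      simp only [norm_mul, norm_eph, Complex.norm_I, Complex.norm_real, one_mul]
      rw [Real.norm_eq_abs, Real.norm_eq_abs, abs_of_pos (by positivity), abs_of_nonneg (by positivity)]
    rw [this, e2]
    have := abs_le.1 hA
    have := abs_le.1 hB
    have : 2/κ = 1/κ + 1/κ := by ring
    linarith
  have e3 : ∫ t in α..β, Complex.exp (I * ph c t) =
      (Complex.exp (I * ph c β) * (-I) * ((Real.log (β/c))⁻¹ : ℝ) - Complex.exp (I * ph c α) * (-I) * ((Real.log (α/c))⁻¹ : ℝ))
      - ∫ t in α..β, Complex.exp (I * ph c t) * I * ((t⁻¹ * (Real.log (t/c)^2)⁻¹ : ℝ) : ℂ) := by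
    rw [← e1]; ring
  rw [e3]
  refine (norm_sub_le _ _).trans ?_
  have b1 := norm_sub_le (Complex.exp (I * ph c β) * (-I) * ((Real.log (β/c))⁻¹ : ℝ)) (Complex.exp (I * ph c α) * (-I) * ((Real.log (α/c))⁻¹ : ℝ))
  have nn : ∀ t : ℝ, ‖Complex.exp (I * ph c t) * (-I) * ((Real.log (t/c))⁻¹ : ℝ)‖ = |(Real.log (t/c))⁻¹| := by
    intro t
    rw [norm_mul, norm_mul, norm_eph, norm_neg, Complex.norm_I, Complex.norm_real, Real.norm_eq_abs]; ring
  rw [nn, nn] at b1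
  have : 4/κ = 1/κ + 1/κ + 2/κ := by ring
  linarith

lemma second_deriv {c t0 u : ℝ} (hc : 0 < c) (ht0 : 1 ≤ t0) (hu : t0 ≤ u) :
    ‖∫ t in t0..u, Complex.exp (I * ph c t)‖ ≤ 14 * Real.sqrt u := by
  have hu1 : 1 ≤ u := ht0.trans hu
  have hs : 0 < Real.sqrt u := Real.sqrt_pos.2 (by linarith)
  have hss : Real.sqrt u * Real.sqrt u = u := Real.mul_self_sqrt (by linarith)
  have hs1 : 1 ≤ Real.sqrt u := by rw [Real.one_le_sqrt]; exact hu1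
  set α := max t0 (min u (c - Real.sqrt u)) with hα
  set β := max t0 (min u (c + Real.sqrt u)) with hβ
  have a1 : t0 ≤ α := le_max_left _ _
  have a2 : α ≤ u := max_le hu (min_le_left _ _)
  have b1 : t0 ≤ β := le_max_left _ _
  have b2 : β ≤ u := max_le hu (min_le_left _ _)
  have ab : α ≤ β := max_le_max le_rfl (min_le_min le_rfl (by linarith))
  have hlen : β - α ≤ 2 * Real.sqrt u := by
    rw [hα, hβ]
    rcases max_cases t0 (min u (c - Real.sqrt u)) with ⟨h1, h1'⟩ | ⟨h1, h1'⟩ <;>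
    rcases max_cases t0 (min u (c + Real.sqrt u)) with ⟨h2, h2'⟩ | ⟨h2, h2'⟩ <;>
    rcases min_cases u (c - Real.sqrt u) with ⟨h3, h3'⟩ | ⟨h3, h3'⟩ <;>
    rcases min_cases u (c + Real.sqrt u) with ⟨h4, h4'⟩ | ⟨h4, h4'⟩ <;>
    linarith
  have hIntg : ∀ p q : ℝ, t0 ≤ p → p ≤ q → IntervalIntegrable (fun t : ℝ => Complex.exp (I * ph c t)) MeasureTheory.volume p q := by
    intro p q hp hpq
    apply ContinuousOn.intervalIntegrable
    rw [Set.uIcc_of_le hpq]; exact eph_cont hc (by linarith)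
  have i1 : ‖∫ t in t0..α, Complex.exp (I * ph c t)‖ ≤ 8 * Real.sqrt u := by
    rcases eq_or_lt_of_le a1 with h | h
    · rw [← h]; simp
    · have hα2 : α ≤ c - Real.sqrt u := by
        rw [hα] at h ⊢
        rcases max_cases t0 (min u (c - Real.sqrt u)) with ⟨h1, h1'⟩ | ⟨h1, h1'⟩
        · rw [h1] at h; linarith
        · rw [h1]; exact min_le_right _ _
      have := first_deriv (κ := 1/(2*Real.sqrt u)) hc (by linarith) h.le (by positivity) (α := t0) (β := α) ?_
      · refine this.trans (le_of_eq ?_)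
        field_simp; norm_num
      · intro t ht
        have ht0 : 0 < t := by linarith [ht.1]
        rw [abs_of_nonpos (Real.log_nonpos (by positivity) ((div_le_one hc).2 (by linarith [ht.2]))), ← Real.log_inv, inv_div]
        refine le_trans ?_ (Real.one_sub_inv_le_log_of_pos (by positivity))
        rw [inv_div, div_le_iff₀ (by positivity)]
        rw [sub_mul, div_mul_eq_mul_div, one_mul, le_sub_iff_add_le, ← le_sub_iff_add_le', div_le_iff₀ hc]
        have h1 := ht.2
        have h2 := mul_nonneg (show 0 ≤ 2 * Real.sqrt u - 1 by linarith) (show 0 ≤ c - t - Real.sqrt u by linarith)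
        nlinarith
  have i2 : ‖∫ t in α..β, Complex.exp (I * ph c t)‖ ≤ 2 * Real.sqrt u := by
    have := intervalIntegral.norm_integral_le_of_norm_le_const (a := α) (b := β) (C := 1) (f := fun t : ℝ => Complex.exp (I * ph c t))
      (fun t _ => (norm_eph c t).le)
    rw [abs_of_nonneg (by linarith)] at this
    linarith
  have i3 : ‖∫ t in β..u, Complex.exp (I * ph c t)‖ ≤ 4 * Real.sqrt u := by
    rcases eq_or_lt_of_le b2 with h | h
    · rw [h]; simp
    · have hβ2 : c + Real.sqrt u ≤ β := by
        rw [hβ] at h ⊢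
        rcases min_cases u (c + Real.sqrt u) with ⟨h1, h1'⟩ | ⟨h1, h1'⟩
        · rw [h1, max_eq_right hu] at h; linarith
        · rw [h1]; exact le_max_right _ _
      have := first_deriv (κ := 1/(Real.sqrt u)) hc (by linarith) h.le (by positivity) (α := β) (β := u) ?_
      · refine this.trans (le_of_eq ?_)
        field_simp
      · intro t ht
        have ht0 : 0 < t := by linarith [ht.1]
        have hct : c ≤ t := by linarith [ht.1]
        rw [abs_of_nonneg (Real.log_nonneg ((one_le_div hc).2 hct))]
        refine le_trans ?_ (Real.one_sub_inv_le_log_of_pos (by positivity))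
        rw [inv_div, div_le_iff₀ (by positivity)]
        rw [sub_mul, div_mul_eq_mul_div, one_mul, le_sub_iff_add_le, ← le_sub_iff_add_le', div_le_iff₀ ht0]
        have h1 := ht.2
        have h1' := ht.1
        nlinarith
  have split : ∫ t in t0..u, Complex.exp (I * ph c t) = (∫ t in t0..α, Complex.exp (I * ph c t))
      + (∫ t in α..β, Complex.exp (I * ph c t)) + (∫ t in β..u, Complex.exp (I * ph c t)) := by
    rw [intervalIntegral.integral_add_adjacent_intervals (hIntg _ _ le_rfl a1) (hIntg _ _ a1 ab),
      intervalIntegral.integral_add_adjacent_intervals (hIntg _ _ le_rfl b1) (hIntg _ _ b1 b2)]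
  rw [split]
  refine (norm_add₃_le).trans ?_
  linarith
end Shanks

namespace Shanks

lemma eph_continuous {c : ℝ} (hc : 0 < c) : Continuous (fun t : ℝ => Complex.exp (I * ph c t)) := by
  have h : Continuous (ph c) := by
    have e : ph c = fun t => c * ((t/c) * Real.log (t/c)) - t := by
      funext t; unfold ph; field_simp
    rw [e]
    have := Real.continuous_mul_log.comp (continuous_id.div_const c)
    exact (continuous_const.mul this).sub continuous_id
  fun_prop

lemma line_hasDeriv (a t : ℝ) : HasDerivAt (fun t : ℝ => (a:ℂ) + t*I) I t := by
  simpa using ((Complex.ofRealCLM.hasDerivAt (x := t)).mul_const I).const_add (a:ℂ)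

lemma comp_line {f : ℂ → ℂ} {f' : ℂ} {a t : ℝ} (h : HasDerivAt f f' ((a:ℂ) + t*I)) :
    HasDerivAt (fun t : ℝ => f ((a:ℂ) + t*I)) (f' * I) t := by
  have := h.comp_of_eq t (line_hasDeriv a t) rfl
  exact this

lemma XX_osc : ∃ C > 0, ∀ t0 T y : ℝ, 3 ≤ t0 → t0 ≤ T → 0 < y →
    ‖∫ t in t0..T, XX ((9/8:ℝ) + t*I) * Complex.exp (-(I * (t * Real.log y : ℝ)))‖ ≤ C * T^(9/8:ℝ) := by
  refine ⟨126 * Real.exp 8 , by positivity, ?_⟩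
  intro t0 T y ht0 hT hy
  have hpi := Real.pi_pos
  have hcy : 0 < 2 * Real.pi * y := by positivity
  set A : ℝ → ℂ := fun t => XX ((9/8:ℝ) + t*I) * Complex.exp (-(I * ph (2*Real.pi) t)) with hA
  set e : ℝ → ℂ := fun t => Complex.exp (I * ph (2*Real.pi*y) t) with he
  have hec : Continuous e := eph_continuous hcy
  set v : ℝ → ℂ := fun u => ∫ t in t0..u, e t with hv
  have hvd : ∀ u, HasDerivAt v (e u) u := fun u =>
    intervalIntegral.integral_hasDerivAt_right (hec.intervalIntegrable _ _)
      (hec.stronglyMeasurableAtFilter _ _) hec.continuousAt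
  set A' : ℝ → ℂ := fun t => A t * (I * (qX ((9/8:ℝ) + t*I) - (Real.log (t/(2*Real.pi)) : ℝ))) with hA'
  have hre : ∀ t : ℝ, 0 < (((9/8:ℝ):ℂ) + t*I).re := by intro t; simp
  have him : ∀ t : ℝ, 0 < t → 0 < (((9/8:ℝ):ℂ) + t*I).im := by intro t; simp
  have hAd : ∀ t, 0 < t → HasDerivAt A (A' t) t := by
    intro t ht
    have h1 := comp_line (XX_hasDeriv (hre t) (him t ht))
    have h2 := ((((ph_hasDeriv (c := 2*Real.pi) (by positivity) ht).ofReal_comp).const_mul I).neg).cexp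
    refine HasDerivAt.congr_deriv (h1.mul h2) ?_
    simp only [hA', hA, Pi.neg_apply]
    ring
  have hu : Set.uIcc t0 T = Set.Icc t0 T := Set.uIcc_of_le hT
  have hlogc : ContinuousOn (fun t : ℝ => Real.log (t/(2*Real.pi))) (Set.Icc t0 T) := by
    apply ContinuousOn.log (by fun_prop)
    intro t ht
    have : 0 < t := by linarith [ht.1]
    positivity
  have hAc : ContinuousOn A (Set.Icc t0 T) := fun t ht =>
    (hAd t (by linarith [ht.1])).continuousAt.continuousWithinAt
  have hA'c : ContinuousOn A' (Set.Icc t0 T) := by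
    apply hAc.mul
    apply continuousOn_const.mul
    apply ContinuousOn.sub
    · intro t ht
      exact (comp_line (qX_hasDeriv (hre t) (him t (by linarith [ht.1])))).continuousAt.continuousWithinAt
    · exact Complex.continuous_ofReal.comp_continuousOn hlogc
  have e1 : ∫ t in t0..T, XX ((9/8:ℝ) + t*I) * Complex.exp (-(I * (t * Real.log y : ℝ))) = ∫ t in t0..T, A t * e t := by
    apply intervalIntegral.integral_congr
    intro t ht
    rw [hu] at ht
    have ht' : 0 < t := by linarith [ht.1]
    simp only [hA, he]
    rw [mul_assoc, ← Complex.exp_add]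
    congr 2
    unfold ph
    have : Real.log (t/(2*Real.pi*y)) = Real.log (t/(2*Real.pi)) - Real.log y := by
      rw [← div_div, Real.log_div (by positivity) (by positivity)]
    rw [this]
    push_cast
    ring
  rw [e1, intervalIntegral.integral_mul_deriv_eq_deriv_mul (u := A) (v := v) (u' := A') (v' := e)
    (fun t ht => hAd t (by rw [hu] at ht; linarith [ht.1])) (fun t _ => hvd t)
    (by apply ContinuousOn.intervalIntegrable; rwa [hu]) (hec.intervalIntegrable _ _)]
  have hv0 : v t0 = 0 := by simp [hv]
  have hvb : ∀ u, t0 ≤ u → ‖v u‖ ≤ 14 * u^(1/2:ℝ) := by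
    intro u hu
    rw [← Real.sqrt_eq_rpow]
    exact second_deriv hcy (by linarith) hu
  have hAb : ∀ t, t0 ≤ t → ‖A t‖ ≤ Real.exp 8 * t^(5/8:ℝ) := by
    intro t ht
    have h := XX_bd (σ := 9/8) (t := t) (by norm_num) (by norm_num) (by linarith)
    simp only [hA, norm_mul]
    have : ‖Complex.exp (-(I * ph (2*Real.pi) t))‖ = 1 := by
      rw [Complex.exp_neg, norm_inv, norm_eph, inv_one]
    rw [this, mul_one]
    norm_num at h ⊢
    exact h
  rw [hv0, mul_zero, sub_zero]
  refine (norm_sub_le _ _).trans ?_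
  have hT0 : 0 < T := by linarith
  have b1 : ‖A T * v T‖ ≤ 14 * Real.exp 8 * T^(9/8:ℝ) := by
    rw [norm_mul]
    refine (mul_le_mul (hAb T hT) (hvb T hT) (norm_nonneg _) (by positivity)).trans (le_of_eq ?_)
    have : T^(9/8:ℝ) = T^(5/8:ℝ) * T^(1/2:ℝ) := by rw [← Real.rpow_add hT0]; norm_num
    rw [this]; ring
  have b2 : ‖∫ t in t0..T, A' t * v t‖ ≤ 112 * Real.exp 8 * T^(1/8:ℝ) * |T - t0| := by
    apply intervalIntegral.norm_integral_le_of_norm_le_const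
    intro t ht
    rw [Set.uIoc_of_le hT] at ht
    have ht' : 0 < t := by linarith [ht.1]
    rw [norm_mul]
    simp only [hA', norm_mul, Complex.norm_I, one_mul]
    have hq := qX_bd (σ := 9/8) (t := t) (by norm_num) (by norm_num) (by linarith [ht.1])
    have := mul_le_mul (mul_le_mul (hAb t ht.1.le) hq (norm_nonneg _) (by positivity)) (hvb t ht.1.le) (norm_nonneg _) (by positivity)
    refine this.trans ?_
    have e2 : Real.exp 8 * t^(5/8:ℝ) * (8/t) * (14 * t^(1/2:ℝ)) = 112 * Real.exp 8 * t^(1/8:ℝ) := by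
      have : t^(1/8:ℝ) = t^(5/8:ℝ) * t^(1/2:ℝ) / t := by
        rw [← Real.rpow_add ht', ← Real.rpow_sub_one ht'.ne']; norm_num
      rw [this]; field_simp; norm_num
    rw [e2]
    gcongr
    exact ht.2
  have b3 : 112 * Real.exp 8 * T^(1/8:ℝ) * |T - t0| ≤ 112 * Real.exp 8 * T^(9/8:ℝ) := by
    have : T^(9/8:ℝ) = T^(1/8:ℝ) * T := by
      nth_rw 3 [← Real.rpow_one T]; rw [← Real.rpow_add hT0]; norm_num
    rw [this, abs_of_nonneg (by linarith), ← mul_assoc]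
    gcongr
    linarith
  linarith
end Shanks

namespace Shanks

lemma int_hasSum {F : ℕ → ℝ → ℂ} {f : ℝ → ℂ} {B : ℕ → ℝ} {a b : ℝ} (hab : a ≤ b)
    (hF : ∀ n, ContinuousOn (F n) (Set.Icc a b)) (hB : Summable B)
    (hFB : ∀ n, ∀ t ∈ Set.Icc a b, ‖F n t‖ ≤ B n)
    (hf : ∀ t ∈ Set.Icc a b, HasSum (fun n => F n t) (f t)) :
    HasSum (fun n => ∫ t in a..b, F n t) (∫ t in a..b, f t) := by
  apply intervalIntegral.hasSum_integral_of_dominated_convergence (fun n _ => B n)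
  · intro n
    rw [Set.uIoc_of_le hab]
    exact ((hF n).mono Set.Ioc_subset_Icc_self).aestronglyMeasurable measurableSet_Ioc
  · intro n
    refine Eventually.of_forall fun t ht => ?_
    rw [Set.uIoc_of_le hab] at ht
    exact hFB n t ⟨ht.1.le, ht.2⟩
  · exact Eventually.of_forall fun t _ => hB
  · simp
  · refine Eventually.of_forall fun t ht => ?_
    rw [Set.uIoc_of_le hab] at ht
    exact hf t ⟨ht.1.le, ht.2⟩

/-- The basic twisted integral on the left line. -/
noncomputable def I0 (d : ℕ) (t0 T : ℝ) : ℂ :=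
  ∫ t in t0..T, riemannZeta ((-1/8:ℝ) + t*I) * (d:ℂ)^(((-1/8:ℝ):ℂ) + t*I)

lemma natcpow (d : ℕ) (hd : 1 ≤ d) (σ t : ℝ) :
    (d:ℂ)^((σ:ℂ) + t*I) = ((d:ℝ)^σ : ℝ) * Complex.exp (I * (t * Real.log d : ℝ)) := by
  have hd' : (d:ℂ) ≠ 0 := by exact_mod_cast (by omega : d ≠ 0)
  rw [Complex.cpow_add _ _ hd', Complex.ofReal_cpow (by positivity)]
  congr 1
  rw [Complex.cpow_def_of_ne_zero hd', ← Complex.natCast_log]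
  congr 1
  push_cast; ring

lemma norm_eI (x : ℝ) : ‖Complex.exp (I * x)‖ = 1 := by
  rw [mul_comm]; exact Complex.norm_exp_ofReal_mul_I _

lemma norm_neI (x : ℝ) : ‖Complex.exp (-(I * x))‖ = 1 := by
  rw [Complex.exp_neg, norm_inv, norm_eI, inv_one]

lemma intervalIntegral_conj_norm {f : ℝ → ℂ} {a b : ℝ} :
    ‖∫ t in a..b, f t‖ = ‖∫ t in a..b, starRingEnd ℂ (f t)‖ := by
  have h : ∫ t in a..b, starRingEnd ℂ (f t) = starRingEnd ℂ (∫ t in a..b, f t) := by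
    simp only [intervalIntegral]
    rw [integral_conj, integral_conj, map_sub]
  rw [h, Complex.norm_conj]

lemma zeta_line_hasSum (t : ℝ) : HasSum (fun m : ℕ => (((m+1:ℕ):ℝ)^(-(9/8):ℝ) : ℝ) * Complex.exp (-(I * (t * Real.log (m+1:ℕ) : ℝ))))
    (riemannZeta ((9/8:ℝ) + t*I)) := by
  have hre : 1 < (((9/8:ℝ):ℂ) + t*I).re := by norm_num
  have h1 : Summable (fun m : ℕ => 1 / ((m:ℂ)+1)^(((9/8:ℝ):ℂ) + t*I)) := by
    have := (Complex.summable_one_div_nat_cpow (p := ((9/8:ℝ):ℂ) + t*I)).2 hre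
    have := (summable_nat_add_iff 1).2 this
    simpa using this
  have h2 := h1.hasSum
  rw [← zeta_eq_tsum_one_div_nat_add_one_cpow hre] at h2
  convert! h2 using 1
  funext m
  have : ((m:ℂ)+1) = ((m+1:ℕ):ℂ) := by push_cast; ring
  rw [this, natcpow (m+1) (by omega), Real.rpow_neg (by positivity), Complex.exp_neg]
  push_cast
  rw [one_div, mul_inv]

theorem I0_a : ∃ C > 0, ∀ t0 T : ℝ, 3 ≤ t0 → t0 ≤ T → ∀ d : ℕ, 1 ≤ d →
    ‖I0 d t0 T‖ ≤ C * T^(9/8:ℝ) * (d:ℝ)^(-1/8:ℝ) := by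
  obtain ⟨C, hC, hX⟩ := XX_osc
  have hsum : Summable (fun m : ℕ => ((m+1:ℕ):ℝ)^(-(9/8):ℝ)) :=
    (summable_nat_add_iff 1).2 (Real.summable_nat_rpow.2 (by norm_num))
  have hpos : 0 ≤ ∑' m : ℕ, ((m+1:ℕ):ℝ)^(-(9/8):ℝ) := tsum_nonneg fun m => by positivity
  refine ⟨C * (∑' m : ℕ, ((m+1:ℕ):ℝ)^(-(9/8):ℝ)) + 1, by positivity, ?_⟩
  intro t0 T ht0 hT d hd
  unfold I0
  rw [intervalIntegral_conj_norm]
  set F : ℕ → ℝ → ℂ := fun m t => (((d:ℝ)^(-1/8:ℝ) : ℝ) : ℂ) * (((m+1:ℕ):ℝ)^(-(9/8):ℝ) : ℝ) *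
    (XX ((9/8:ℝ) + t*I) * Complex.exp (-(I * (t * Real.log (d * (m+1:ℕ) : ℝ) : ℝ)))) with hF
  have hh := int_hasSum (F := F)
    (f := fun t : ℝ => starRingEnd ℂ (riemannZeta ((-1/8:ℝ) + t*I) * (d:ℂ)^(((-1/8:ℝ):ℂ) + t*I)))
    (B := fun m => ((d:ℝ)^(-1/8:ℝ)) * ((m+1:ℕ):ℝ)^(-(9/8):ℝ) * (Real.exp 8 * T^(5/8:ℝ))) hT ?_ ?_ ?_ ?_
  · rw [← hh.tsum_eq]
    have hb : ∀ m, ‖∫ t in t0..T, F m t‖ ≤ ((d:ℝ)^(-1/8:ℝ)) * ((m+1:ℕ):ℝ)^(-(9/8):ℝ) * (C * T^(9/8:ℝ)) := by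
      intro m
      simp only [hF]
      rw [intervalIntegral.integral_const_mul, norm_mul, norm_mul, Complex.norm_real, Complex.norm_real,
        Real.norm_of_nonneg (by positivity), Real.norm_of_nonneg (by positivity)]
      gcongr
      exact hX t0 T _ ht0 hT (by positivity)
    refine (tsum_of_norm_bounded ((hsum.hasSum.mul_left _).mul_right _) hb).trans ?_
    have : 0 ≤ T^(9/8:ℝ) * (d:ℝ)^(-1/8:ℝ) := by
      have : 0 ≤ T := by linarith
      positivity
    nlinarith
  · intro m
    apply continuousOn_const.mul
    apply ContinuousOn.mul
    · intro t ht
      exact (comp_line (XX_hasDeriv (by simp) (by simp; linarith [ht.1]))).continuousAt.continuousWithinAt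
    · fun_prop
  · exact (hsum.mul_left _).mul_right _
  · intro m t ht
    simp only [hF, norm_mul, norm_neI, mul_one, Complex.norm_real]
    rw [Real.norm_of_nonneg (by positivity), Real.norm_of_nonneg (by positivity)]
    gcongr
    have h := XX_bd (σ := 9/8) (t := t) (by norm_num) (by norm_num) (by linarith [ht.1])
    refine h.trans ?_
    norm_num
    gcongr
    · linarith [ht.1]
    · exact ht.2
  · intro t ht
    have ht0 : 0 < t := by linarith [ht.1]
    have h1 := (zeta_line_hasSum t).mul_left ((((d:ℝ)^(-1/8:ℝ) : ℝ) : ℂ) * XX ((9/8:ℝ) + t*I) * Complex.exp (-(I * (t * Real.log d : ℝ))))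
    convert! h1 using 1
    · funext m
      simp only [hF]
      have : Complex.exp (-(I * (t * Real.log (d * (m+1:ℕ) : ℝ) : ℝ))) = Complex.exp (-(I * (t * Real.log d : ℝ))) * Complex.exp (-(I * (t * Real.log (m+1:ℕ) : ℝ))) := by
        rw [← Complex.exp_add]
        congr 1
        rw [Real.log_mul (by positivity) (by positivity)]
        push_cast; ring
      rw [this]; ring
    · rw [map_mul, natcpow d hd, map_mul, Complex.conj_ofReal, ← Complex.exp_conj, map_mul, Complex.conj_I, Complex.conj_ofReal,
        ← riemannZeta_conj]
      have e : starRingEnd ℂ (((-1/8:ℝ):ℂ) + t*I) = 1 - (((9/8:ℝ):ℂ) + t*I) := by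
        rw [map_add, map_mul, Complex.conj_ofReal, Complex.conj_ofReal, Complex.conj_I]
        push_cast; ring
      rw [e, zeta_fe (by simp) (by intro h; have := congrArg Complex.im h; simp at this; linarith)]
      rw [neg_mul]; ring
end Shanks

namespace Shanks

lemma zline_hasSum {c : ℝ} (hc : 1 < c) (t : ℝ) : HasSum (fun m : ℕ => (((m+1:ℕ):ℝ)^(-c) : ℝ) * Complex.exp (-(I * (t * Real.log (m+1:ℕ) : ℝ))))
    (riemannZeta (c + t*I)) := by
  have hre : 1 < ((c:ℂ) + t*I).re := by simpa using hc
  have h1 : Summable (fun m : ℕ => 1 / ((m:ℂ)+1)^((c:ℂ) + t*I)) := by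
    have := (Complex.summable_one_div_nat_cpow (p := (c:ℂ) + t*I)).2 hre
    have := (summable_nat_add_iff 1).2 this
    simpa using this
  have h2 := h1.hasSum
  rw [← zeta_eq_tsum_one_div_nat_add_one_cpow hre] at h2
  convert! h2 using 1
  funext m
  have : ((m:ℂ)+1) = ((m+1:ℕ):ℂ) := by push_cast; ring
  rw [this, natcpow (m+1) (by omega), Real.rpow_neg (by positivity), Complex.exp_neg]
  push_cast
  rw [one_div, mul_inv]

/-- Sum of `k^(-c)`. -/
noncomputable def Zc (c : ℝ) : ℝ := ∑' m : ℕ, ((m+1:ℕ):ℝ)^(-c)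

lemma Zc_summable {c : ℝ} (hc : 1 < c) : Summable (fun m : ℕ => ((m+1:ℕ):ℝ)^(-c)) :=
  (summable_nat_add_iff 1).2 (Real.summable_nat_rpow.2 (by linarith))

lemma Zc_eq {c : ℝ} (hc : 1 < c) : ((Zc c : ℝ) : ℂ) = riemannZeta c := by
  have h1 := zline_hasSum hc 0
  have h2 := Complex.hasSum_ofReal.2 (Zc_summable hc).hasSum
  have : riemannZeta (c + (0:ℝ)*I) = riemannZeta c := by simp
  rw [this] at h1
  refine h2.unique ?_
  convert! h1 using 1
  funext m
  simp

lemma Zc_bd : ∀ᶠ T : ℝ in atTop, Zc (1 + 1/Real.log T) ≤ 2 * Real.log T := by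
  have h1 : Tendsto (fun T : ℝ => (1 + ((1/Real.log T : ℝ):ℂ))) atTop (nhdsWithin 1 {1}ᶜ) := by
    apply tendsto_nhdsWithin_of_tendsto_nhds_of_eventually_within
    · have : Tendsto (fun T : ℝ => 1/Real.log T) atTop (nhds 0) := by
        have := Real.tendsto_log_atTop.inv_tendsto_atTop
        simp only [one_div]; exact this
      have h2 := (Complex.continuous_ofReal.tendsto 0).comp this
      have := h2.const_add 1
      simpa using this
    · filter_upwards [eventually_gt_atTop 1] with T hT
      have := Real.log_pos hT
      simp; exact ⟨by linarith, by linarith, by linarith⟩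
  have h2 := (riemannZeta_residue_one.comp h1).norm
  have h3 := h2.eventually_le_const (u := 2) (by norm_num)
  filter_upwards [h3, eventually_gt_atTop 1] with T hT hT1
  have hL := Real.log_pos hT1
  have hc : 1 < 1 + 1/Real.log T := by have : 0 < 1/Real.log T := by positivity
                                       linarith
  have e := Zc_eq hc
  simp only [Function.comp] at hT
  have e2 : (1 + ((1/Real.log T : ℝ):ℂ)) = ((1 + 1/Real.log T : ℝ) : ℂ) := by push_cast; ring
  rw [e2, ← e, norm_mul, Complex.norm_real] at hT
  have e3 : ‖((1 + 1/Real.log T : ℝ) : ℂ) - 1‖ = 1/Real.log T := by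
    rw [← Complex.ofReal_one, ← Complex.ofReal_sub, Complex.norm_real, Real.norm_of_nonneg] <;> simp
    linarith
  rw [e3, one_div, inv_mul_le_iff₀ hL] at hT
  have := le_abs_self (Zc (1 + 1/Real.log T))
  rw [Real.norm_eq_abs] at hT
  rw [one_div] at this ⊢
  linarith

lemma int_exp_bd {θ t0 T : ℝ} (hθ : θ ≠ 0) :
    ‖∫ t in t0..T, Complex.exp (I * (t * θ : ℝ))‖ ≤ 2/|θ| := by
  have hne : I * (θ:ℂ) ≠ 0 := by simp [hθ]
  have : ∫ t in t0..T, Complex.exp (I * (t * θ : ℝ)) = ∫ t in t0..T, Complex.exp ((I * θ) * t) := by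
    congr 1; funext t; congr 1; push_cast; ring
  rw [this, integral_exp_mul_complex hne, norm_div]
  have n1 : ∀ t : ℝ, ‖Complex.exp ((I * θ) * t)‖ = 1 := by
    intro t
    have : (I * θ) * t = I * ((θ * t : ℝ):ℂ) := by push_cast; ring
    rw [this, norm_eI]
  have n2 : ‖I * (θ:ℂ)‖ = |θ| := by simp
  rw [n2]
  gcongr
  refine (norm_sub_le _ _).trans ?_
  rw [n1, n1]; norm_num

/-- Vertical integral on the line `c`. -/
lemma vert_bd {T t0 L : ℝ} (hT : 10 ≤ T) (hL : L = Real.log T) (ht0 : t0 ≤ T) (hZ : Zc (1+1/L) ≤ 2 * L)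
    (d : ℕ) (hd : 1 ≤ d) (hdT : (d:ℝ) ≤ T) :
    ‖(∫ t in t0..T, riemannZeta ((1+1/L:ℝ) + t*I) * (d:ℂ)^(((1+1/L:ℝ):ℂ) + t*I)) - (T - t0 : ℝ)‖ ≤ 60 * L * d := by
  have hL1 : 1 ≤ L := by
    rw [hL, Real.le_log_iff_exp_le (by linarith)]
    linarith [Real.exp_one_lt_d9]
  have hd0 : (0:ℝ) < d := by exact_mod_cast hd
  set c : ℝ := 1 + 1/L with hc
  have hc1 : 1 < c := by have : 0 < 1/L := by positivity
                         linarith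
  have hpow : ∀ x : ℝ, 0 < x → x ≤ T → x^(1/L) ≤ 3 := by
    intro x hx hxT
    have : x^(1/L) ≤ T^(1/L) := Real.rpow_le_rpow hx.le hxT (by positivity)
    refine this.trans ?_
    rw [Real.rpow_def_of_pos (by linarith), ← hL, mul_one_div, div_self (by linarith)]
    linarith [Real.exp_one_lt_d9]
  set F : ℕ → ℝ → ℂ := fun m t => (((d:ℝ)^c * ((m+1:ℕ):ℝ)^(-c) : ℝ) : ℂ) *
    Complex.exp (I * (t * (Real.log d - Real.log (m+1:ℕ)) : ℝ)) with hF
  have hh := int_hasSum (F := F)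
    (f := fun t : ℝ => riemannZeta (c + t*I) * (d:ℂ)^((c:ℂ) + t*I))
    (B := fun m => (d:ℝ)^c * ((m+1:ℕ):ℝ)^(-c)) ht0 ?_ ?_ ?_ ?_
  rotate_left
  · intro m
    apply Continuous.continuousOn
    simp only [hF]; fun_prop
  · exact (Zc_summable hc1).mul_left _
  · intro m t _
    simp only [hF, norm_mul, norm_eI, mul_one, Complex.norm_real]
    rw [Real.norm_of_nonneg (by positivity), Real.norm_of_nonneg (by positivity)]
  · intro t _
    have h1 := (zline_hasSum hc1 t).mul_right ((d:ℂ)^((c:ℂ) + t*I))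
    convert! h1 using 1
    funext m
    simp only [hF]
    rw [natcpow d hd]
    have : Complex.exp (I * (t * (Real.log d - Real.log (m+1:ℕ)) : ℝ)) = Complex.exp (I * (t * Real.log d : ℝ)) * Complex.exp (-(I * (t * Real.log (m+1:ℕ) : ℝ))) := by
      rw [← Complex.exp_add]
      congr 1
      push_cast; ring
    rw [this]; push_cast; ring
  -- term bounds
  have hbig : ∀ m : ℕ, ‖∫ t in t0..T, F (m + d) t‖ ≤ 6 * d * ((m+1:ℕ):ℝ)^(-c) := by
    intro m
    simp only [hF]
    set k : ℕ := m + d + 1 with hk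
    have hk0 : (0:ℝ) < k := by positivity
    have hkd : (k:ℝ) - d = (m+1:ℕ) := by rw [hk]; push_cast; ring
    have hlog : ((m+1:ℕ):ℝ)/k ≤ Real.log k - Real.log d := by
      rw [← Real.log_div hk0.ne' hd0.ne']
      refine le_trans (le_of_eq ?_) (Real.one_sub_inv_le_log_of_pos (by positivity))
      rw [inv_div, ← hkd]; field_simp
    have hm0 : (0:ℝ) < (m+1:ℕ) := by positivity
    have hpos : 0 < Real.log k - Real.log d := lt_of_lt_of_le (by positivity) hlog
    rw [intervalIntegral.integral_const_mul, norm_mul, Complex.norm_real, Real.norm_of_nonneg (by positivity)]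
    have h1 := int_exp_bd (θ := Real.log d - Real.log k) (t0 := t0) (T := T) (by linarith)
    rw [abs_sub_comm, abs_of_pos hpos] at h1
    have h2 : 2/(Real.log k - Real.log d) ≤ 2 * (k/(m+1:ℕ)) := by
      rw [div_le_iff₀ hpos]
      have := mul_le_mul_of_nonneg_left hlog (show 0 ≤ 2 * ((k:ℝ)/(m+1:ℕ)) by positivity)
      refine le_trans (le_of_eq ?_) this
      field_simp
    refine (mul_le_mul_of_nonneg_left (h1.trans h2) (by positivity)).trans ?_
    have e1 : (d:ℝ)^c ≤ 3 * d := by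
      rw [hc, Real.rpow_add hd0, Real.rpow_one]
      nlinarith [hpow d hd0 hdT]
    have e2 : (k:ℝ)^(-c) * k ≤ ((m+1:ℕ):ℝ)^(-c) * (m+1:ℕ) := by
      rw [← Real.rpow_add_one hk0.ne', ← Real.rpow_add_one hm0.ne']
      apply Real.rpow_le_rpow_of_nonpos hm0 (by linarith) (by linarith)
    calc (d:ℝ)^c * (k:ℝ)^(-c) * (2 * (k/(m+1:ℕ))) = 2 * (d:ℝ)^c * ((k:ℝ)^(-c) * k) / (m+1:ℕ) := by ring
      _ ≤ 2 * (3 * d) * (((m+1:ℕ):ℝ)^(-c) * (m+1:ℕ)) / (m+1:ℕ) := by gcongr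
      _ = 6 * d * ((m+1:ℕ):ℝ)^(-c) := by field_simp; ring
  have hsmall : ∀ m : ℕ, m + 1 < d → ‖∫ t in t0..T, F m t‖ ≤ 6 * d * (1/((m:ℝ)+1) + 1/((d:ℝ)-1-m)) := by
    intro m hm
    simp only [hF]
    set k : ℕ := m + 1 with hk
    have hk0 : (0:ℝ) < k := by positivity
    have hkd : (0:ℝ) < d - k := by
      have : (k:ℝ) < d := by exact_mod_cast hm
      linarith
    have hlog : ((d:ℝ)-k)/d ≤ Real.log d - Real.log k := by
      rw [← Real.log_div hd0.ne' hk0.ne']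
      refine le_trans (le_of_eq ?_) (Real.one_sub_inv_le_log_of_pos (by positivity))
      rw [inv_div]; field_simp
    have hpos : 0 < Real.log d - Real.log k := lt_of_lt_of_le (by positivity) hlog
    rw [intervalIntegral.integral_const_mul, norm_mul, Complex.norm_real, Real.norm_of_nonneg (by positivity)]
    have h1 := int_exp_bd (θ := Real.log d - Real.log k) (t0 := t0) (T := T) (by linarith)
    rw [abs_of_pos hpos] at h1
    have h2 : 2/(Real.log d - Real.log k) ≤ 2 * (d/(d-k)) := by
      rw [div_le_iff₀ hpos]
      have := mul_le_mul_of_nonneg_left hlog (show 0 ≤ 2 * ((d:ℝ)/(d-k)) by positivity)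
      refine le_trans (le_of_eq ?_) this
      field_simp
    refine (mul_le_mul_of_nonneg_left (h1.trans h2) (by positivity)).trans ?_
    have e1 : (d:ℝ)^c * (k:ℝ)^(-c) ≤ 3 * (d/k) := by
      rw [Real.rpow_neg hk0.le, ← div_eq_mul_inv, ← Real.div_rpow hd0.le hk0.le, hc, Real.rpow_add (by positivity), Real.rpow_one, mul_comm]
      have h1k : (1:ℝ) ≤ k := by rw [hk]; push_cast; linarith [show (0:ℝ) ≤ m by positivity]
      have : (d:ℝ)/k ≤ T := (div_le_self hd0.le h1k).trans hdT
      gcongr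
      exact hpow _ (by positivity) this
    have e3 : (m:ℝ) + 1 = k := by rw [hk]; push_cast; ring
    have e4 : (d:ℝ) - 1 - m = d - k := by rw [← e3]; ring
    rw [e3, e4]
    calc (d:ℝ)^c * (k:ℝ)^(-c) * (2 * (d/(d-k))) ≤ 3 * (d/k) * (2 * (d/(d-k))) := by gcongr
      _ = 6 * d * (1/k + 1/(d-k)) := by
        have := hkd.ne'
        field_simp
        ring
  have hdiag : ∀ m : ℕ, m + 1 = d → ∫ t in t0..T, F m t = (T - t0 : ℝ) := by
    intro m hm
    simp only [hF, hm, sub_self, mul_zero]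
    rw [← Real.rpow_add hd0]
    simp
  obtain ⟨e, rfl⟩ : ∃ e, d = e + 1 := ⟨d - 1, by omega⟩
  have hrest := (hasSum_nat_add_iff' (e+1)).2 hh
  have hrb := tsum_of_norm_bounded ((Zc_summable hc1).hasSum.mul_left (6 * ((e+1:ℕ):ℝ))) hbig
  rw [hrest.tsum_eq, sum_range_succ, hdiag e rfl] at hrb
  have hfin : ‖∑ m ∈ range e, ∫ t in t0..T, F m t‖ ≤ 12 * ((e+1:ℕ):ℝ) * (1 + L) := by
    refine (norm_sum_le _ _).trans ?_
    have : ∑ m ∈ range e, ‖∫ t in t0..T, F m t‖ ≤ ∑ m ∈ range e, 6 * ((e+1:ℕ):ℝ) * (1/((m:ℝ)+1) + 1/(((e+1:ℕ):ℝ)-1-m)) := by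
      apply sum_le_sum
      intro m hm
      exact hsmall m (by rw [mem_range] at hm; omega)
    refine this.trans ?_
    rw [← mul_sum, sum_add_distrib]
    have r : ∑ m ∈ range e, 1/(((e+1:ℕ):ℝ)-1-m) = ∑ m ∈ range e, 1/((m:ℝ)+1) := by
      rw [← sum_range_reflect]
      apply sum_congr rfl
      intro m hm
      rw [mem_range] at hm
      congr 1
      have : ((e - 1 - m : ℕ):ℝ) = e - 1 - m := by
        rw [Nat.cast_sub (by omega), Nat.cast_sub (by omega)]; simp
      rw [this]; push_cast; ring
    have hH : ∑ m ∈ range e, 1/((m:ℝ)+1) ≤ 1 + L := by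
      have h := harmonic_le_one_add_log e
      have h2 : ((harmonic e : ℚ) : ℝ) = ∑ m ∈ range e, 1/((m:ℝ)+1) := by
        simp [harmonic]
      rw [h2] at h
      refine h.trans ?_
      rw [hL]
      rcases Nat.eq_zero_or_pos e with h0 | h0
      · rw [h0]; simp; exact Real.log_nonneg (by linarith)
      · gcongr
        push_cast at hdT; linarith
    rw [r]
    have : (0:ℝ) < ((e+1:ℕ):ℝ) := hd0
    nlinarith
  set V := ∫ t in t0..T, riemannZeta (c + t*I) * ((e+1:ℕ):ℂ)^((c:ℂ) + t*I) with hV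
  have e9 : V - (T - t0 : ℝ) = (V - (∑ m ∈ range e, (∫ t in t0..T, F m t) + (T - t0 : ℝ))) + ∑ m ∈ range e, ∫ t in t0..T, F m t := by ring
  rw [e9]
  refine (norm_add_le _ _).trans ?_
  have hZ' : (∑' m : ℕ, ((m+1:ℕ):ℝ)^(-c)) ≤ 2 * L := hZ
  have h6 : (6 * ((e+1:ℕ):ℝ)) * (∑' m : ℕ, ((m+1:ℕ):ℝ)^(-c)) ≤ 6 * ((e+1:ℕ):ℝ) * (2 * L) := by gcongr
  nlinarith
end Shanks

namespace Shanks

lemma top_bd : ∃ C > 0, ∀ T σ : ℝ, 10 ≤ T → ∀ d : ℕ, 1 ≤ d → (d:ℝ) ≤ T → -1/8 ≤ σ → σ ≤ 1 + 1/Real.log T →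
    ‖riemannZeta (σ + T*I)‖ * (d:ℝ)^σ ≤ C * Real.log T * (T^(5/8:ℝ) + T^(1/2:ℝ)*(d:ℝ)^(1/2:ℝ) + d) := by
  obtain ⟨C1, hC1, h1⟩ := zeta_bd1
  obtain ⟨C2, hC2, h2⟩ := zeta_left
  refine ⟨3*C1 + C2, by positivity, ?_⟩
  intro T σ hT d hd hdT hσ1 hσ2
  have hT0 : 0 < T := by linarith
  have hL1 : 1 ≤ Real.log T := by
    rw [Real.le_log_iff_exp_le (by linarith)]
    linarith [Real.exp_one_lt_d9]
  have hd1 : (1:ℝ) ≤ d := by exact_mod_cast hd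
  have hd0 : (0:ℝ) < d := by linarith
  have hinv : 1/Real.log T ≤ 1 := by rw [div_le_one (by linarith)]; exact hL1
  have hr0 : 0 < (d:ℝ)/T := by positivity
  have hr1 : (d:ℝ)/T ≤ 1 := (div_le_one hT0).2 hdT
  have A0 : 0 ≤ T^(5/8:ℝ) := by positivity
  have B0 : 0 ≤ T^(1/2:ℝ)*(d:ℝ)^(1/2:ℝ) := by positivity
  rcases le_or_gt (1/2) σ with h | h
  · have hb := h1 σ T (by linarith) (by linarith) (by linarith)
    refine (mul_le_mul_of_nonneg_right hb (by positivity)).trans ?_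
    have e1 : T^(1-σ) * (d:ℝ)^σ ≤ T^(1/2:ℝ)*(d:ℝ)^(1/2:ℝ) := by
      have a1 : T^(1-σ) * (d:ℝ)^σ = T * (d/T)^σ := by
        rw [Real.div_rpow hd0.le hT0.le, Real.rpow_sub hT0, Real.rpow_one]; ring
      have a2 : T^(1/2:ℝ) * (d:ℝ)^(1/2:ℝ) = T * (d/T)^(1/2:ℝ) := by
        have : T = T^(1/2:ℝ) * T^(1/2:ℝ) := by rw [← Real.rpow_add hT0]; norm_num
        rw [Real.div_rpow hd0.le hT0.le]
        nth_rw 2 [this]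
        field_simp
      rw [a1, a2]
      exact mul_le_mul_of_nonneg_left (Real.rpow_le_rpow_of_exponent_ge hr0 hr1 h) hT0.le
    have e2 : (d:ℝ)^σ ≤ 3 * d := by
      calc (d:ℝ)^σ ≤ (d:ℝ)^(1 + 1/Real.log T) := Real.rpow_le_rpow_of_exponent_le hd1 hσ2
        _ = d * (d:ℝ)^(1/Real.log T) := by rw [Real.rpow_add hd0, Real.rpow_one]
        _ ≤ d * 3 := by
          gcongr
          have : (d:ℝ)^(1/Real.log T) ≤ T^(1/Real.log T) := Real.rpow_le_rpow hd0.le hdT (by positivity)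
          refine this.trans ?_
          rw [Real.rpow_def_of_pos (by linarith), mul_one_div, div_self (by linarith)]
          linarith [Real.exp_one_lt_d9]
        _ = 3 * d := by ring
    have e3 : (T^(1-σ) + 1) * (d:ℝ)^σ ≤ 3 * (T^(5/8:ℝ) + T^(1/2:ℝ)*(d:ℝ)^(1/2:ℝ) + d) := by nlinarith
    calc C1 * (T^(1-σ) + 1) * Real.log T * (d:ℝ)^σ = C1 * Real.log T * ((T^(1-σ) + 1) * (d:ℝ)^σ) := by ring
      _ ≤ C1 * Real.log T * (3 * (T^(5/8:ℝ) + T^(1/2:ℝ)*(d:ℝ)^(1/2:ℝ) + d)) := by gcongr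
      _ ≤ (3*C1+C2) * Real.log T * (T^(5/8:ℝ) + T^(1/2:ℝ)*(d:ℝ)^(1/2:ℝ) + d) := by
        have : 0 ≤ C2 * Real.log T * (T^(5/8:ℝ) + T^(1/2:ℝ)*(d:ℝ)^(1/2:ℝ) + d) := by positivity
        nlinarith
  · have hb := h2 σ T (by linarith) (by linarith) (by linarith)
    refine (mul_le_mul_of_nonneg_right hb (by positivity)).trans ?_
    have e1 : T^(1/2:ℝ) * (d:ℝ)^σ ≤ T^(1/2:ℝ)*(d:ℝ)^(1/2:ℝ) := by
      gcongr 
    have e2 : T^(1/2-σ) * (d:ℝ)^σ ≤ T^(5/8:ℝ) := by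
      have a1 : T^(1/2-σ) * (d:ℝ)^σ = T^(1/2:ℝ) * (d/T)^σ := by
        rw [Real.div_rpow hd0.le hT0.le, Real.rpow_sub hT0]; ring
      have a2 : T^(5/8:ℝ) = T^(1/2:ℝ) * T^(1/8:ℝ) := by rw [← Real.rpow_add hT0]; norm_num
      rw [a1, a2]
      gcongr
      calc ((d:ℝ)/T)^σ ≤ ((d:ℝ)/T)^(-1/8:ℝ) := Real.rpow_le_rpow_of_exponent_ge hr0 hr1 hσ1
        _ = (T/d)^(1/8:ℝ) := by
          rw [show (-1/8:ℝ) = -(1/8) by norm_num, Real.rpow_neg hr0.le, ← Real.inv_rpow hr0.le, inv_div]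
        _ ≤ T^(1/8:ℝ) := by
          gcongr
          exact div_le_self hT0.le hd1
    calc C2 * (T^(1/2:ℝ) + T^(1/2-σ)) * Real.log T * (d:ℝ)^σ = C2 * Real.log T * (T^(1/2:ℝ) * (d:ℝ)^σ + T^(1/2-σ) * (d:ℝ)^σ) := by ring
      _ ≤ C2 * Real.log T * (T^(5/8:ℝ) + T^(1/2:ℝ)*(d:ℝ)^(1/2:ℝ) + d) := by
        gcongr C2 * Real.log T * ?_; linarith
      _ ≤ (3*C1+C2) * Real.log T * (T^(5/8:ℝ) + T^(1/2:ℝ)*(d:ℝ)^(1/2:ℝ) + d) := by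
        have : 0 ≤ 3 * C1 * Real.log T * (T^(5/8:ℝ) + T^(1/2:ℝ)*(d:ℝ)^(1/2:ℝ) + d) := by positivity
        nlinarith

theorem I0_b : ∃ C > 0, ∃ T1 ≥ 10, ∀ t0 T : ℝ, 3 ≤ t0 → t0 ≤ 4 → T1 ≤ T → ∀ d : ℕ, 1 ≤ d → (d:ℝ) ≤ T →
    ‖I0 d t0 T - (T - t0 : ℝ)‖ ≤ C * Real.log T * (T^(5/8:ℝ) + T^(1/2:ℝ)*(d:ℝ)^(1/2:ℝ) + d) := by
  obtain ⟨C, hC, htop⟩ := top_bd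
  obtain ⟨C3, hC3, hst⟩ := zeta_strip
  obtain ⟨T1, hT1⟩ := eventually_atTop.1 Zc_bd
  refine ⟨3 * C + 36 * C3 + 60, by positivity, max 10 T1, le_max_left _ _, ?_⟩
  intro t0 T h3 h4 hTT d hd hdT
  have hT : 10 ≤ T := (le_max_left _ _).trans hTT
  have hZ := hT1 T ((le_max_right _ _).trans hTT)
  have hT0 : 0 < T := by linarith
  have hL1 : 1 ≤ Real.log T := by
    rw [Real.le_log_iff_exp_le (by linarith)]
    linarith [Real.exp_one_lt_d9]
  have hd1 : (1:ℝ) ≤ d := by exact_mod_cast hd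
  have hd0 : (0:ℝ) < d := by linarith
  have hinv : 1/Real.log T ≤ 1 := by rw [div_le_one (by linarith)]; exact hL1
  have hinv0 : 0 < 1/Real.log T := by positivity
  have hdc : (d:ℂ) ≠ 0 := by exact_mod_cast (by omega : d ≠ 0)
  have hV := vert_bd hT rfl (by linarith : t0 ≤ T) hZ d hd hdT
  set L := Real.log T with hL
  set Q := T^(5/8:ℝ) + T^(1/2:ℝ)*(d:ℝ)^(1/2:ℝ) + d with hQ
  have hdQ : (d:ℝ) ≤ Q := by
    have A0 : 0 ≤ T^(5/8:ℝ) := by positivity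
    have B0 : 0 ≤ T^(1/2:ℝ)*(d:ℝ)^(1/2:ℝ) := by positivity
    linarith
  have hQ0 : 0 < Q := by linarith
  have hz := rectI_zero (f := fun s => riemannZeta s * (d:ℂ)^s) (b := -1/8) (a := 1+1/L) (t0 := t0) (T := T)
    (by linarith) (by linarith) (by
      intro s hs
      have him : t0 ≤ s.im := hs.2.1
      apply DifferentiableAt.differentiableWithinAt
      apply (differentiableAt_riemannZeta (by rintro rfl; simp at him; linarith)).mul
      exact (differentiableAt_id).const_cpow (Or.inl hdc))
  unfold rectI at hz
  have nrm : ∀ σ t : ℝ, ‖riemannZeta (σ + t*I) * (d:ℂ)^((σ:ℂ) + t*I)‖ = ‖riemannZeta (σ + t*I)‖ * (d:ℝ)^σ := by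
    intro σ t
    rw [norm_mul, natcpow d hd, norm_mul, norm_eI, mul_one, Complex.norm_real, Real.norm_of_nonneg (by positivity)]
  have hlen : |1 + 1/L - -1/8| ≤ 3 := by rw [abs_of_nonneg] <;> linarith
  have b1 : ‖∫ σ in (-1/8:ℝ)..(1+1/L), riemannZeta (σ + t0*I) * (d:ℂ)^((σ:ℂ) + t0*I)‖ ≤ (C3 * 4 * (3*d)) * |1 + 1/L - -1/8| := by
    apply intervalIntegral.norm_integral_le_of_norm_le_const
    intro σ hσ
    rw [Set.uIoc_of_le (by linarith)] at hσ
    rw [nrm]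
    have hb := hst σ t0 (by linarith [hσ.1]) (by linarith [hσ.2]) (by linarith)
    have h44 : t0^(7/8:ℝ) ≤ 4 := by
      calc t0^(7/8:ℝ) ≤ t0^(1:ℝ) := Real.rpow_le_rpow_of_exponent_le (by linarith) (by norm_num)
        _ = t0 := Real.rpow_one _
        _ ≤ 4 := h4
    have e2 : (d:ℝ)^σ ≤ 3 * d := by
      calc (d:ℝ)^σ ≤ (d:ℝ)^(1 + 1/L) := Real.rpow_le_rpow_of_exponent_le hd1 hσ.2
        _ = d * (d:ℝ)^(1/L) := by rw [Real.rpow_add hd0, Real.rpow_one]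
        _ ≤ d * 3 := by
          gcongr
          have : (d:ℝ)^(1/L) ≤ T^(1/L) := Real.rpow_le_rpow hd0.le hdT (by positivity)
          refine this.trans ?_
          rw [Real.rpow_def_of_pos (by linarith), mul_one_div, div_self (by linarith)]
          linarith [Real.exp_one_lt_d9]
        _ = 3 * d := by ring
    refine mul_le_mul (hb.trans ?_) e2 (by positivity) (by positivity)
    gcongr
  have b2 : ‖∫ σ in (-1/8:ℝ)..(1+1/L), riemannZeta (σ + T*I) * (d:ℂ)^((σ:ℂ) + T*I)‖ ≤ (C * L * Q) * |1 + 1/L - -1/8| := by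
    apply intervalIntegral.norm_integral_le_of_norm_le_const
    intro σ hσ
    rw [Set.uIoc_of_le (by linarith)] at hσ
    rw [nrm]
    exact htop T σ hT d hd hdT (by linarith [hσ.1]) hσ.2
  set W1 := ∫ σ in (-1/8:ℝ)..(1+1/L), riemannZeta (σ + t0*I) * (d:ℂ)^((σ:ℂ) + t0*I)
  set W2 := ∫ σ in (-1/8:ℝ)..(1+1/L), riemannZeta (σ + T*I) * (d:ℂ)^((σ:ℂ) + T*I)
  set V := ∫ t in t0..T, riemannZeta ((1+1/L:ℝ) + t*I) * (d:ℂ)^(((1+1/L:ℝ):ℂ) + t*I)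
  have hI : W1 - W2 + I * V - I * I0 d t0 T = 0 := hz
  have e : I0 d t0 T - (T - t0 : ℝ) = (V - (T - t0 : ℝ)) - I * W1 + I * W2 := by
    linear_combination I * hI + (V - I0 d t0 T) * (-I_sq)
  rw [e]
  have n1 := norm_add_le ((V - (T - t0 : ℝ)) - I * W1) (I * W2)
  have n2 := norm_sub_le (V - (T - t0 : ℝ)) (I * W1)
  rw [norm_mul, Complex.norm_I, one_mul] at n1 n2
  have b1' : ‖W1‖ ≤ 36 * C3 * L * Q := by
    refine b1.trans ?_
    calc (C3 * 4 * (3*d)) * |1 + 1/L - -1/8| ≤ (C3 * 4 * (3*d)) * 3 := by gcongr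
      _ = 36 * C3 * 1 * d := by ring
      _ ≤ 36 * C3 * L * Q := by gcongr
  have b2' : ‖W2‖ ≤ 3 * C * L * Q := by
    refine b2.trans ?_
    calc (C * L * Q) * |1 + 1/L - -1/8| ≤ (C * L * Q) * 3 := by gcongr
      _ = _ := by ring
  have b3 : 60 * L * d ≤ 60 * L * Q := by gcongr
  calc _ ≤ 60 * L * Q + 36 * C3 * L * Q + 3 * C * L * Q := by linarith
    _ = _ := by ring
end Shanks

namespace Shanks

-- Arithmetic sums

open ArithmeticFunction in
lemma lam_nonneg (d : ℕ) : 0 ≤ vonMangoldt d := vonMangoldt_nonneg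

/-- Mertens sum. -/
noncomputable def Mer (N : ℕ) : ℝ := ∑ d ∈ Ioc 0 N, ArithmeticFunction.vonMangoldt d / d

/-- Chebyshev sum. -/
noncomputable def Psi (N : ℕ) : ℝ := ∑ d ∈ Ioc 0 N, ArithmeticFunction.vonMangoldt d

lemma Psi_le (N : ℕ) : Psi N ≤ 6 * N := by
  have h := Chebyshev.psi_le_const_mul_self (x := (N:ℝ)) (by positivity)
  have h2 : Chebyshev.psi N = Psi N := by simp [Chebyshev.psi, Psi]
  rw [h2] at h
  have : Real.log 4 ≤ 2 := by
    have : Real.log 4 = 2 * Real.log 2 := by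
      rw [show (4:ℝ) = 2^2 by norm_num, Real.log_pow]; norm_num
    have := Real.log_two_lt_d9
    linarith
  have : (0:ℝ) ≤ N := by positivity
  nlinarith

lemma Psi_nonneg (N : ℕ) : 0 ≤ Psi N := Finset.sum_nonneg fun d _ => lam_nonneg d

lemma sum_log_le (N : ℕ) : ∑ d ∈ Ioc 0 N, Real.log d ≤ N * Real.log N := by
  calc ∑ d ∈ Ioc 0 N, Real.log d ≤ ∑ d ∈ Ioc 0 N, Real.log N := by
        refine Finset.sum_le_sum fun d hd => ?_
        have := Finset.mem_Ioc.mp hd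
        exact Real.log_le_log (by exact_mod_cast this.1) (by exact_mod_cast this.2)
    _ = _ := by simp

lemma sum_log_ge (N : ℕ) : N * Real.log N - N ≤ ∑ d ∈ Ioc 0 N, Real.log d := by
  induction N with
  | zero => simp
  | succ N ih =>
    rw [Finset.sum_Ioc_succ_top (Nat.zero_le _)]
    rcases Nat.eq_zero_or_pos N with h | h
    · subst h; simp
    · have hN : (0:ℝ) < N := by exact_mod_cast h
      have h1 : Real.log ((N+1)/N) ≤ 1/N := by
        have := Real.log_le_sub_one_of_pos (x := ((N:ℝ)+1)/N) (by positivity)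
        refine this.trans (le_of_eq ?_)
        field_simp; ring
      rw [Real.log_div (by positivity) (by positivity)] at h1
      have h2 : (N:ℝ) * (Real.log (N+1) - Real.log N) ≤ 1 := by
        calc (N:ℝ) * (Real.log (N+1) - Real.log N) ≤ N * (1/N) := by gcongr
          _ = 1 := by field_simp
      push_cast
      nlinarith

lemma sum_log_eq (N : ℕ) : ∑ d ∈ Ioc 0 N, Real.log d =
    ∑ d ∈ Ioc 0 N, ArithmeticFunction.vonMangoldt d * ((N / d : ℕ) : ℝ) := by
  have h := ArithmeticFunction.sum_Ioc_mul_zeta_eq_sum ArithmeticFunction.vonMangoldt N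
  rw [← h, ArithmeticFunction.vonMangoldt_mul_zeta]
  simp

lemma Mer_bd (N : ℕ) (hN : 1 ≤ N) : |Mer N - Real.log N| ≤ 6 := by
  have hN0 : (0:ℝ) < N := by exact_mod_cast hN
  have h1 : ∑ d ∈ Ioc 0 N, Real.log d ≤ N * Mer N := by
    rw [sum_log_eq, Mer, Finset.mul_sum]
    refine Finset.sum_le_sum fun d hd => ?_
    have : ((N / d : ℕ) : ℝ) ≤ N / d := Nat.cast_div_le
    calc _ ≤ ArithmeticFunction.vonMangoldt d * ((N:ℝ)/d) :=
          mul_le_mul_of_nonneg_left this (lam_nonneg d)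
      _ = _ := by ring
  have h2 : N * Mer N - Psi N ≤ ∑ d ∈ Ioc 0 N, Real.log d := by
    rw [sum_log_eq, Mer, Psi, Finset.mul_sum, ← Finset.sum_sub_distrib]
    refine Finset.sum_le_sum fun d hd => ?_
    have h0 := (Finset.mem_Ioc.mp hd).1
    have : (N:ℝ) / d - 1 ≤ ((N / d : ℕ) : ℝ) := by
      have := Nat.lt_floor_add_one ((N:ℝ)/d)
      rw [Nat.floor_div_eq_div] at this
      linarith
    calc _ = ArithmeticFunction.vonMangoldt d * ((N:ℝ)/d - 1) := by ring
      _ ≤ _ := mul_le_mul_of_nonneg_left this (lam_nonneg d)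
  have h3 := Psi_le N
  have h4 := sum_log_le N
  have h5 := sum_log_ge N
  rw [abs_le]
  constructor
  · by_contra hc
    push Not at hc
    have : N * (Mer N - Real.log N) < N * (-6) := by gcongr
    nlinarith
  · by_contra hc
    push Not at hc
    have : (N:ℝ) * 6 < N * (Mer N - Real.log N) := by gcongr
    nlinarith

lemma pow_diff_le (u v : ℝ) (hu : 0 ≤ u) (huv : u ≤ v) (n : ℕ) :
    v^(n+1) - u^(n+1) ≤ (n+1) * (v-u) * v^n := by
  induction n with
  | zero => simp
  | succ n ih =>
    have h1 : u^(n+1) ≤ v^(n+1) := by gcongr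
    have h2 : v^(n+2) - u^(n+2) = v * (v^(n+1)-u^(n+1)) + u^(n+1) * (v-u) := by ring
    have h3 : v * (v^(n+1)-u^(n+1)) ≤ v * ((n+1) * (v-u) * v^n) :=
      mul_le_mul_of_nonneg_left ih (hu.trans huv)
    have h4 : u^(n+1) * (v-u) ≤ v^(n+1) * (v-u) := mul_le_mul_of_nonneg_right h1 (by linarith)
    rw [h2]; push_cast
    calc _ ≤ v * ((n+1) * (v-u) * v^n) + v^(n+1) * (v-u) := by linarith
      _ = _ := by ring

lemma pow_diff_ge (u v : ℝ) (hu : 0 ≤ u) (huv : u ≤ v) (n : ℕ) :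
    (n+1) * (v-u) * u^n ≤ v^(n+1) - u^(n+1) := by
  induction n with
  | zero => simp
  | succ n ih =>
    have h1 : u^(n+1) ≤ v^(n+1) := by gcongr
    have h2 : v^(n+2) - u^(n+2) = u * (v^(n+1)-u^(n+1)) + v^(n+1) * (v-u) := by ring
    have h3 : u * ((n+1) * (v-u) * u^n) ≤ u * (v^(n+1)-u^(n+1)) :=
      mul_le_mul_of_nonneg_left ih hu
    have h4 : u^(n+1) * (v-u) ≤ v^(n+1) * (v-u) := mul_le_mul_of_nonneg_right h1 (by linarith)
    rw [h2]; push_cast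
    calc _ = u * ((n+1) * (v-u) * u^n) + u^(n+1) * (v-u) := by ring
      _ ≤ _ := by linarith

/-- weighted Mertens sum -/
noncomputable def Wer (n N : ℕ) : ℝ :=
  ∑ d ∈ Ioc 0 N, ArithmeticFunction.vonMangoldt d / d * Real.log d ^ n

lemma Wer_aux (n : ℕ) (hn : 1 ≤ n) (N : ℕ) (hN : 1 ≤ N) :
    |Wer n N - Real.log N ^ (n+1) / (n+1) - (Mer N - Real.log N) * Real.log N ^ n|
      ≤ 7 * Real.log N ^ n := by
  induction N, hN using Nat.le_induction with
  | base => simp [Wer, Mer, show n ≠ 0 by omega]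
  | succ N hN ih =>
    have hN0 : (1:ℝ) ≤ N := by exact_mod_cast hN
    set u := Real.log N with hu
    set v := Real.log ((N+1:ℕ):ℝ) with hv
    have hu0 : 0 ≤ u := Real.log_nonneg hN0
    have huv : u ≤ v := Real.log_le_log (by linarith) (by push_cast; linarith)
    have hd : v - u ≤ 1 := by
      rw [hu, hv, ← Real.log_div (by positivity) (by positivity)]
      refine (Real.log_le_sub_one_of_pos (by positivity)).trans ?_
      rw [div_sub_one (by positivity), div_le_one (by positivity)]
      push_cast; linarith
    have hE := Mer_bd N hN
    have hM : Mer (N+1) = Mer N + ArithmeticFunction.vonMangoldt (N+1) / ((N+1:ℕ):ℝ) := by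
      rw [Mer, Finset.sum_Ioc_succ_top (Nat.zero_le _)]; rfl
    have hW : Wer n (N+1) = Wer n N + (Mer (N+1) - Mer N) * v^n := by
      rw [Wer, Finset.sum_Ioc_succ_top (Nat.zero_le _), hM]
      simp only [Wer]; ring
    have hp1 := pow_diff_le u v hu0 huv n
    have hp2 := pow_diff_ge u v hu0 huv n
    have hpow : u^n ≤ v^n := by gcongr
    have hn0 : (0:ℝ) < n + 1 := by positivity
    set B := (v-u)*v^n - (v^(n+1)-u^(n+1))/(n+1) with hB
    have hB0 : 0 ≤ B := by
      rw [hB, sub_nonneg, div_le_iff₀ hn0]; linarith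
    have hB1 : B ≤ v^n - u^n := by
      have : (v-u)*u^n ≤ (v^(n+1)-u^(n+1))/(n+1) := by
        rw [le_div_iff₀ hn0]; linarith
      have : (v-u)*(v^n-u^n) ≤ 1*(v^n-u^n) := by gcongr
      rw [hB]; linarith
    have key : Wer n (N+1) - v ^ (n+1) / (n+1) - (Mer (N+1) - v) * v ^ n
        = (Wer n N - u ^ (n+1) / (n+1) - (Mer N - u) * u ^ n) + (B - (Mer N - u) * (v^n-u^n)) := by
      rw [hW, hB]; ring
    rw [key]
    have h2 : |(Mer N - u) * (v^n-u^n)| ≤ 6 * (v^n-u^n) := by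
      rw [abs_mul, abs_of_nonneg (by linarith : 0 ≤ v^n-u^n)]
      gcongr
    refine (abs_add_le _ _).trans ?_
    have h3 : |B - (Mer N - u) * (v^n-u^n)| ≤ 7*(v^n-u^n) := by
      refine (abs_sub _ _).trans ?_
      rw [abs_of_nonneg hB0]; linarith
    linarith

lemma Wer_bd (n : ℕ) (hn : 1 ≤ n) (N : ℕ) (hN : 1 ≤ N) :
    |Wer n N - Real.log N ^ (n+1) / (n+1)| ≤ 13 * Real.log N ^ n := by
  have h := Wer_aux n hn N hN
  have hE := Mer_bd N hN
  have hu : 0 ≤ Real.log N ^ n := pow_nonneg (Real.log_nonneg (by exact_mod_cast hN)) n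
  have h2 : |(Mer N - Real.log N) * Real.log N ^ n| ≤ 6 * Real.log N ^ n := by
    rw [abs_mul, abs_of_nonneg hu]; gcongr
  have := abs_add_le (Wer n N - Real.log N ^ (n+1) / (n+1) - (Mer N - Real.log N) * Real.log N ^ n)
    ((Mer N - Real.log N) * Real.log N ^ n)
  rw [sub_add_cancel] at this
  linarith

lemma rpow_tel (h : ℝ) (h0 : 0 < h) (x : ℝ) (hx : 0 < x) :
    h * (x+1)^(-1-h) ≤ x^(-h) - (x+1)^(-h) := by
  have hb : 1 + h * (1/(x+1)) ≤ ((x+1)/x)^h := by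
    have e1 : Real.log ((x+1)/x) ≥ 1/(x+1) := by
      have := Real.one_sub_inv_le_log_of_pos (x := (x+1)/x) (by positivity)
      refine le_trans (le_of_eq ?_) this
      field_simp; ring
    rw [Real.rpow_def_of_pos (by positivity)]
    have := Real.add_one_le_exp (Real.log ((x+1)/x) * h)
    nlinarith
  have e2 : x^(-h) = ((x+1)/x)^h * (x+1)^(-h) := by
    rw [Real.div_rpow (by positivity) hx.le, Real.rpow_neg hx.le, Real.rpow_neg (by positivity : (0:ℝ) ≤ x+1)]
    have : (x+1)^h ≠ 0 := by positivity
    field_simp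
  have e3 : (x+1)^(-1-h) = (1/(x+1)) * (x+1)^(-h) := by
    rw [Real.rpow_sub (by positivity), Real.rpow_neg (by positivity) h, Real.rpow_neg_one]
    ring
  rw [e2, e3]
  have : 0 < (x+1)^(-h) := by positivity
  nlinarith

/-- tail bound -/
lemma lam_tail (h : ℝ) (h0 : 0 < h) (M : ℕ) (hM : 1 ≤ M) (N : ℕ) (hN : M ≤ N) :
    ∑ d ∈ Ioc M N, ArithmeticFunction.vonMangoldt d * (d:ℝ)^(-1-h) ≤
      Psi N * (N:ℝ)^(-1-h) + 6*(1+1/h) * ((M:ℝ)^(-h) - (N:ℝ)^(-h)) := by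
  induction N, hN using Nat.le_induction with
  | base => 
    simp only [Finset.Ioc_self, Finset.sum_empty, sub_self, mul_zero, add_zero]
    have := Psi_nonneg M
    positivity
  | succ N hN ih =>
    have hN0 : (0:ℝ) < N := by exact_mod_cast (by omega : 0 < N)
    rw [Finset.sum_Ioc_succ_top hN]
    have hP : Psi (N+1) = Psi N + ArithmeticFunction.vonMangoldt (N+1) := by
      rw [Psi, Finset.sum_Ioc_succ_top (Nat.zero_le _)]; rfl
    rw [hP]
    push_cast
    have ht := rpow_tel h h0 N hN0
    have e1 : (N:ℝ) * (N:ℝ)^(-1-h) = (N:ℝ)^(-h) := by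
      conv_lhs => rw [← Real.rpow_one_add' hN0.le (by linarith)]
      congr 1; ring
    have e2 : ((N:ℝ)+1) * ((N:ℝ)+1)^(-1-h) = ((N:ℝ)+1)^(-h) := by
      conv_lhs => rw [← Real.rpow_one_add' (by positivity) (by linarith)]
      congr 1; ring
    have hmono : ((N:ℝ)+1)^(-1-h) ≤ (N:ℝ)^(-1-h) :=
      Real.rpow_le_rpow_of_nonpos hN0 (by linarith) (by linarith)
    have h3 : Psi N * ((N:ℝ)^(-1-h) - ((N:ℝ)+1)^(-1-h)) ≤
        6 * N * ((N:ℝ)^(-1-h) - ((N:ℝ)+1)^(-1-h)) :=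
      mul_le_mul_of_nonneg_right (Psi_le N) (by linarith)
    have h4 : ((N:ℝ)+1)^(-1-h) ≤ 1/h * ((N:ℝ)^(-h) - ((N:ℝ)+1)^(-h)) := by
      rw [div_mul_eq_mul_div, le_div_iff₀ h0]; linarith
    nlinarith

lemma lam_tail2 (h : ℝ) (h0 : 0 < h) (M : ℕ) (hM : 1 ≤ M) (N : ℕ) (hN : M ≤ N) :
    ∑ d ∈ Ioc M N, ArithmeticFunction.vonMangoldt d * (d:ℝ)^(-1-h) ≤
      6*(1+1/h) * (M:ℝ)^(-h) := by
  have h1 := lam_tail h h0 M hM N hN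
  have hN0 : (0:ℝ) < N := by exact_mod_cast (by omega : 0 < N)
  have e1 : (N:ℝ) * (N:ℝ)^(-1-h) = (N:ℝ)^(-h) := by
    conv_lhs => rw [← Real.rpow_one_add' hN0.le (by linarith)]
    congr 1; ring
  have h2 : Psi N * (N:ℝ)^(-1-h) ≤ 6 * N * (N:ℝ)^(-1-h) :=
    mul_le_mul_of_nonneg_right (Psi_le N) (by positivity)
  have h3 : 0 ≤ 1/h * (N:ℝ)^(-h) := by positivity
  nlinarith

/-- tail with log powers -/
lemma lam_tail3 (n : ℕ) : ∃ M0 : ℕ, 2 ≤ M0 ∧ ∀ M N : ℕ, M0 ≤ M → M ≤ N →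
    ∑ d ∈ Ioc M N, ArithmeticFunction.vonMangoldt d * (d:ℝ)^(-9/8:ℝ) * Real.log d ^ n ≤
      102 * (M:ℝ)^(-1/8:ℝ) * Real.log M ^ n := by
  obtain ⟨M0, hM0⟩ := exists_nat_ge (Real.exp (16*(n+1)))
  refine ⟨M0 + 2, by omega, fun M N hM hN => ?_⟩
  have hMe : Real.exp (16*(n+1)) ≤ M := hM0.trans (by exact_mod_cast (by omega : M0 ≤ M))
  have hM1 : (1:ℝ) ≤ M := by exact_mod_cast (by omega : 1 ≤ M)
  set a : ℝ := 1/(16*(n+1)) with ha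
  have ha0 : 0 < a := by positivity
  have hanti := Real.log_div_self_rpow_antitoneOn ha0
  have hainv : a⁻¹ = 16*(n+1) := by rw [ha]; simp
  have hna : a * n ≤ 1/16 := by
    rw [ha, div_mul_eq_mul_div, div_le_iff₀ (by positivity)]; linarith
  have key : ∀ d ∈ Ioc M N, ArithmeticFunction.vonMangoldt d * (d:ℝ)^(-9/8:ℝ) * Real.log d ^ n ≤
      (ArithmeticFunction.vonMangoldt d * (d:ℝ)^(-1-1/16:ℝ)) *
        ((M:ℝ)^(-1/16:ℝ) * Real.log M ^ n) := by
    intro d hd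
    have hd' := Finset.mem_Ioc.mp hd
    have hMd : (M:ℝ) ≤ d := by exact_mod_cast hd'.1.le
    have hd0 : (0:ℝ) < d := by linarith
    have hMp : (0:ℝ) < M := by linarith
    have h1 := hanti (a := (M:ℝ)) (b := (d:ℝ)) (by rw [Set.mem_Ici, hainv]; exact hMe)
      (by rw [Set.mem_Ici, hainv]; exact hMe.trans hMd) hMd
    simp only at h1
    have h2 : (Real.log d / (d:ℝ)^a)^n ≤ (Real.log M / (M:ℝ)^a)^n :=
      pow_le_pow_left₀ (div_nonneg (Real.log_nonneg (by linarith)) (by positivity)) h1 n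
    rw [div_pow, div_pow, ← Real.rpow_natCast ((d:ℝ)^a), ← Real.rpow_natCast ((M:ℝ)^a),
      ← Real.rpow_mul hd0.le, ← Real.rpow_mul hMp.le] at h2
    have h3 : (d:ℝ)^(-1/16+a*n) ≤ (M:ℝ)^(-1/16+a*n) :=
      Real.rpow_le_rpow_of_nonpos hMp hMd (by linarith)
    have hlM : 0 ≤ Real.log M := Real.log_nonneg hM1
    have hld : 0 ≤ Real.log d := Real.log_nonneg (by linarith)
    have h4 : (d:ℝ)^(-1/16:ℝ) * Real.log d ^ n ≤ (M:ℝ)^(-1/16:ℝ) * Real.log M ^ n := by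
      have := mul_le_mul h3 h2 (by positivity) (by positivity)
      rw [Real.rpow_add hd0, Real.rpow_add hMp] at this
      have p1 : (d:ℝ)^(a*n) ≠ 0 := by positivity
      have p2 : (M:ℝ)^(a*n) ≠ 0 := by positivity
      calc _ = (d:ℝ)^(-1/16:ℝ) * (d:ℝ)^(a*n) * (Real.log d ^ n / (d:ℝ)^(a*n)) := by field_simp
        _ ≤ _ := this
        _ = _ := by field_simp
    have e1 : (d:ℝ)^(-9/8:ℝ) = (d:ℝ)^(-1-1/16:ℝ) * (d:ℝ)^(-1/16:ℝ) := by
      rw [← Real.rpow_add hd0]; norm_num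
    rw [e1]
    calc _ = (ArithmeticFunction.vonMangoldt d * (d:ℝ)^(-1-1/16:ℝ)) *
          ((d:ℝ)^(-1/16:ℝ) * Real.log d ^ n) := by ring
      _ ≤ _ := mul_le_mul_of_nonneg_left h4 (mul_nonneg (lam_nonneg d) (by positivity))
  refine (Finset.sum_le_sum key).trans ?_
  rw [← Finset.sum_mul]
  have ht := lam_tail2 (1/16) (by norm_num) M (by omega) N hN
  have hlM : 0 ≤ Real.log M := Real.log_nonneg hM1
  refine (mul_le_mul_of_nonneg_right ht (by positivity)).trans (le_of_eq ?_)
  have e1 : (M:ℝ)^(-1/8:ℝ) = (M:ℝ)^(-(1/16):ℝ) * (M:ℝ)^(-1/16:ℝ) := by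
    rw [← Real.rpow_add (by linarith)]; norm_num
  rw [e1]; norm_num; ring

end Shanks

namespace Shanks

-- The left edge

lemma zetaD_diffOn (k : ℕ) : DifferentiableOn ℂ (iteratedDeriv k riemannZeta) {z : ℂ | 0 < z.im} := by
  induction k with
  | zero => simpa using zeta_diffOn
  | succ k ih => rw [iteratedDeriv_succ]; exact ih.deriv uhp_open

lemma zetaD_hasDeriv (k : ℕ) {s : ℂ} (hs : 0 < s.im) :
    HasDerivAt (iteratedDeriv k riemannZeta) (iteratedDeriv (k+1) riemannZeta s) s := by
  rw [iteratedDeriv_succ]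
  exact ((zetaD_diffOn k).differentiableAt (uhp_open.mem_nhds hs)).hasDerivAt

lemma zetaD_line (k : ℕ) (σ : ℝ) {t : ℝ} (ht : 0 < t) :
    HasDerivAt (fun t : ℝ => iteratedDeriv k riemannZeta ((σ:ℂ) + t*I))
      (iteratedDeriv (k+1) riemannZeta ((σ:ℂ) + t*I) * I) t :=
  comp_line (zetaD_hasDeriv k (by simpa using ht))

lemma zetaD_line_cont (k : ℕ) (σ t0 T : ℝ) (ht0 : 0 < t0) :
    ContinuousOn (fun t : ℝ => iteratedDeriv k riemannZeta ((σ:ℂ) + t*I)) (Set.Icc t0 T) :=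
  fun t ht => (zetaD_line k σ (by linarith [ht.1])).continuousAt.continuousWithinAt

lemma npow_line (d : ℕ) (hd : 1 ≤ d) (σ t : ℝ) :
    HasDerivAt (fun t : ℝ => (d:ℂ)^((σ:ℂ)+t*I)) ((d:ℂ)^((σ:ℂ)+t*I) * (Real.log d : ℝ) * I) t := by
  have h := comp_line (a := σ) (t := t) ((hasDerivAt_id _).const_cpow (c := (d:ℂ))
    (Or.inl (by exact_mod_cast (by omega : d ≠ 0))))
  refine h.congr_deriv ?_
  rw [← Complex.natCast_log]
  simp

lemma norm_npow_line (d : ℕ) (hd : 1 ≤ d) (σ t : ℝ) : ‖(d:ℂ)^((σ:ℂ)+t*I)‖ = (d:ℝ)^σ := by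
  rw [Complex.norm_natCast_cpow_of_pos (by omega)]; simp

/-- The integrals over the left edge. -/
noncomputable def JJ (k d : ℕ) (t0 T : ℝ) : ℂ :=
  ∫ t in t0..T, iteratedDeriv k riemannZeta ((-1/8:ℝ) + t*I) * (d:ℂ)^(((-1/8:ℝ):ℂ) + t*I)

lemma JJ_step (k : ℕ) : ∃ C > 0, ∀ t0 T : ℝ, 3 ≤ t0 → t0 ≤ T → ∀ d : ℕ, 1 ≤ d →
    ‖JJ (k+1) d t0 T + (Real.log d : ℝ) * JJ k d t0 T‖ ≤ C * T^(7/8:ℝ) * (d:ℝ)^(-1/8:ℝ) := by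
  obtain ⟨C, hC, h⟩ := zetaD_strip k
  refine ⟨2*C, by positivity, fun t0 T ht0 hT d hd => ?_⟩
  have hd0 : (0:ℝ) < d := by exact_mod_cast hd
  set F : ℝ → ℂ := fun t => iteratedDeriv k riemannZeta ((-1/8:ℝ) + t*I) * (d:ℂ)^(((-1/8:ℝ):ℂ) + t*I) with hF
  set G : ℝ → ℂ := fun t => iteratedDeriv (k+1) riemannZeta ((-1/8:ℝ) + t*I) * (d:ℂ)^(((-1/8:ℝ):ℂ) + t*I) with hG
  have hu : Set.uIcc t0 T = Set.Icc t0 T := Set.uIcc_of_le hT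
  have hpc : ContinuousOn (fun t : ℝ => (d:ℂ)^(((-1/8:ℝ):ℂ) + t*I)) (Set.Icc t0 T) :=
    fun t _ => (npow_line d hd _ t).continuousAt.continuousWithinAt
  have hFc : ContinuousOn F (Set.Icc t0 T) := (zetaD_line_cont k _ t0 T (by linarith)).mul hpc
  have hGc : ContinuousOn G (Set.Icc t0 T) := (zetaD_line_cont (k+1) _ t0 T (by linarith)).mul hpc
  have hder : ∀ t ∈ Set.uIcc t0 T, HasDerivAt F (I * (G t + (Real.log d : ℝ) * F t)) t := by
    intro t ht
    rw [hu] at ht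
    have h1 := zetaD_line k (-1/8) (t := t) (by linarith [ht.1])
    refine (h1.mul (npow_line d hd (-1/8) t)).congr_deriv ?_
    simp only [hF, hG]; ring
  have hIntg : IntervalIntegrable (fun t => I * (G t + (Real.log d : ℝ) * F t)) MeasureTheory.volume t0 T := by
    apply ContinuousOn.intervalIntegrable
    rw [hu]
    exact continuousOn_const.mul (hGc.add (continuousOn_const.mul hFc))
  have hi := intervalIntegral.integral_eq_sub_of_hasDerivAt hder hIntg
  have hGi : IntervalIntegrable G MeasureTheory.volume t0 T :=
    ContinuousOn.intervalIntegrable (by rw [hu]; exact hGc)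
  have hFi : IntervalIntegrable (fun t => ((Real.log d : ℝ):ℂ) * F t) MeasureTheory.volume t0 T :=
    ContinuousOn.intervalIntegrable (by rw [hu]; exact continuousOn_const.mul hFc)
  rw [intervalIntegral.integral_const_mul, intervalIntegral.integral_add hGi hFi,
    intervalIntegral.integral_const_mul] at hi
  have hn : ‖JJ (k+1) d t0 T + (Real.log d : ℝ) * JJ k d t0 T‖ = ‖F T - F t0‖ := by
    rw [← hi, norm_mul, Complex.norm_I, one_mul]; rfl
  rw [hn]
  have hb : ∀ t, t0 ≤ t → t ≤ T → ‖F t‖ ≤ C * T^(7/8:ℝ) * (d:ℝ)^(-1/8:ℝ) := by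
    intro t h1 h2
    rw [hF]
    simp only [norm_mul]
    rw [norm_npow_line d hd]
    gcongr
    refine (h (-1/8) t (by norm_num) (by norm_num) (by linarith)).trans ?_
    gcongr
    linarith
  have := hb T hT le_rfl
  have := hb t0 le_rfl hT
  refine (norm_sub_le _ _).trans ?_
  linarith

lemma JJ_zero (d : ℕ) (t0 T : ℝ) : JJ 0 d t0 T = I0 d t0 T := by
  simp only [JJ, I0, iteratedDeriv_zero]

lemma JJ_I0 (k : ℕ) : ∃ C > 0, ∀ t0 T : ℝ, 3 ≤ t0 → t0 ≤ T → ∀ d : ℕ, 1 ≤ d →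
    ‖JJ k d t0 T - ((-Real.log d : ℝ):ℂ)^k * I0 d t0 T‖ ≤
      C * T^(7/8:ℝ) * (d:ℝ)^(-1/8:ℝ) * (1 + Real.log d)^k := by
  induction k with
  | zero => 
    refine ⟨1, one_pos, fun t0 T ht0 hT d hd => ?_⟩
    rw [JJ_zero]
    simp only [pow_zero, one_mul, sub_self, norm_zero]
    have : (0:ℝ) ≤ T := by linarith
    positivity
  | succ k ih =>
    obtain ⟨C1, hC1, h1⟩ := ih
    obtain ⟨C2, hC2, h2⟩ := JJ_step k
    refine ⟨C1 + C2, by positivity, fun t0 T ht0 hT d hd => ?_⟩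
    have a1 := h1 t0 T ht0 hT d hd
    have a2 := h2 t0 T ht0 hT d hd
    have hl : 0 ≤ Real.log d := Real.log_nonneg (by exact_mod_cast hd)
    have hT0 : (0:ℝ) ≤ T := by linarith
    set X := T^(7/8:ℝ) * (d:ℝ)^(-1/8:ℝ) with hX
    have hX0 : 0 ≤ X := by positivity
    have e : JJ (k+1) d t0 T - ((-Real.log d : ℝ):ℂ)^(k+1) * I0 d t0 T =
        (JJ (k+1) d t0 T + (Real.log d : ℝ) * JJ k d t0 T) -
        (Real.log d : ℝ) * (JJ k d t0 T - ((-Real.log d : ℝ):ℂ)^k * I0 d t0 T) := by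
      push_cast; ring
    rw [e]
    refine (norm_sub_le _ _).trans ?_
    rw [norm_mul, Complex.norm_real, Real.norm_of_nonneg hl]
    have hp : 1 ≤ (1 + Real.log d)^(k+1) := one_le_pow₀ (by linarith)
    calc _ ≤ C2 * T^(7/8:ℝ) * (d:ℝ)^(-1/8:ℝ) + Real.log d * (C1 * T^(7/8:ℝ) * (d:ℝ)^(-1/8:ℝ) * (1 + Real.log d)^k) := by gcongr
      _ = C2 * X * 1 + C1 * X * (Real.log d * (1 + Real.log d)^k) := by rw [hX]; ring
      _ ≤ C2 * X * (1 + Real.log d)^(k+1) + C1 * X * (1 + Real.log d)^(k+1) := by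
        gcongr
        rw [pow_succ, mul_comm]
        gcongr
        linarith
      _ = _ := by rw [hX]; ring

/-- the von Mangoldt coefficients -/
lemma lam_summable : Summable (fun d : ℕ => ArithmeticFunction.vonMangoldt d * (d:ℝ)^(-9/8:ℝ)) := by
  have h := (ArithmeticFunction.LSeriesSummable_vonMangoldt (s := ((9/8:ℝ):ℂ)) (by rw [Complex.ofReal_re]; norm_num)).norm
  refine h.congr fun d => ?_
  rw [LSeries.norm_term_eq]
  split_ifs with hd
  · subst hd; simp
  · rw [Complex.norm_real, Real.norm_of_nonneg (lam_nonneg d), Complex.ofReal_re,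
      show (-9/8:ℝ) = -(9/8) by norm_num, Real.rpow_neg (by positivity)]
    rfl

lemma lam_hasSum (t : ℝ) : HasSum (fun d : ℕ => ((ArithmeticFunction.vonMangoldt d / d : ℝ) : ℂ) *
      (d:ℂ)^(((-1/8:ℝ):ℂ) + t*I))
    (- starRingEnd ℂ (deriv riemannZeta (((9/8:ℝ):ℂ)+t*I) / riemannZeta (((9/8:ℝ):ℂ)+t*I))) := by
  have hs : 1 < ((((9/8:ℝ):ℂ)+t*I)).re := by simp; norm_num
  have h := (ArithmeticFunction.LSeriesSummable_vonMangoldt hs).LSeriesHasSum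
  rw [ArithmeticFunction.LSeries_vonMangoldt_eq_deriv_riemannZeta_div hs] at h
  have h2 := (Complex.hasSum_conj' (f := _) ).mpr h
  rw [neg_div, map_neg] at h2
  convert! h2 using 1
  funext d
  rcases Nat.eq_zero_or_pos d with hd | hd
  · subst hd; simp
  · rw [LSeries.term_of_ne_zero (by omega), map_div₀, natcpow d hd, natcpow d hd, map_mul,
      Complex.conj_ofReal, ← Complex.exp_conj, Complex.conj_ofReal, map_mul, Complex.conj_I, Complex.conj_ofReal,
      neg_mul, Complex.exp_neg]
    have hd0 : (0:ℝ) < d := by exact_mod_cast hd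
    have e : (d:ℝ)^(-1/8:ℝ) = d * ((d:ℝ)^(9/8:ℝ))⁻¹ := by
      rw [← Real.rpow_neg hd0.le, ← Real.rpow_one_add' hd0.le (by norm_num)]; norm_num
    rw [e]
    have e2 : (((d:ℝ)^(9/8:ℝ) : ℝ):ℂ) ≠ 0 := by
      exact_mod_cast (by positivity : (d:ℝ)^(9/8:ℝ) ≠ 0)
    have e3 : (d:ℂ) ≠ 0 := by exact_mod_cast (by omega : d ≠ 0)
    have e4 := Complex.exp_ne_zero (I * ((t * Real.log d : ℝ):ℂ))
    push_cast at e2 e4 ⊢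
    field_simp

end Shanks

namespace Shanks

lemma left_sum (n : ℕ) (t0 T : ℝ) (ht0 : 3 ≤ t0) (hT : t0 ≤ T) :
    HasSum (fun d : ℕ => ((ArithmeticFunction.vonMangoldt d / d : ℝ) : ℂ) * JJ n d t0 T)
      (∫ t in t0..T, (- starRingEnd ℂ (deriv riemannZeta (((9/8:ℝ):ℂ)+t*I) / riemannZeta (((9/8:ℝ):ℂ)+t*I)))
        * iteratedDeriv n riemannZeta (((-1/8:ℝ):ℂ) + t*I)) := by
  obtain ⟨C, hC, h⟩ := zetaD_strip n
  have hT0 : 0 ≤ T := by linarith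
  have hpc : ∀ d : ℕ, ContinuousOn (fun t : ℝ => ((ArithmeticFunction.vonMangoldt d / d : ℝ) : ℂ) *
      (d:ℂ)^(((-1/8:ℝ):ℂ) + t*I)) (Set.Icc t0 T) := by
    intro d
    rcases Nat.eq_zero_or_pos d with hd | hd
    · subst hd; simpa using continuousOn_const
    · exact continuousOn_const.mul
        fun t _ => (npow_line d hd _ t).continuousAt.continuousWithinAt
  have := int_hasSum (a := t0) (b := T)
    (F := fun (d : ℕ) (t : ℝ) => (((ArithmeticFunction.vonMangoldt d / d : ℝ) : ℂ) *
      (d:ℂ)^(((-1/8:ℝ):ℂ) + t*I)) * iteratedDeriv n riemannZeta (((-1/8:ℝ):ℂ) + t*I))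
    (f := fun t => (- starRingEnd ℂ (deriv riemannZeta (((9/8:ℝ):ℂ)+t*I) / riemannZeta (((9/8:ℝ):ℂ)+t*I)))
        * iteratedDeriv n riemannZeta (((-1/8:ℝ):ℂ) + t*I))
    (B := fun d => (ArithmeticFunction.vonMangoldt d * (d:ℝ)^(-9/8:ℝ)) * (C * T^(7/8:ℝ)))
    hT (fun d => (hpc d).mul (zetaD_line_cont n _ t0 T (by linarith)))
    (lam_summable.mul_right _) ?_ ?_
  · convert! this using 1
    funext d
    rw [JJ, ← intervalIntegral.integral_const_mul]
    congr 1
    funext t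
    ring
  · intro d t ht
    have hb : ‖iteratedDeriv n riemannZeta (((-1/8:ℝ):ℂ) + t*I)‖ ≤ C * T^(7/8:ℝ) := by
      refine (h (-1/8) t (by norm_num) (by norm_num) (by linarith [ht.1])).trans ?_
      have : 0 ≤ t := by linarith [ht.1]
      gcongr
      exact ht.2
    rw [norm_mul]
    rcases Nat.eq_zero_or_pos d with hd | hd
    · subst hd; simp
    · have hd0 : (0:ℝ) < d := by exact_mod_cast hd
      have hl := lam_nonneg d
      have e : ‖((ArithmeticFunction.vonMangoldt d / d : ℝ) : ℂ) * (d:ℂ)^(((-1/8:ℝ):ℂ) + t*I)‖ =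
          ArithmeticFunction.vonMangoldt d * (d:ℝ)^(-9/8:ℝ) := by
        rw [norm_mul, norm_npow_line d hd, Complex.norm_real, Real.norm_of_nonneg (by positivity),
          show (-9/8:ℝ) = -1 + -1/8 by norm_num, Real.rpow_add hd0, Real.rpow_neg_one]
        ring
      rw [e]
      gcongr
  · intro t ht
    exact (lam_hasSum t).mul_right _

lemma qX_size {t : ℝ} (ht : 3 ≤ t) : ‖qX (((9/8:ℝ):ℂ) + t*I)‖ ≤ 13 * t^(1/8:ℝ) := by
  have h := qX_bd (σ := 9/8) (t := t) (by norm_num) (by norm_num) (by linarith)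
  have hpi := Real.pi_pos
  have hpi4 := Real.pi_lt_d2
  have h1 : (1:ℝ) ≤ t^(1/8:ℝ) := Real.one_le_rpow (by linarith) (by norm_num)
  have h2 : |Real.log (t/(2*Real.pi))| ≤ 8 * t^(1/8:ℝ) + 2 := by
    rw [Real.log_div (by linarith) (by positivity), abs_le]
    have a1 : Real.log t ≤ 8 * t^(1/8:ℝ) := by
      have := Real.log_le_rpow_div (x := t) (by linarith) (ε := 1/8) (by norm_num)
      linarith
    have a2 : Real.log (2*Real.pi) ≤ 2 := by
      rw [Real.log_le_iff_le_exp (by positivity)]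
      have : (2.7:ℝ) ≤ Real.exp 1 := by have := Real.exp_one_gt_d9; linarith
      have e : Real.exp 2 = Real.exp 1 * Real.exp 1 := by rw [← Real.exp_add]; norm_num
      nlinarith
    have a3 : 0 ≤ Real.log t := Real.log_nonneg (by linarith)
    have a4 : 0 ≤ Real.log (2*Real.pi) := Real.log_nonneg (by nlinarith [Real.pi_gt_three])
    constructor <;> linarith
  have h3 : 8 / t ≤ 3 := by rw [div_le_iff₀ (by linarith)]; linarith
  have h4 : ‖((Real.log (t/(2*Real.pi)) : ℝ) : ℂ)‖ ≤ 8 * t^(1/8:ℝ) + 2 := by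
    rw [Complex.norm_real]; exact h2
  have := norm_add_le (qX (((9/8:ℝ):ℂ) + t*I) - (Real.log (t/(2*Real.pi)) : ℝ)) ((Real.log (t/(2*Real.pi)) : ℝ):ℂ)
  rw [sub_add_cancel] at this
  linarith

lemma quad_open : IsOpen {z : ℂ | 0 < z.re ∧ 0 < z.im} :=
  (isOpen_lt continuous_const Complex.continuous_re).inter (isOpen_lt continuous_const Complex.continuous_im)

lemma qX_diffOn : DifferentiableOn ℂ qX {z : ℂ | 0 < z.re ∧ 0 < z.im} := fun _ hz =>
  (qX_hasDeriv hz.1 hz.2).differentiableAt.differentiableWithinAt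

lemma qc_line {t : ℝ} (ht : 0 < t) : HasDerivAt (fun t : ℝ => starRingEnd ℂ (qX (((9/8:ℝ):ℂ) + t*I)))
    (starRingEnd ℂ (deriv qX (((9/8:ℝ):ℂ) + t*I) * I)) t := by
  have h1 : HasDerivAt qX (deriv qX (((9/8:ℝ):ℂ) + t*I)) (((9/8:ℝ):ℂ) + t*I) :=
    (qX_hasDeriv (by simp) (by simpa using ht)).differentiableAt.hasDerivAt
  exact (comp_line h1).star

lemma q_part (k : ℕ) : ∃ C > 0, ∀ t0 T : ℝ, 3 ≤ t0 → t0 ≤ T →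
    ‖∫ t in t0..T, starRingEnd ℂ (qX (((9/8:ℝ):ℂ) + t*I)) *
      iteratedDeriv (k+1) riemannZeta (((-1/8:ℝ):ℂ) + t*I)‖ ≤ C * T := by
  obtain ⟨C, hC, h⟩ := zetaD_strip k
  refine ⟨26*C + 41*C, by positivity, fun t0 T ht0 hT => ?_⟩
  have hT0 : 0 < T := by linarith
  have hu : Set.uIcc t0 T = Set.Icc t0 T := Set.uIcc_of_le hT
  set Q : ℝ → ℂ := fun t => starRingEnd ℂ (qX (((9/8:ℝ):ℂ) + t*I)) with hQ
  set Q' : ℝ → ℂ := fun t => starRingEnd ℂ (deriv qX (((9/8:ℝ):ℂ) + t*I) * I) with hQ'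
  set Z : ℝ → ℂ := fun t => iteratedDeriv k riemannZeta (((-1/8:ℝ):ℂ) + t*I) with hZ
  set Z' : ℝ → ℂ := fun t => iteratedDeriv (k+1) riemannZeta (((-1/8:ℝ):ℂ) + t*I) with hZ'
  have hQc : ContinuousOn Q (Set.Icc t0 T) := fun t ht =>
    (qc_line (by linarith [ht.1])).continuousAt.continuousWithinAt
  have hQ'c : ContinuousOn Q' (Set.Icc t0 T) := by
    intro t ht
    have h1 : HasDerivAt (deriv qX) (deriv (deriv qX) (((9/8:ℝ):ℂ) + t*I)) (((9/8:ℝ):ℂ) + t*I) :=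
      ((qX_diffOn.deriv quad_open).differentiableAt
        (quad_open.mem_nhds ⟨by simp, by simp; linarith [ht.1]⟩)).hasDerivAt
    exact ((comp_line h1).mul_const I).star.continuousAt.continuousWithinAt
  have hZc : ContinuousOn Z (Set.Icc t0 T) := zetaD_line_cont k _ t0 T (by linarith)
  have hZ'c : ContinuousOn Z' (Set.Icc t0 T) := zetaD_line_cont (k+1) _ t0 T (by linarith)
  have hder : ∀ t ∈ Set.uIcc t0 T, HasDerivAt (fun t => Q t * Z t) (Q' t * Z t + I * (Q t * Z' t)) t := by
    intro t ht
    rw [hu] at ht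
    refine ((qc_line (t := t) (by linarith [ht.1])).mul (zetaD_line k (-1/8) (t := t) (by linarith [ht.1]))).congr_deriv ?_
    simp only [hQ, hQ', hZ, hZ']; ring
  have i1 : IntervalIntegrable (fun t => Q' t * Z t) MeasureTheory.volume t0 T :=
    ContinuousOn.intervalIntegrable (by rw [hu]; exact hQ'c.mul hZc)
  have i2 : IntervalIntegrable (fun t => I * (Q t * Z' t)) MeasureTheory.volume t0 T :=
    ContinuousOn.intervalIntegrable (by rw [hu]; exact continuousOn_const.mul (hQc.mul hZ'c))
  have hi := intervalIntegral.integral_eq_sub_of_hasDerivAt hder (i1.add i2)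
  rw [intervalIntegral.integral_add i1 i2, intervalIntegral.integral_const_mul] at hi
  have hn : ‖∫ t in t0..T, Q t * Z' t‖ = ‖(Q T * Z T - Q t0 * Z t0) - ∫ t in t0..T, Q' t * Z t‖ := by
    rw [← hi, add_sub_cancel_left, norm_mul, Complex.norm_I, one_mul]
  have hZb : ∀ t, 3 ≤ t → ‖Z t‖ ≤ C * t^(7/8:ℝ) := fun t ht =>
    h (-1/8) t (by norm_num) (by norm_num) ht
  have hb : ∀ t, t0 ≤ t → t ≤ T → ‖Q t * Z t‖ ≤ 13 * C * T := by
    intro t h1 h2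
    have h3 : 3 ≤ t := by linarith
    have hq : ‖Q t‖ ≤ 13 * t^(1/8:ℝ) := by
      rw [hQ]; simp only [Complex.norm_conj]; exact qX_size h3
    rw [norm_mul]
    have : 0 < t := by linarith
    calc _ ≤ 13 * t^(1/8:ℝ) * (C * t^(7/8:ℝ)) := by gcongr; exact hZb t h3
      _ = 13 * C * (t^(1/8:ℝ) * t^(7/8:ℝ)) := by ring
      _ = 13 * C * t := by rw [← Real.rpow_add this]; norm_num
      _ ≤ _ := by gcongr
  have hib : ‖∫ t in t0..T, Q' t * Z t‖ ≤ 41 * C * |T - t0| := by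
    apply intervalIntegral.norm_integral_le_of_norm_le_const
    intro t ht
    rw [Set.uIoc_of_le hT] at ht
    have h3 : 3 ≤ t := by linarith [ht.1]
    have hq : ‖Q' t‖ ≤ 41 / t := by
      rw [hQ']; simp only [Complex.norm_conj, norm_mul, Complex.norm_I, mul_one]
      have := qX_deriv_bd (s := ((9/8:ℝ):ℂ) + t*I) (by simp; norm_num) (by simp; linarith)
      simpa using this
    rw [norm_mul]
    have ht0 : 0 < t := by linarith
    calc _ ≤ 41 / t * (C * t^(7/8:ℝ)) := by gcongr; exact hZb t h3
      _ ≤ 41 / t * (C * t^(1:ℝ)) := by gcongr <;> [linarith; norm_num]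
      _ = 41 * C := by rw [Real.rpow_one]; field_simp
  rw [hn]
  have hab : |T - t0| ≤ T := by rw [abs_of_nonneg (by linarith)]; linarith
  have h5 : 41 * C * |T - t0| ≤ 41 * C * T := by gcongr
  have h6 := hb T hT le_rfl
  have h7 := hb t0 le_rfl hT
  refine (norm_sub_le _ _).trans ?_
  have := norm_sub_le (Q T * Z T) (Q t0 * Z t0)
  linarith

lemma zline_ne (t : ℝ) : riemannZeta (((9/8:ℝ):ℂ)+t*I) ≠ 0 :=
  riemannZeta_ne_zero_of_one_lt_re (by simp; norm_num)

lemma left_edge (n : ℕ) (hn : 1 ≤ n) : ∃ C > 0, ∀ t0 T : ℝ, 3 ≤ t0 → t0 ≤ T → ∃ S : ℂ,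
    HasSum (fun d : ℕ => ((ArithmeticFunction.vonMangoldt d / d : ℝ) : ℂ) * JJ n d t0 T) S ∧
    ‖(∫ t in t0..T, deriv riemannZeta (((-1/8:ℝ):ℂ)+t*I) / riemannZeta (((-1/8:ℝ):ℂ)+t*I) *
      iteratedDeriv n riemannZeta (((-1/8:ℝ):ℂ) + t*I)) - S‖ ≤ C * T := by
  obtain ⟨k, rfl⟩ : ∃ k, n = k + 1 := ⟨n-1, by omega⟩
  obtain ⟨C, hC, h⟩ := q_part k
  refine ⟨C, hC, fun t0 T ht0 hT => ⟨_, left_sum (k+1) t0 T ht0 hT, ?_⟩⟩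
  have hu : Set.uIcc t0 T = Set.Icc t0 T := Set.uIcc_of_le hT
  refine le_trans (le_of_eq ?_) (h t0 T ht0 hT)
  set Z : ℝ → ℂ := fun t => iteratedDeriv (k+1) riemannZeta (((-1/8:ℝ):ℂ) + t*I) with hZ
  set Q : ℝ → ℂ := fun t => starRingEnd ℂ (qX (((9/8:ℝ):ℂ) + t*I)) with hQ
  set W : ℝ → ℂ := fun t => - starRingEnd ℂ (deriv riemannZeta (((9/8:ℝ):ℂ)+t*I) / riemannZeta (((9/8:ℝ):ℂ)+t*I)) with hW
  have hZc : ContinuousOn Z (Set.Icc t0 T) := zetaD_line_cont (k+1) _ t0 T (by linarith)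
  have hQc : ContinuousOn Q (Set.Icc t0 T) := fun t ht =>
    (qc_line (by linarith [ht.1])).continuousAt.continuousWithinAt
  have hWc : ContinuousOn W (Set.Icc t0 T) := by
    intro t ht
    have h0 := zetaD_line 0 (9/8) (t := t) (by linarith [ht.1])
    have h1 := zetaD_line 1 (9/8) (t := t) (by linarith [ht.1])
    simp only [iteratedDeriv_zero, iteratedDeriv_one] at h0 h1
    exact (h1.div h0 (zline_ne t)).star.neg.continuousAt.continuousWithinAt
  have e : (∫ t in t0..T, deriv riemannZeta (((-1/8:ℝ):ℂ)+t*I) / riemannZeta (((-1/8:ℝ):ℂ)+t*I) * Z t)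
      = ∫ t in t0..T, (W t * Z t - Q t * Z t) := by
    apply intervalIntegral.integral_congr
    intro t ht
    rw [hu] at ht
    have hre : 0 < (((9/8:ℝ):ℂ) + t*I).re := by simp
    have him : 0 < (((9/8:ℝ):ℂ) + t*I).im := by simp; linarith [ht.1]
    have h1 := zeta_refl_logDeriv hre him (zline_ne t)
    have h2 := refl_pt (-1/8) t
    have h3 : (1 - (-1/8):ℝ) = 9/8 := by norm_num
    rw [h3] at h2
    rw [← h2] at h1
    simp only
    rw [h1, map_add]
    simp only [hW, hQ]
    ring
  have i1 : IntervalIntegrable (fun t => W t * Z t) MeasureTheory.volume t0 T :=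
    ContinuousOn.intervalIntegrable (by rw [hu]; exact hWc.mul hZc)
  have i2 : IntervalIntegrable (fun t => Q t * Z t) MeasureTheory.volume t0 T :=
    ContinuousOn.intervalIntegrable (by rw [hu]; exact hQc.mul hZc)
  rw [e, intervalIntegral.integral_sub i1 i2, sub_sub_cancel_left, norm_neg]

end Shanks

namespace Shanks

lemma log_pow_small (n : ℕ) : ∃ C > 0, ∀ x : ℝ, 1 ≤ x → (1 + Real.log x)^n ≤ C * x^(1/16:ℝ) := by
  set ε : ℝ := 1/(16*(n+1)) with hε
  have hε0 : 0 < ε := by positivity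
  have hne : ε * n ≤ 1/16 := by
    rw [hε, div_mul_eq_mul_div, div_le_iff₀ (by positivity)]; linarith
  refine ⟨(1+1/ε)^n, by positivity, fun x hx => ?_⟩
  have h1 := Real.log_le_rpow_div (x := x) (by linarith) hε0
  have h2 : 1 ≤ x^ε := Real.one_le_rpow hx hε0.le
  have h3 : 1 + Real.log x ≤ (1+1/ε) * x^ε := by
    calc _ ≤ x^ε + x^ε/ε := by linarith
      _ = _ := by ring
  have h0 : 0 ≤ Real.log x := Real.log_nonneg hx
  calc (1 + Real.log x)^n ≤ ((1+1/ε) * x^ε)^n := by gcongr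
    _ = (1+1/ε)^n * x^(ε*n) := by rw [mul_pow, Real.rpow_mul (by linarith), Real.rpow_natCast]
    _ ≤ _ := by gcongr

lemma lam_const (n : ℕ) : ∃ C > 0, ∀ N : ℕ, ∑ d ∈ Ioc 0 N,
    ArithmeticFunction.vonMangoldt d / d * ((d:ℝ)^(-1/8:ℝ) * (1 + Real.log d)^n) ≤ C := by
  obtain ⟨C, hC, h⟩ := log_pow_small n
  refine ⟨C * 102, by positivity, fun N => ?_⟩
  rcases Nat.eq_zero_or_pos N with hN | hN
  · subst hN; simp; positivity
  have key : ∀ d ∈ Ioc 0 N, ArithmeticFunction.vonMangoldt d / d * ((d:ℝ)^(-1/8:ℝ) * (1 + Real.log d)^n) ≤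
      C * (ArithmeticFunction.vonMangoldt d * (d:ℝ)^(-1-1/16:ℝ)) := by
    intro d hd
    have hd1 := (Finset.mem_Ioc.mp hd).1
    have hd0 : (0:ℝ) < d := by exact_mod_cast hd1
    have hb := h d (by exact_mod_cast hd1)
    have hl := lam_nonneg d
    calc _ ≤ ArithmeticFunction.vonMangoldt d / d * ((d:ℝ)^(-1/8:ℝ) * (C * (d:ℝ)^(1/16:ℝ))) := by gcongr
      _ = C * (ArithmeticFunction.vonMangoldt d * ((d:ℝ)^(-1:ℝ) * (d:ℝ)^(-1/8:ℝ) * (d:ℝ)^(1/16:ℝ))) := by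
        rw [Real.rpow_neg_one]; ring
      _ = _ := by rw [← Real.rpow_add hd0, ← Real.rpow_add hd0]; norm_num
  refine (Finset.sum_le_sum key).trans ?_
  rw [← Finset.mul_sum, ← Finset.sum_Ioc_consecutive _ (Nat.zero_le 1) hN]
  have ht := lam_tail2 (1/16) (by norm_num) 1 le_rfl N hN
  have : ∑ d ∈ Ioc 0 1, ArithmeticFunction.vonMangoldt d * (d:ℝ)^(-1-1/16:ℝ) = 0 := by simp
  rw [this, zero_add]
  gcongr
  refine ht.trans (le_of_eq ?_)
  norm_num

lemma ev_T (M : ℝ) : ∃ T1 : ℝ, 10 ≤ T1 ∧ ∀ T, T1 ≤ T → M ≤ T / Real.log T ^ 4 := by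
  have h : Tendsto (fun T : ℝ => T / Real.log T ^ 4) atTop atTop := by
    have h1 : (fun x : ℝ => Real.log x ^ 4) =o[atTop] id := by
      have := isLittleO_log_rpow_rpow_atTop (s := 1) 4 one_pos
      refine this.congr' ?_ ?_
      · filter_upwards with x; norm_cast
      · filter_upwards with x; simp
    have h2 := h1.tendsto_div_nhds_zero
    have h3 : Tendsto (fun x : ℝ => Real.log x ^ 4 / id x) atTop (nhdsWithin 0 (Set.Ioi 0)) := by
      refine tendsto_nhdsWithin_iff.mpr ⟨h2, ?_⟩
      filter_upwards [eventually_gt_atTop 1] with x hx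
      have := Real.log_pos hx
      have : 0 < x := by linarith
      simp only [id, Set.mem_Ioi]; positivity
    refine (tendsto_inv_nhdsGT_zero.comp h3).congr fun x => ?_
    simp
  obtain ⟨T1, hT1⟩ := (h.eventually_ge_atTop M).exists_forall_of_atTop
  exact ⟨max T1 10, le_max_right _ _, fun T hT => hT1 T ((le_max_left _ _).trans hT)⟩

lemma log_ge_one {T : ℝ} (hT : 10 ≤ T) : 1 ≤ Real.log T := by
  rw [Real.le_log_iff_exp_le (by linarith)]
  have := Real.exp_one_lt_d9
  linarith

lemma sum_Ioc_shift (f : ℕ → ℂ) (N : ℕ) : ∑ d ∈ Ioc 0 N, f d = ∑ i ∈ range N, f (i+1) := by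
  induction N with
  | zero => simp
  | succ N ih => rw [Finset.sum_Ioc_succ_top (Nat.zero_le _), Finset.sum_range_succ, ih]

lemma main_sum (n : ℕ) (hn : 1 ≤ n) : ∃ C > 0, ∃ T1 ≥ 10, ∀ t0 T : ℝ, 3 ≤ t0 → t0 ≤ 4 → T1 ≤ T →
    ∀ S : ℂ, HasSum (fun d : ℕ => ((ArithmeticFunction.vonMangoldt d / d : ℝ) : ℂ) * JJ n d t0 T) S →
    ‖S - (((-1)^n * (T-t0) * Wer n ⌊T / Real.log T ^ 4⌋₊ : ℝ) : ℂ)‖ ≤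
      C * (T * Real.log T ^ n * √(Real.log T)) := by
  obtain ⟨C1, hC1, h1⟩ := JJ_I0 n
  obtain ⟨C2, hC2, T2, hT2, h2⟩ := I0_b
  obtain ⟨C3, hC3, h3⟩ := I0_a
  obtain ⟨Cc, hCc, hc⟩ := lam_const n
  obtain ⟨M0, hM0, hm⟩ := lam_tail3 n
  obtain ⟨T3, hT3, h4⟩ := ev_T (M0 + 1)
  refine ⟨C1*Cc + 434*C2 + 204*C3, by positivity, max T2 T3, le_max_of_le_left hT2, ?_⟩
  intro t0 T ht0 ht4 hT S hS
  have hT2' : T2 ≤ T := (le_max_left _ _).trans hT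
  have hT3' : T3 ≤ T := (le_max_right _ _).trans hT
  have hT10 : 10 ≤ T := by linarith
  have hT0 : 0 < T := by linarith
  have ht0T : t0 ≤ T := by linarith
  set L := Real.log T with hL
  have hL1 : 1 ≤ L := log_ge_one hT10
  have hL0 : 0 < L := by linarith
  have hY := h4 T hT3'
  rw [← hL] at hY
  set Y := T / L^4 with hYdef
  set D := ⌊Y⌋₊ with hD
  have hY0 : 0 < Y := by positivity
  have hDY : (D:ℝ) ≤ Y := Nat.floor_le hY0.le
  have hYD : Y < D + 1 := Nat.lt_floor_add_one Y
  have hDM : M0 ≤ D := by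
    rw [hD]; apply Nat.le_floor; linarith
  have hD1 : 1 ≤ D := by omega
  have hD1' : (1:ℝ) ≤ D := by exact_mod_cast hD1
  have hYT : Y ≤ T := div_le_self hT0.le (one_le_pow₀ hL1)
  have hYL : Y ≤ T / L^2 := by
    rw [hYdef]; gcongr <;> norm_num
  have hlD : Real.log D ≤ L := Real.log_le_log (by linarith) (by linarith)
  have hlD0 : 0 ≤ Real.log D := Real.log_nonneg hD1'
  -- bounds
  have hsq : L * T^(5/8:ℝ) ≤ 29 * (T / L) := by
    have a1 := Real.log_le_rpow_div (x := T) hT0.le (ε := 3/16) (by norm_num)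
    have a2 : L^2 ≤ 29 * T^(3/8:ℝ) := by
      have : T^(3/8:ℝ) = T^(3/16:ℝ) * T^(3/16:ℝ) := by rw [← Real.rpow_add hT0]; norm_num
      rw [this]
      rw [← hL] at a1
      have p : 0 < T^(3/16:ℝ) := by positivity
      have : L^2 ≤ (T^(3/16:ℝ)/(3/16))^2 := by gcongr
      refine this.trans ?_
      have := mul_pos p p
      nlinarith
    have a3 : T = T^(5/8:ℝ) * T^(3/8:ℝ) := by rw [← Real.rpow_add hT0]; norm_num
    rw [mul_div_assoc', le_div_iff₀ hL0]
    have p : 0 < T^(5/8:ℝ) := by positivity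
    calc L * T^(5/8:ℝ) * L = T^(5/8:ℝ) * L^2 := by ring
      _ ≤ T^(5/8:ℝ) * (29 * T^(3/8:ℝ)) := by gcongr
      _ = 29 * (T^(5/8:ℝ) * T^(3/8:ℝ)) := by ring
      _ = 29 * T := by rw [← a3]
  have hI0 : ∀ d ∈ Ioc 0 D, ‖I0 d t0 T - (T-t0:ℝ)‖ ≤ 31 * C2 * (T / L) := by
    intro d hd
    have hd' := Finset.mem_Ioc.mp hd
    have hdD : (d:ℝ) ≤ Y := le_trans (by exact_mod_cast hd'.2) hDY
    refine (h2 t0 T ht0 ht4 hT2' d hd'.1 (hdD.trans hYT)).trans ?_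
    have b1 : T^(1/2:ℝ) * (d:ℝ)^(1/2:ℝ) ≤ T / L^2 := by
      calc T^(1/2:ℝ) * (d:ℝ)^(1/2:ℝ) ≤ T^(1/2:ℝ) * Y^(1/2:ℝ) := by gcongr
        _ = √(T * Y) := by rw [← Real.mul_rpow hT0.le hY0.le, Real.sqrt_eq_rpow]
        _ = √((T/L^2)^2) := by congr 1; rw [hYdef]; field_simp
        _ = T / L^2 := Real.sqrt_sq (by positivity)
    have b2 : (d:ℝ) ≤ T / L^2 := hdD.trans hYL
    have b3 : L * (T/L^2) = T / L := by field_simp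
    calc C2 * L * (T^(5/8:ℝ) + T^(1/2:ℝ)*(d:ℝ)^(1/2:ℝ) + d)
        ≤ C2 * L * (T^(5/8:ℝ) + T/L^2 + T/L^2) := by gcongr
      _ = C2 * (L * T^(5/8:ℝ) + 2 * (L * (T/L^2))) := by ring
      _ ≤ C2 * (29 * (T/L) + 2 * (T/L)) := by rw [b3]; gcongr
      _ = _ := by ring
  set c : ℕ → ℝ := fun d => ArithmeticFunction.vonMangoldt d / d with hcdef
  have hc0 : ∀ d, 0 ≤ c d := fun d => div_nonneg (lam_nonneg d) (by positivity)
  set e1 : ℕ → ℝ := fun d => C1 * T^(7/8:ℝ) * (c d * ((d:ℝ)^(-1/8:ℝ) * (1 + Real.log d)^n)) with he1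
  have hlogn : ∀ d : ℕ, 0 ≤ Real.log d := fun d => Real.log_natCast_nonneg d
  have hJ : ∀ d : ℕ, 1 ≤ d → ‖(c d : ℂ) * (JJ n d t0 T - ((-Real.log d : ℝ):ℂ)^n * I0 d t0 T)‖ ≤ e1 d := by
    intro d hd
    rw [norm_mul, Complex.norm_real, Real.norm_of_nonneg (hc0 d)]
    calc _ ≤ c d * (C1 * T^(7/8:ℝ) * (d:ℝ)^(-1/8:ℝ) * (1 + Real.log d)^n) :=
          mul_le_mul_of_nonneg_left (h1 t0 T ht0 ht0T d hd) (hc0 d)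
      _ = _ := by rw [he1]; ring
  have hnl : ∀ d : ℕ, ‖((-Real.log d : ℝ):ℂ)^n‖ = Real.log d ^ n := by
    intro d
    rw [norm_pow, Complex.norm_real, norm_neg, Real.norm_of_nonneg (hlogn d)]
  have hA : ∀ d ∈ Ioc 0 D, ‖(c d : ℂ) * JJ n d t0 T - (c d : ℂ) * (((-Real.log d : ℝ):ℂ)^n * (T-t0:ℝ))‖
      ≤ e1 d + 31 * C2 * (T/L) * (c d * Real.log d ^ n) := by
    intro d hd
    have e : (c d : ℂ) * JJ n d t0 T - (c d : ℂ) * (((-Real.log d : ℝ):ℂ)^n * (T-t0:ℝ)) =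
      (c d : ℂ) * (JJ n d t0 T - ((-Real.log d : ℝ):ℂ)^n * I0 d t0 T) +
      (c d : ℂ) * (((-Real.log d : ℝ):ℂ)^n * (I0 d t0 T - (T-t0:ℝ))) := by ring
    rw [e]
    refine (norm_add_le _ _).trans ?_
    refine add_le_add (hJ d (Finset.mem_Ioc.mp hd).1) ?_
    rw [norm_mul, norm_mul, hnl, Complex.norm_real, Real.norm_of_nonneg (hc0 d)]
    calc _ ≤ c d * (Real.log d ^ n * (31 * C2 * (T/L))) :=
          mul_le_mul_of_nonneg_left (mul_le_mul_of_nonneg_left (hI0 d hd) (pow_nonneg (hlogn d) n)) (hc0 d)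
      _ = _ := by ring
  have hB : ∀ d : ℕ, D < d → ‖(c d : ℂ) * JJ n d t0 T‖ ≤ e1 d +
      C3 * T^(9/8:ℝ) * (ArithmeticFunction.vonMangoldt d * (d:ℝ)^(-9/8:ℝ) * Real.log d ^ n) := by
    intro d hd
    have hd1 : 1 ≤ d := by omega
    have hd0 : (0:ℝ) < d := by exact_mod_cast hd1
    have e : (c d : ℂ) * JJ n d t0 T =
      (c d : ℂ) * (JJ n d t0 T - ((-Real.log d : ℝ):ℂ)^n * I0 d t0 T) +
      (c d : ℂ) * (((-Real.log d : ℝ):ℂ)^n * I0 d t0 T) := by ring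
    rw [e]
    refine (norm_add_le _ _).trans ?_
    refine add_le_add (hJ d hd1) ?_
    rw [norm_mul, norm_mul, hnl, Complex.norm_real, Real.norm_of_nonneg (hc0 d)]
    calc _ ≤ c d * (Real.log d ^ n * (C3 * T^(9/8:ℝ) * (d:ℝ)^(-1/8:ℝ))) :=
          mul_le_mul_of_nonneg_left (mul_le_mul_of_nonneg_left (h3 t0 T ht0 ht0T d hd1) (pow_nonneg (hlogn d) n)) (hc0 d)
      _ = _ := by
        rw [show (-9/8:ℝ) = -1 + -1/8 by norm_num, Real.rpow_add hd0, Real.rpow_neg_one, hcdef]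
        ring
  set B := (C1*Cc + 434*C2 + 204*C3) * (T * L ^ n * √L) with hBd
  set Mn : ℂ := (((-1)^n * (T-t0) * Wer n D : ℝ) : ℂ) with hMn
  have hMn2 : Mn = ∑ d ∈ Ioc 0 D, (c d : ℂ) * (((-Real.log d : ℝ):ℂ)^n * (T-t0:ℝ)) := by
    rw [hMn, Wer, Finset.mul_sum, Complex.ofReal_sum]
    refine Finset.sum_congr rfl fun d _ => ?_
    rw [← Complex.ofReal_pow, ← Complex.ofReal_mul, ← Complex.ofReal_mul, neg_pow]
    congr 1
    rw [hcdef]; ring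
  have hsL : 1 ≤ √L := Real.one_le_sqrt.mpr hL1
  have hmain : ∀ N, D ≤ N → ‖∑ d ∈ Ioc 0 N, (c d : ℂ) * JJ n d t0 T - Mn‖ ≤ B := by
    intro N hN
    rw [← Finset.sum_Ioc_consecutive _ (Nat.zero_le D) hN, hMn2, add_sub_right_comm, ← Finset.sum_sub_distrib]
    refine (norm_add_le _ _).trans ?_
    have s1 := norm_sum_le_of_le _ hA
    have s2 := norm_sum_le_of_le (Ioc D N) (fun d hd => hB d (Finset.mem_Ioc.mp hd).1)
    rw [Finset.sum_add_distrib] at s1 s2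
    have s3 : ∑ d ∈ Ioc 0 D, e1 d + ∑ d ∈ Ioc D N, e1 d ≤ C1 * T^(7/8:ℝ) * Cc := by
      rw [Finset.sum_Ioc_consecutive _ (Nat.zero_le D) hN, he1, ← Finset.mul_sum]
      gcongr
      exact hc N
    have s4 : ∑ d ∈ Ioc 0 D, c d * Real.log d ^ n ≤ 14 * L^(n+1) := by
      have := Wer_bd n hn D hD1
      have w1 := (abs_le.mp this).2
      have w2 : Real.log D ^ (n+1) / (n+1) ≤ L^(n+1) := by
        refine (div_le_self (by positivity) (by linarith [(Nat.cast_nonneg n : (0:ℝ) ≤ n)])).trans ?_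
        gcongr
      have w3 : Real.log D ^ n ≤ L^(n+1) := by
        calc Real.log D ^ n ≤ L^n := by gcongr
          _ ≤ L^(n+1) := pow_le_pow_right₀ hL1 (by omega)
      have : ∑ d ∈ Ioc 0 D, c d * Real.log d ^ n = Wer n D := rfl
      linarith
    have s5 := hm D N hDM hN
    have s6 : (D:ℝ)^(-1/8:ℝ) ≤ 2 * T^(-1/8:ℝ) * √L := by
      have hDY2 : Y / 2 ≤ D := by linarith
      calc (D:ℝ)^(-1/8:ℝ) ≤ (Y/2)^(-1/8:ℝ) := Real.rpow_le_rpow_of_nonpos (by positivity) hDY2 (by norm_num)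
        _ = T^(-1/8:ℝ) * (L^4)^(1/8:ℝ) * 2^(1/8:ℝ) := by
          rw [hYdef, Real.div_rpow (by positivity) (by norm_num), Real.div_rpow hT0.le (by positivity),
            show (-1/8:ℝ) = -(1/8) by norm_num, Real.rpow_neg (by positivity : (0:ℝ) ≤ L^4),
            Real.rpow_neg (by norm_num : (0:ℝ) ≤ 2)]
          simp
        _ ≤ T^(-1/8:ℝ) * √L * 2 := by
          have z1 : (L^4)^(1/8:ℝ) = √L := by
            rw [← Real.rpow_natCast, ← Real.rpow_mul hL0.le, Real.sqrt_eq_rpow]; norm_num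
          have z2 : (2:ℝ)^(1/8:ℝ) ≤ 2 := by
            calc (2:ℝ)^(1/8:ℝ) ≤ 2^(1:ℝ) := by gcongr <;> norm_num
              _ = 2 := Real.rpow_one 2
          rw [z1]; gcongr
        _ = _ := by ring
    have s7 : C3 * T^(9/8:ℝ) * (102 * (D:ℝ)^(-1/8:ℝ) * Real.log D ^ n) ≤ 204 * C3 * (T * L^n * √L) := by
      calc C3 * T^(9/8:ℝ) * (102 * (D:ℝ)^(-1/8:ℝ) * Real.log D ^ n)
          ≤ C3 * T^(9/8:ℝ) * (102 * (2 * T^(-1/8:ℝ) * √L) * L ^ n) := by gcongr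
        _ = 204 * C3 * ((T^(9/8:ℝ) * T^(-1/8:ℝ)) * L^n * √L) := by ring
        _ = _ := by rw [← Real.rpow_add hT0]; norm_num
    have s8 : C3 * T^(9/8:ℝ) * ∑ d ∈ Ioc D N, ArithmeticFunction.vonMangoldt d * (d:ℝ)^(-9/8:ℝ) * Real.log d ^ n
        ≤ 204 * C3 * (T * L^n * √L) := (mul_le_mul_of_nonneg_left s5 (by positivity)).trans s7
    have hLn : 1 ≤ L^n := one_le_pow₀ hL1
    have s9 : C1 * T^(7/8:ℝ) * Cc ≤ C1 * Cc * (T * L^n * √L) := by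
      have : T^(7/8:ℝ) ≤ T := by
        calc T^(7/8:ℝ) ≤ T^(1:ℝ) := by gcongr <;> [linarith; norm_num]
          _ = T := Real.rpow_one T
      calc C1 * T^(7/8:ℝ) * Cc ≤ C1 * T * Cc := by gcongr
        _ = C1 * Cc * (T * 1 * 1) := by ring
        _ ≤ _ := by gcongr
    have s10 : 31 * C2 * (T/L) * ∑ d ∈ Ioc 0 D, c d * Real.log d ^ n ≤ 434 * C2 * (T * L^n * √L) := by
      calc _ ≤ 31 * C2 * (T/L) * (14 * L^(n+1)) := by gcongr
        _ = 434 * C2 * (T * L^n * 1) := by rw [pow_succ]; field_simp; ring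
        _ ≤ _ := by gcongr
    rw [hBd]
    rw [Finset.mul_sum] at s8 s10
    linarith
  -- pass to the limit
  have hlim := hS.tendsto_sum_nat.comp (tendsto_add_atTop_nat 1)
  have hlim2 : Tendsto (fun N : ℕ => ‖∑ d ∈ Ioc 0 N, (c d : ℂ) * JJ n d t0 T - Mn‖) atTop (nhds ‖S - Mn‖) := by
    refine ((hlim.sub_const Mn).norm).congr fun N => ?_
    simp only [Function.comp]
    congr 2
    rw [Finset.sum_range_succ', ]
    simp only [Nat.cast_zero, div_zero, Complex.ofReal_zero, zero_mul, add_zero]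
    symm
    exact sum_Ioc_shift _ N
  exact le_of_tendsto hlim2 (by filter_upwards [eventually_ge_atTop D] with N hN using hmain N hN)

end Shanks

namespace Shanks

lemma logDeriv_edge : ∃ C > 0, ∀ t : ℝ,
    ‖deriv riemannZeta (((9/8:ℝ):ℂ)+t*I) / riemannZeta (((9/8:ℝ):ℂ)+t*I)‖ ≤ C := by
  refine ⟨∑' d : ℕ, ArithmeticFunction.vonMangoldt d * (d:ℝ)^(-9/8:ℝ) + 1, ?_, fun t => ?_⟩
  · have : 0 ≤ ∑' d : ℕ, ArithmeticFunction.vonMangoldt d * (d:ℝ)^(-9/8:ℝ) :=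
      tsum_nonneg fun d => mul_nonneg (lam_nonneg d) (by positivity)
    linarith
  have h := lam_hasSum t
  have h2 := h.norm_le_of_bounded lam_summable.hasSum (fun d => by
    rcases Nat.eq_zero_or_pos d with hd | hd
    · subst hd; simp
    · have hd0 : (0:ℝ) < d := by exact_mod_cast hd
      have hl := lam_nonneg d
      rw [norm_mul, norm_npow_line d hd, Complex.norm_real, Real.norm_of_nonneg (by positivity),
          show (-9/8:ℝ) = -1 + -1/8 by norm_num, Real.rpow_add hd0, Real.rpow_neg_one]
      apply le_of_eq; ring)
  rw [norm_neg, Complex.norm_conj] at h2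
  linarith

lemma zeta_right : ∃ C > 0, ∀ s : ℂ, 17/16 ≤ s.re → ‖riemannZeta s‖ ≤ C := by
  have hs : Summable (fun d : ℕ => (d:ℝ)^(-(17/16):ℝ)) := by
    rw [Real.summable_nat_rpow]; norm_num
  refine ⟨∑' d : ℕ, (d:ℝ)^(-(17/16):ℝ) + 1, ?_, fun s h => ?_⟩
  · have : 0 ≤ ∑' d : ℕ, (d:ℝ)^(-(17/16):ℝ) := tsum_nonneg fun d => by positivity
    linarith
  have h1 : 1 < s.re := by linarith
  rw [zeta_eq_tsum_one_div_nat_cpow h1]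
  have := tsum_of_norm_bounded (f := fun d : ℕ => 1 / (d:ℂ)^s) hs.hasSum (fun d => by
    rcases Nat.eq_zero_or_pos d with hd | hd
    · subst hd
      have : s ≠ 0 := by intro h0; rw [h0] at h1; simp at h1; linarith
      simp [this]
    · rw [norm_div, norm_one, Complex.norm_natCast_cpow_of_pos hd, one_div, ← Real.rpow_neg (by positivity)]
      exact Real.rpow_le_rpow_of_exponent_le (by exact_mod_cast hd) (by linarith))
  linarith

lemma zetaD_right (n : ℕ) : ∃ C > 0, ∀ t : ℝ, ‖iteratedDeriv n riemannZeta (((9/8:ℝ):ℂ)+t*I)‖ ≤ C := by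
  obtain ⟨C, hC, h⟩ := zeta_right
  refine ⟨n.factorial * C / (1/16)^n, by positivity, fun t => ?_⟩
  have hball : ∀ z ∈ Metric.closedBall (((9/8:ℝ):ℂ)+t*I) (1/16:ℝ), 17/16 ≤ z.re := by
    intro z hz
    rw [Metric.mem_closedBall, dist_eq_norm] at hz
    have h1 := (Complex.abs_re_le_norm (z - (((9/8:ℝ):ℂ)+t*I))).trans hz
    have h2 := (abs_le.mp h1).1
    simp at h2
    linarith
  apply Complex.norm_iteratedDeriv_le_of_forall_mem_sphere_norm_le n (by norm_num)
  · apply DifferentiableOn.diffContOnCl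
    intro z hz
    rw [closure_ball _ (by norm_num)] at hz
    have := hball z hz
    refine (differentiableAt_riemannZeta ?_).differentiableWithinAt
    rintro rfl
    simp at this; linarith
  · intro z hz
    exact h z (hball z (Metric.sphere_subset_closedBall hz))

lemma Wer_le (n : ℕ) (hn : 1 ≤ n) {D : ℕ} {L : ℝ} (hD : 1 ≤ D) (hL : 1 ≤ L) (h : Real.log D ≤ L) :
    |Wer n D| ≤ 14 * L^(n+1) := by
  have hlD0 : 0 ≤ Real.log D := Real.log_natCast_nonneg D
  have := Wer_bd n hn D hD
  have w1 := (abs_le.mp this).2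
  have w2 : Real.log D ^ (n+1) / (n+1) ≤ L^(n+1) := by
    refine (div_le_self (by positivity) (by linarith [(Nat.cast_nonneg n : (0:ℝ) ≤ n)])).trans ?_
    gcongr
  have w3 : Real.log D ^ n ≤ L^(n+1) := by
    calc Real.log D ^ n ≤ L^n := by gcongr
      _ ≤ L^(n+1) := pow_le_pow_right₀ hL (by omega)
  rw [abs_of_nonneg]
  · linarith
  · exact Finset.sum_nonneg fun d _ => mul_nonneg (div_nonneg (lam_nonneg d) (by positivity))
      (pow_nonneg (Real.log_natCast_nonneg d) n)

lemma zeroSum_main (n : ℕ) (hn : 1 ≤ n) (δ : ℝ) (hδ : 0 < δ) : ∃ C > 0, ∃ T1 ≥ 10, ∀ T : ℝ, T1 ≤ T →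
    AdmissibleHeight δ T →
    ‖2 * Real.pi * zetaZeroSum n T + (((-1)^n * T * Wer n ⌊T / Real.log T ^ 4⌋₊ : ℝ) : ℂ)‖ ≤
      C * (T * Real.log T ^ n * √(Real.log T)) := by
  obtain ⟨t0, ht3, ht4, K, hK⟩ := zeroSum_eq n
  obtain ⟨C1, hC1, T1, hT1, h1⟩ := logDeriv_adm δ hδ
  obtain ⟨C2, hC2, h2⟩ := zetaD_strip n
  obtain ⟨C3, hC3, h3⟩ := logDeriv_edge
  obtain ⟨C4, hC4, h4⟩ := zetaD_right n
  obtain ⟨C5, hC5, h5⟩ := left_edge n hn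
  obtain ⟨C6, hC6, T6, hT6, h6⟩ := main_sum n hn
  obtain ⟨T7, hT7, h7⟩ := ev_T 1
  set f : ℂ → ℂ := fun z => deriv riemannZeta z / riemannZeta z * iteratedDeriv n riemannZeta z with hf
  set bot : ℂ := ∫ x in (-1/8:ℝ)..(9/8:ℝ), f (x + t0*I) with hbot
  refine ⟨‖K‖ + ‖bot‖ + 320 * C1 * C2 + C3*C4 + C5 + C6 + 56, by positivity,
    max (max T1 T6) T7, le_max_of_le_right hT7, ?_⟩
  intro T hT hadm
  have hT1' : T1 ≤ T := ((le_max_left _ _).trans (le_max_left _ _)).trans hT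
  have hT6' : T6 ≤ T := ((le_max_right _ _).trans (le_max_left _ _)).trans hT
  have hT7' : T7 ≤ T := (le_max_right _ _).trans hT
  have hT10 : 10 ≤ T := by linarith
  have hT0 : 0 < T := by linarith
  have ht0T : t0 ≤ T := by linarith
  have hY := h7 T hT7'
  set L := Real.log T with hL
  have hL1 : 1 ≤ L := log_ge_one hT10
  set D := ⌊T / L^4⌋₊ with hD
  have hD1 : 1 ≤ D := Nat.le_floor (by simpa using hY)
  have hDT : (D:ℝ) ≤ T := (Nat.floor_le (by positivity)).trans (div_le_self hT0.le (one_le_pow₀ hL1))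
  have hlD : Real.log D ≤ L := Real.log_le_log (by exact_mod_cast hD1) hDT
  have hW := Wer_le n hn hD1 hL1 hlD
  have hz := fun σ h1' h2' => h1 T hT1' hadm σ h1' h2'
  have hEq := hK T ht0T (fun σ a b => (hz σ a b).1)
  obtain ⟨S, hS, hS2⟩ := h5 t0 T ht3 ht0T
  have hS3 := h6 t0 T ht3 ht4 hT6' S hS
  have hsL : 1 ≤ √L := Real.one_le_sqrt.mpr hL1
  have hLn : 1 ≤ L^n := one_le_pow₀ hL1
  set top : ℂ := ∫ x in (-1/8:ℝ)..(9/8:ℝ), f (x + T*I) with htop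
  set right : ℂ := ∫ y in t0..T, f (((9/8:ℝ):ℂ) + y*I) with hright
  set left : ℂ := ∫ y in t0..T, f (((-1/8:ℝ):ℂ) + y*I) with hleft
  set P := T * L^n * √L with hP
  have hTP : T ≤ P := by
    calc T = T * 1 * 1 := by ring
      _ ≤ _ := by rw [hP]; gcongr
  have hP1 : 1 ≤ P := by linarith
  -- top
  have btop : ‖top‖ ≤ 320 * C1 * C2 * T := by
    have a0 : ‖top‖ ≤ (C1 * L^2) * (C2 * T^(7/8:ℝ)) * |9/8 - (-1/8:ℝ)| := by
      apply intervalIntegral.norm_integral_le_of_norm_le_const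
      intro x hx
      rw [Set.uIoc_of_le (by norm_num)] at hx
      rw [hf]
      simp only [norm_mul]
      have b1 := (hz x hx.1.le hx.2).2
      have b2 := h2 x T (by linarith [hx.1]) (by linarith [hx.2]) (by linarith)
      gcongr
    have a1 : L^2 ≤ 256 * T^(1/8:ℝ) := by
      have c1 := Real.log_le_rpow_div (x := T) hT0.le (ε := 1/16) (by norm_num)
      have c2 : T^(1/8:ℝ) = T^(1/16:ℝ) * T^(1/16:ℝ) := by rw [← Real.rpow_add hT0]; norm_num
      rw [← hL] at c1
      calc L^2 ≤ (T^(1/16:ℝ)/(1/16))^2 := by gcongr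
        _ = _ := by rw [c2]; ring
    refine a0.trans ?_
    rw [show |9/8 - (-1/8:ℝ)| = 5/4 by norm_num]
    calc _ ≤ (C1 * (256 * T^(1/8:ℝ))) * (C2 * T^(7/8:ℝ)) * (5/4) := by gcongr
      _ = 320 * C1 * C2 * (T^(1/8:ℝ) * T^(7/8:ℝ)) := by ring
      _ = _ := by rw [← Real.rpow_add hT0]; norm_num
  have bright : ‖right‖ ≤ C3 * C4 * T := by
    have a0 : ‖right‖ ≤ C3 * C4 * |T - t0| := by
      apply intervalIntegral.norm_integral_le_of_norm_le_const
      intro y _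
      rw [hf]
      simp only [norm_mul]
      have := h3 y
      have := h4 y
      gcongr
    refine a0.trans ?_
    gcongr
    rw [abs_of_nonneg (by linarith)]; linarith
  have bW : ‖(((-1)^n * t0 * Wer n D : ℝ) : ℂ)‖ ≤ 56 * P := by
    rw [Complex.norm_real, Real.norm_eq_abs, abs_mul, abs_mul, abs_pow, abs_neg, abs_one, one_pow, one_mul,
      abs_of_nonneg (by linarith : 0 ≤ t0)]
    have hLT : L ≤ T := (Real.log_le_sub_one_of_pos hT0).trans (by linarith)
    calc t0 * |Wer n D| ≤ 4 * (14 * L^(n+1)) := by gcongr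
      _ = 56 * (L * L^n * 1) := by rw [pow_succ]; ring
      _ ≤ _ := by rw [hP]; gcongr
  have e : I * (2 * Real.pi * zetaZeroSum n T + (((-1)^n * T * Wer n D : ℝ) : ℂ)) =
      K + bot - top + I * right - I * (left - S) - I * (S - (((-1)^n * (T-t0) * Wer n D : ℝ) : ℂ))
      + I * (((-1)^n * t0 * Wer n D : ℝ) : ℂ) := by
    have e0 : rectI f (-1/8) (9/8) t0 T = bot - top + I * right - I * left := rfl
    rw [e0] at hEq
    have : I * (2 * Real.pi * zetaZeroSum n T) = K + (bot - top + I * right - I * left) := by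
      rw [← hEq]; ring
    rw [mul_add, this]
    push_cast
    ring
  have hIn : ∀ z : ℂ, ‖I * z‖ = ‖z‖ := fun z => by rw [norm_mul, Complex.norm_I, one_mul]
  rw [← hIn, e]
  have hfin : ‖K + bot - top + I * right - I * (left - S) - I * (S - (((-1)^n * (T-t0) * Wer n D : ℝ) : ℂ))
      + I * (((-1)^n * t0 * Wer n D : ℝ) : ℂ)‖ ≤ ‖K‖ + ‖bot‖ + ‖top‖ + ‖right‖ + ‖left - S‖ +
      ‖S - (((-1)^n * (T-t0) * Wer n D : ℝ) : ℂ)‖ + ‖(((-1)^n * t0 * Wer n D : ℝ) : ℂ)‖ := by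
    refine (norm_add_le _ _).trans ?_
    rw [hIn]; gcongr
    refine (norm_sub_le _ _).trans ?_
    rw [hIn]; gcongr
    refine (norm_sub_le _ _).trans ?_
    rw [hIn]; gcongr
    refine (norm_add_le _ _).trans ?_
    rw [hIn]; gcongr
    refine (norm_sub_le _ _).trans ?_
    gcongr
    exact norm_add_le _ _
  refine hfin.trans ?_
  have z1 : ‖K‖ ≤ ‖K‖ * P := le_mul_of_one_le_right (norm_nonneg _) hP1
  have z2 : ‖bot‖ ≤ ‖bot‖ * P := le_mul_of_one_le_right (norm_nonneg _) hP1
  have z3 : 320 * C1 * C2 * T ≤ 320 * C1 * C2 * P := by gcongr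
  have z4 : C3 * C4 * T ≤ C3 * C4 * P := by gcongr
  have z5 : C5 * T ≤ C5 * P := by gcongr
  have z6 : ‖left - S‖ ≤ C5 * T := hS2
  linarith

end Shanks

namespace Shanks

lemma loglog_small : Tendsto (fun T : ℝ => Real.log (Real.log T) / Real.log T) atTop (nhds 0) :=
  (Real.isLittleO_log_id_atTop.tendsto_div_nhds_zero).comp Real.tendsto_log_atTop

lemma const_log_small (c : ℝ) : Tendsto (fun T : ℝ => c / Real.log T) atTop (nhds 0) :=
  tendsto_const_nhds.div_atTop Real.tendsto_log_atTop

lemma logD_tendsto : Tendsto (fun T : ℝ => Real.log ⌊T / Real.log T ^ 4⌋₊ / Real.log T) atTop (nhds 1) := by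
  obtain ⟨T1, hT1, h⟩ := ev_T 1
  have hlow : Tendsto (fun T : ℝ => 1 - 4 * (Real.log (Real.log T) / Real.log T) - Real.log 2 / Real.log T)
      atTop (nhds 1) := by
    have := ((loglog_small.const_mul 4).const_sub 1).sub (const_log_small (Real.log 2))
    simpa using this
  refine tendsto_of_tendsto_of_tendsto_of_le_of_le' hlow tendsto_const_nhds ?_ ?_
  · filter_upwards [eventually_ge_atTop T1] with T hT
    have hY := h T hT
    have hT10 : 10 ≤ T := by linarith
    have hL1 := log_ge_one hT10
    set L := Real.log T with hL
    have hD1 : 1 ≤ ⌊T / L^4⌋₊ := Nat.le_floor (by simpa using hY)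
    have hD1' : (1:ℝ) ≤ ⌊T / L^4⌋₊ := by exact_mod_cast hD1
    have hlt := Nat.lt_floor_add_one (T / L^4)
    have h2 : T / L^4 / 2 ≤ ⌊T / L^4⌋₊ := by linarith
    have hT0 : 0 < T := by linarith
    have h3 := Real.log_le_log (by positivity) h2
    rw [Real.log_div (by positivity) (by norm_num), Real.log_div (by positivity) (by positivity),
      Real.log_pow, ← hL] at h3
    rw [le_div_iff₀ (by linarith)]
    refine le_trans (le_of_eq ?_) h3
    have : L ≠ 0 := by positivity
    field_simp
    push_cast; ring
  · filter_upwards [eventually_ge_atTop T1] with T hT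
    have hY := h T hT
    have hT10 : 10 ≤ T := by linarith
    have hL1 := log_ge_one hT10
    have hT0 : 0 < T := by linarith
    have hD1 : 1 ≤ ⌊T / Real.log T^4⌋₊ := Nat.le_floor (by simpa using hY)
    have hDT : (⌊T / Real.log T^4⌋₊:ℝ) ≤ T :=
      (Nat.floor_le (by positivity)).trans (div_le_self hT0.le (one_le_pow₀ hL1))
    rw [div_le_one (by linarith)]
    exact Real.log_le_log (by exact_mod_cast hD1) hDT

lemma Wer_tendsto (n : ℕ) (hn : 1 ≤ n) :
    Tendsto (fun T : ℝ => Wer n ⌊T / Real.log T ^ 4⌋₊ / Real.log T ^ (n+1)) atTop (nhds (1/(n+1))) := by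
  have h1 : Tendsto (fun T : ℝ => (Real.log ⌊T / Real.log T ^ 4⌋₊ / Real.log T)^(n+1) / (n+1)) atTop
      (nhds (1/(n+1))) := by
    have := (logD_tendsto.pow (n+1)).div_const ((n:ℝ)+1)
    simpa using this
  have h2 : Tendsto (fun T : ℝ => Wer n ⌊T / Real.log T ^ 4⌋₊ / Real.log T ^ (n+1) -
      (Real.log ⌊T / Real.log T ^ 4⌋₊ / Real.log T)^(n+1) / (n+1)) atTop (nhds 0) := by
    refine squeeze_zero_norm' ?_ (const_log_small 13)
    obtain ⟨T1, hT1, h⟩ := ev_T 1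
    filter_upwards [eventually_ge_atTop T1] with T hT
    have hY := h T hT
    have hT10 : 10 ≤ T := by linarith
    have hL1 := log_ge_one hT10
    have hT0 : 0 < T := by linarith
    set L := Real.log T with hL
    set D := ⌊T / L^4⌋₊ with hD
    have hD1 : 1 ≤ D := Nat.le_floor (by simpa using hY)
    have hDT : (D:ℝ) ≤ T :=
      (Nat.floor_le (by positivity)).trans (div_le_self hT0.le (one_le_pow₀ hL1))
    have hlD : Real.log D ≤ L := Real.log_le_log (by exact_mod_cast hD1) hDT
    have hlD0 : 0 ≤ Real.log D := Real.log_natCast_nonneg D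
    have hW := Wer_bd n hn D hD1
    have hL0 : 0 < L := by linarith
    have e : Wer n D / L ^ (n+1) - (Real.log D / L)^(n+1) / (n+1) =
        (Wer n D - Real.log D ^ (n+1) / (n+1)) / L^(n+1) := by
      rw [div_pow]; ring
    rw [e, Real.norm_eq_abs, abs_div, abs_of_pos (by positivity : 0 < L^(n+1)),
      div_le_div_iff₀ (by positivity) hL0]
    calc _ ≤ 13 * Real.log D ^ n * L := by gcongr
      _ ≤ 13 * L^n * L := by gcongr
      _ = _ := by ring
  have := h2.add h1
  simpa using this

lemma log_ratio : Tendsto (fun T : ℝ => Real.log T / Real.log (T / (2*Real.pi))) atTop (nhds 1) := by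
  have h : Tendsto (fun T : ℝ => 1 - Real.log (2*Real.pi) / Real.log T) atTop (nhds 1) := by
    simpa using (const_log_small (Real.log (2*Real.pi))).const_sub 1
  have h2 := h.inv₀ one_ne_zero
  rw [inv_one] at h2
  refine h2.congr' ?_
  filter_upwards [eventually_ge_atTop 10] with T hT
  have hL := log_ge_one hT
  have hpi := Real.pi_pos
  rw [Real.log_div (by linarith) (by positivity)]
  have hL0 : Real.log T ≠ 0 := by linarith
  have e : 1 - Real.log (2*Real.pi) / Real.log T =
      (Real.log T - Real.log (2*Real.pi)) / Real.log T := by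
    rw [sub_div, div_self hL0]
  rw [e, inv_div]

lemma sqrt_small : Tendsto (fun T : ℝ => √(Real.log T) / Real.log T) atTop (nhds 0) := by
  have h : Tendsto (fun T : ℝ => (√(Real.log T))⁻¹) atTop (nhds 0) :=
    tendsto_inv_atTop_zero.comp (Real.tendsto_sqrt_atTop.comp Real.tendsto_log_atTop)
  refine h.congr fun T => ?_
  rw [Real.sqrt_div_self', one_div]

lemma shanks_tendsto (n : ℕ) (hn : 1 ≤ n) (δ : ℝ) (hδ : 0 < δ) :
    Tendsto
      (fun T : ℝ => zetaZeroSum n T /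
        (((T / (2 * Real.pi)) * Real.log (T / (2 * Real.pi)) ^ (n + 1) : ℝ) : ℂ))
      (atTop ⊓ Filter.principal {T : ℝ | AdmissibleHeight δ T})
      (nhds ((((-1 : ℝ) ^ (n + 1) / (n + 1) : ℝ)) : ℂ)) := by
  obtain ⟨C, hC, T1, hT1, h⟩ := zeroSum_main n hn δ hδ
  set l := atTop ⊓ Filter.principal {T : ℝ | AdmissibleHeight δ T} with hl
  have hle : l ≤ atTop := inf_le_left
  have hpi := Real.pi_pos
  -- ratio with the full logarithm
  have hA : Tendsto (fun T : ℝ => (2 * Real.pi * zetaZeroSum n T +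
      (((-1)^n * T * Wer n ⌊T / Real.log T ^ 4⌋₊ : ℝ) : ℂ)) / ((T * Real.log T ^ (n+1) : ℝ):ℂ)) l (nhds 0) := by
    have hlim : Tendsto (fun T : ℝ => C * (√(Real.log T) / Real.log T)) l (nhds 0) := by
      simpa using (sqrt_small.mono_left hle).const_mul C
    refine squeeze_zero_norm' ?_ hlim
    have hev : ∀ᶠ T in l, T1 ≤ T := hle (eventually_ge_atTop T1)
    have hev2 : ∀ᶠ T in l, AdmissibleHeight δ T :=
      (inf_le_right : l ≤ _) (Filter.mem_principal_self _)
    filter_upwards [hev, hev2] with T hT hadm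
    have hb := h T hT hadm
    have hT10 : 10 ≤ T := by linarith
    have hL1 := log_ge_one hT10
    have hT0 : 0 < T := by linarith
    have hL0 : 0 < Real.log T := by linarith
    have hp : 0 < T * Real.log T ^ (n+1) := by positivity
    rw [norm_div, Complex.norm_real, Real.norm_of_nonneg hp.le, div_le_iff₀ hp]
    refine hb.trans (le_of_eq ?_)
    rw [pow_succ]; field_simp
  have hB : Tendsto (fun T : ℝ => (((-1)^n * (Wer n ⌊T / Real.log T ^ 4⌋₊ / Real.log T ^ (n+1)) : ℝ) : ℂ)) l
      (nhds (((-1)^n * (1/(n+1)) : ℝ) : ℂ)) :=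
    (Complex.continuous_ofReal.tendsto _).comp (((Wer_tendsto n hn).mono_left hle).const_mul _)
  have hR : Tendsto (fun T : ℝ => (((Real.log T / Real.log (T / (2*Real.pi)))^(n+1) : ℝ):ℂ)) l (nhds ((1:ℝ):ℂ)) := by
    have := ((log_ratio.mono_left hle).pow (n+1))
    rw [one_pow] at this
    exact (Complex.continuous_ofReal.tendsto _).comp this
  have hfin := (hA.sub hB).mul hR
  have hval : (0 - (((-1)^n * (1/(n+1)) : ℝ) : ℂ)) * ((1:ℝ):ℂ) = (((-1 : ℝ) ^ (n + 1) / (n + 1) : ℝ) : ℂ) := by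
    push_cast; rw [pow_succ]; ring
  rw [hval] at hfin
  refine hfin.congr' ?_
  have hev : ∀ᶠ T in l, 100 ≤ T := hle (eventually_ge_atTop 100)
  filter_upwards [hev] with T hT
  have hT0 : 0 < T := by linarith
  have hL0 : 0 < Real.log T := by linarith [log_ge_one (by linarith : 10 ≤ T)]
  have hl0 : 0 < Real.log (T/(2*Real.pi)) := by
    apply Real.log_pos
    rw [lt_div_iff₀ (by positivity)]
    have := Real.pi_lt_d2
    linarith
  have c1 : (T:ℂ) ≠ 0 := by exact_mod_cast hT0.ne'
  have c2 : ((Real.log T : ℝ):ℂ) ≠ 0 := by exact_mod_cast hL0.ne'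
  have c3 : ((Real.log (T/(2*Real.pi)) : ℝ):ℂ) ≠ 0 := by exact_mod_cast hl0.ne'
  have c4 : ((Real.pi : ℝ):ℂ) ≠ 0 := by exact_mod_cast hpi.ne'
  simp only [Complex.ofReal_mul, Complex.ofReal_div, Complex.ofReal_pow, Complex.ofReal_neg,
    Complex.ofReal_one, Complex.ofReal_ofNat]
  generalize ((Real.log (T/(2*Real.pi)) : ℝ):ℂ) = x at *
  generalize ((Real.log T : ℝ):ℂ) = y at *
  rw [div_pow]
  have c3' := pow_ne_zero (n+1) c3
  have c2' := pow_ne_zero (n+1) c2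
  generalize x ^ (n+1) = X at *
  generalize y ^ (n+1) = Y at *
  field_simp
  ring

end Shanks

/-- as `T → ∞` through admissible values, the ratio
`(∑_{0<γ≤T} ζ^{(n)}(ρ)) / ((T/2π) log^{n+1}(T/2π))` tends to the real number
`(-1)^{n+1}/(n+1)`; in particular `ζ^{(n)}(ρ)` is real and positive in the
mean for `n` odd, and real and negative in the mean for `n` even. -/
theorem generalised_shanks (n : ℕ) (hn : 1 ≤ n) (δ : ℝ) (hδ : 0 < δ) :
    Tendsto
      (fun T : ℝ => zetaZeroSum n T /
        (((T / (2 * Real.pi)) * Real.log (T / (2 * Real.pi)) ^ (n + 1) : ℝ) : ℂ))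
      (atTop ⊓ Filter.principal {T : ℝ | AdmissibleHeight δ T})
      (nhds ((((-1 : ℝ) ^ (n + 1) / (n + 1) : ℝ)) : ℂ))
    ∧ (Odd n → 0 < ((-1 : ℝ) ^ (n + 1) / (n + 1) : ℝ))
    ∧ (Even n → ((-1 : ℝ) ^ (n + 1) / (n + 1) : ℝ) < 0) := by
  refine ⟨Shanks.shanks_tendsto n hn δ hδ, fun h => ?_, fun h => ?_⟩
  · rw [h.add_one.neg_one_pow]
    positivity
  · rw [h.add_one.neg_one_pow]
    exact div_neg_of_neg_of_pos (by norm_num) (by positivity)
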